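/- Let ℋ = {H₁, …, H_p} be a finite family of subgroups of G, and assume G is finitely presented relative to ℋ. Then a JSJ tree of G over 𝒜 relative to ℋ exists: there is a universally elliptic (𝒜,ℋ)-tree dominating every universally elliptic (𝒜,ℋ)-tree. Moreover it can be chosen with all edge stabilizers finitely generated, and with all vertex stabilizers finitely generated if every Hᵢ is finitely generated. -/

import Mathlib

universe u v

/-- A `G`-tree: a nonempty simple graph which is a tree (connected and acyclic),
with a minimal action of `G` by graph automorphisms without inversions. -/
structure GTree (G : Type u) [Group G] : Type (u + 1) where
  V : Type u
  graph : SimpleGraph V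
  nonempty : Nonempty V
  connected : graph.Connected
  acyclic : graph.IsAcyclic
  act : G → V → V
  act_one : ∀ w, act 1 w = w
  act_mul : ∀ g h w, act (g * h) w = act g (act h w)
  act_adj : ∀ g a b, graph.Adj a b → graph.Adj (act g a) (act g b)
  noInversion : ∀ g a b, graph.Adj a b → ¬(act g a = b ∧ act g b = a)
  minimal : ∀ S : Set V, S.Nonempty → (∀ g, ∀ w ∈ S, act g w ∈ S) →
    (graph.induce S).Connected → S = Set.univ

namespace GTree

variable {G : Type u} [Group G]

/-- The stabilizer of a vertex. -/
def vertexStab (T : GTree G) (w : T.V) : Subgroup G where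
  carrier := {g | T.act g w = w}
  one_mem' := T.act_one w
  mul_mem' := by
    intro a b ha hb
    simp only [Set.mem_setOf_eq] at *
    rw [T.act_mul, hb, ha]
  inv_mem' := by
    intro a ha
    simp only [Set.mem_setOf_eq] at *
    calc T.act a⁻¹ w = T.act a⁻¹ (T.act a w) := by rw [ha]
    _ = T.act (a⁻¹ * a) w := (T.act_mul _ _ _).symm
    _ = w := by rw [inv_mul_cancel, T.act_one]

/-- The stabilizer of an edge `{u,v}`: elements fixing both endpoints. -/
def edgeStab (T : GTree G) (a b : T.V) : Subgroup G :=
  T.vertexStab a ⊓ T.vertexStab b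

/-- A subgroup is elliptic in `T` if it fixes a vertex. -/
def EllipticSubgroup (T : GTree G) (H : Subgroup G) : Prop :=
  ∃ w : T.V, ∀ h ∈ H, T.act h w = w

/-- An element is elliptic in `T` if it fixes a vertex (otherwise it is hyperbolic). -/
def EllipticElt (T : GTree G) (g : G) : Prop :=
  ∃ w : T.V, T.act g w = w

/-- `T₁` dominates `T₂`: every subgroup elliptic in `T₁` is elliptic in `T₂`. -/
def Dominates (T₁ T₂ : GTree G) : Prop :=
  ∀ H : Subgroup G, T₁.EllipticSubgroup H → T₂.EllipticSubgroup H

/-- `T` is an `𝒜`-tree: all its edge stabilizers belong to `𝒜`. -/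
def IsATree (T : GTree G) (𝒜 : Set (Subgroup G)) : Prop :=
  ∀ a b : T.V, T.graph.Adj a b → T.edgeStab a b ∈ 𝒜

/-- A subgroup is universally elliptic if it is elliptic in every `𝒜`-tree. -/
def UnivEllipticSubgroup (𝒜 : Set (Subgroup G)) (H : Subgroup G) : Prop :=
  ∀ T : GTree G, T.IsATree 𝒜 → T.EllipticSubgroup H

/-- An `𝒜`-tree is universally elliptic if all its edge stabilizers are universally elliptic. -/
def UnivEllipticTree (T : GTree G) (𝒜 : Set (Subgroup G)) : Prop :=
  ∀ a b : T.V, T.graph.Adj a b → UnivEllipticSubgroup 𝒜 (T.edgeStab a b)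

/-- A JSJ tree of `G` over `𝒜`: a universally elliptic `𝒜`-tree dominating every
universally elliptic `𝒜`-tree. -/
def IsJSJ (T : GTree G) (𝒜 : Set (Subgroup G)) : Prop :=
  T.IsATree 𝒜 ∧ T.UnivEllipticTree 𝒜 ∧
    ∀ T' : GTree G, T'.IsATree 𝒜 → T'.UnivEllipticTree 𝒜 → T.Dominates T'

/-- A collapse map `T → T'`: a `G`-equivariant surjection on vertices sending adjacent
vertices to adjacent or equal vertices, with connected point preimages. -/
def IsCollapseMap (T T' : GTree G) (f : T.V → T'.V) : Prop :=
  (∀ g w, f (T.act g w) = T'.act g (f w)) ∧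
    Function.Surjective f ∧
    (∀ a b : T.V, T.graph.Adj a b → f a = f b ∨ T'.graph.Adj (f a) (f b)) ∧
    ∀ w : T'.V, (T.graph.induce (f ⁻¹' {w})).Connected

end GTree

/-- `𝒜` is closed under conjugation and under passing to subgroups. -/
def ClosedFamily {G : Type u} [Group G] (𝒜 : Set (Subgroup G)) : Prop :=
  (∀ H ∈ 𝒜, ∀ g : G, Subgroup.map (MulAut.conj g).toMonoidHom H ∈ 𝒜) ∧
    ∀ H ∈ 𝒜, ∀ K : Subgroup G, K ≤ H → K ∈ 𝒜

/-- `G` is finitely presented: it admits a presentation with finitely many generators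
and finitely many relations. -/
def FinitelyPresentedGroup (G : Type u) [Group G] : Prop :=
  ∃ (n : ℕ) (rels : Set (FreeGroup (Fin n))),
    rels.Finite ∧ Nonempty (PresentedGroup rels ≃* G)

/-- `T` is an `(𝒜,ℋ)`-tree: an `𝒜`-tree in which every subgroup in `ℋ` is elliptic. -/
def RelATree {G : Type u} [Group G] (𝒜 ℋ : Set (Subgroup G)) (T : GTree G) : Prop :=
  T.IsATree 𝒜 ∧ ∀ H ∈ ℋ, T.EllipticSubgroup H

/-- A subgroup is universally elliptic relative to `ℋ` if it is elliptic in every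
`(𝒜,ℋ)`-tree. -/
def RelUnivEllipticSubgroup {G : Type u} [Group G] (𝒜 ℋ : Set (Subgroup G))
    (K : Subgroup G) : Prop :=
  ∀ T : GTree G, RelATree 𝒜 ℋ T → T.EllipticSubgroup K

/-- An `(𝒜,ℋ)`-tree is universally elliptic if all its edge stabilizers are universally
elliptic relative to `ℋ`. -/
def RelUnivEllipticTree {G : Type u} [Group G] (𝒜 ℋ : Set (Subgroup G))
    (T : GTree G) : Prop :=
  ∀ a b : T.V, T.graph.Adj a b → RelUnivEllipticSubgroup 𝒜 ℋ (T.edgeStab a b)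

/-- A JSJ tree of `G` over `𝒜` relative to `ℋ`. -/
def IsRelJSJ {G : Type u} [Group G] (𝒜 ℋ : Set (Subgroup G)) (T : GTree G) : Prop :=
  RelATree 𝒜 ℋ T ∧ RelUnivEllipticTree 𝒜 ℋ T ∧
    ∀ T' : GTree G, RelATree 𝒜 ℋ T' → RelUnivEllipticTree 𝒜 ℋ T' → T.Dominates T'

/-- The family of groups `F, H₁, …, H_p` whose free product is used to define relative
finite presentability. -/
def relFam {G : Type u} [Group G] {p : ℕ} (H : Fin p → Subgroup G) (n : ℕ) :
    Option (Fin p) → Type u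
  | none => FreeGroup (ULift.{u} (Fin n))
  | some j => H j

instance relFamGroup {G : Type u} [Group G] {p : ℕ} (H : Fin p → Subgroup G) (n : ℕ) :
    (i : Option (Fin p)) → Group (relFam H n i)
  | none => inferInstanceAs (Group (FreeGroup _))
  | some j => inferInstanceAs (Group (H j))

/-- `G` is finitely presented relative to `H₁, …, H_p`: there is a surjection from
`F ∗ H₁ ∗ ⋯ ∗ H_p` (with `F` a finitely generated free group) onto `G` restricting to
the inclusion on each `Hᵢ`, whose kernel is the normal closure of a finite subset. -/
def RelFinitelyPresented {G : Type u} [Group G] {p : ℕ} (H : Fin p → Subgroup G) : Prop :=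
  ∃ (n : ℕ) (φ : Monoid.CoprodI (relFam H n) →* G),
    Function.Surjective φ ∧
    (∀ (j : Fin p) (h : H j), φ (Monoid.CoprodI.of (M := relFam H n) (i := some j) h) = (h : G)) ∧
    ∃ s : Set (Monoid.CoprodI (relFam H n)), s.Finite ∧
      MonoidHom.ker φ = Subgroup.normalClosure s

/-- `S` has a single orbit of edges. -/
def OneEdgeOrbit {G : Type u} [Group G] (S : GTree G) : Prop :=
  ∀ e₁ ∈ S.graph.edgeSet, ∀ e₂ ∈ S.graph.edgeSet, ∃ g : G, Sym2.map (S.act g) e₁ = e₂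

/-- `G` splits over `K`: there is a nontrivial `G`-tree with a single orbit of edges
having `K` as an edge stabilizer. -/
def SplitsOver {G : Type u} [Group G] (K : Subgroup G) : Prop :=
  ∃ S : GTree G, Nontrivial S.V ∧ OneEdgeOrbit S ∧
    ∃ x y : S.V, S.graph.Adj x y ∧ S.edgeStab x y = K

/-- A subgroup is slender if all its subgroups are finitely generated. -/
def SlenderSubgroup {G : Type u} [Group G] (H : Subgroup G) : Prop :=
  ∀ K : Subgroup G, K ≤ H → K.FG

/-- A subgroup is abelian. -/
def AbelianSubgroup {G : Type u} [Group G] (H : Subgroup G) : Prop :=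
  ∀ a ∈ H, ∀ b ∈ H, a * b = b * a

/-- `H` is malnormal in `G`: `gHg⁻¹ ∩ H ≠ {1}` implies `g ∈ H`. -/
def Malnormal {G : Type u} [Group G] (H : Subgroup G) : Prop :=
  ∀ g : G, (∃ x ∈ H, x ≠ 1 ∧ g * x * g⁻¹ ∈ H) → g ∈ H

/-- `G` is CSA: the centralizer of every nontrivial element is abelian and malnormal. -/
def IsCSA (G : Type u) [Group G] : Prop :=
  ∀ g : G, g ≠ 1 →
    AbelianSubgroup (Subgroup.centralizer {g}) ∧ Malnormal (Subgroup.centralizer {g})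

open scoped Pointwise

/-- Two subsets are nested if some side of one is contained in some side of the other. -/
def Nested {Y : Type*} (A B : Set Y) : Prop :=
  A ⊆ B ∨ A ⊆ Bᶜ ∨ Aᶜ ⊆ B ∨ Aᶜ ⊆ Bᶜ

/-- The members of `𝓗` containing `y` but not `x`. -/
def wallsBetween {Y : Type*} (𝓗 : Set (Set Y)) (x y : Y) : Set (Set Y) :=
  {A | A ∈ 𝓗 ∧ x ∉ A ∧ y ∈ A}

/-- A `G`-invariant family of halfspaces which is closed under complement, pairwise nested, and
separates any two points only finitely often. -/
structure IsWallSystem (G : Type*) {Y : Type*} [Group G] [MulAction G Y] (𝓗 : Set (Set Y)) :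
    Prop where
  compl_mem : ∀ A ∈ 𝓗, Aᶜ ∈ 𝓗
  smul_mem : ∀ g : G, ∀ A ∈ 𝓗, g • A ∈ 𝓗
  nested : ∀ A ∈ 𝓗, ∀ B ∈ 𝓗, Nested A B
  finite : ∀ x y, (wallsBetween 𝓗 x y).Finite

/-- `𝓗` separates points. -/
def SeparatesPoints {Y : Type*} (𝓗 : Set (Set Y)) : Prop :=
  ∀ x y, (∀ A ∈ 𝓗, x ∈ A ↔ y ∈ A) → x = y

section WallCount

variable {Y : Type*} {Λ : Set (Set Y)}

/-- The number of walls separating two points, modulo two. -/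
noncomputable def wallParity (Λ : Set (Set Y)) (x y : Y) : ZMod 2 :=
  ((wallsBetween Λ x y).ncard : ZMod 2)

theorem wallParity_add (hc : ∀ A ∈ Λ, Aᶜ ∈ Λ) (hf : ∀ x y, (wallsBetween Λ x y).Finite)
    (x y z : Y) : wallParity Λ x y + wallParity Λ y z = wallParity Λ x z := by
  classical
  have split : ∀ (S : Set (Set Y)) (_ : S.Finite) (w : Y),
      S.ncard = (S ∩ {A | w ∈ A}).ncard + (S ∩ {A | w ∉ A}).ncard := by
    intro S hS w
    rw [← Set.ncard_union_eq _ (hS.inter_of_left _) (hS.inter_of_left _)]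
    · congr 1
      ext A
      by_cases h : w ∈ A <;> simp [h]
    · rw [Set.disjoint_left]
      rintro A ⟨_, h⟩ ⟨_, h'⟩
      exact h' h
  have e1 := split _ (hf x y) z
  have e2 := split _ (hf y z) x
  have e3 := split _ (hf x z) y
  have f1 : (wallsBetween Λ x y ∩ {A | z ∈ A}) = (wallsBetween Λ x z ∩ {A | y ∈ A}) := by
    ext A; simp only [wallsBetween, Set.mem_inter_iff, Set.mem_ofPred_eq]; tauto
  have f2 : (wallsBetween Λ y z ∩ {A | x ∉ A}) = (wallsBetween Λ x z ∩ {A | y ∉ A}) := by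
    ext A; simp only [wallsBetween, Set.mem_inter_iff, Set.mem_ofPred_eq]; tauto
  have f3 : (wallsBetween Λ y z ∩ {A | x ∈ A}) =
      compl '' (wallsBetween Λ x y ∩ {A | z ∉ A}) := by
    ext A
    simp only [wallsBetween, Set.mem_inter_iff, Set.mem_ofPred_eq, Set.mem_image]
    constructor
    · rintro ⟨⟨h1, h2, h3⟩, h4⟩
      exact ⟨Aᶜ, ⟨⟨hc _ h1, fun h => h h4, h2⟩, fun h => h h3⟩, compl_compl A⟩
    · rintro ⟨B, ⟨⟨h1, h2, h3⟩, h4⟩, rfl⟩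
      exact ⟨⟨hc _ h1, fun h => h h3, h4⟩, h2⟩
  have f4 : (wallsBetween Λ y z ∩ {A | x ∈ A}).ncard =
      (wallsBetween Λ x y ∩ {A | z ∉ A}).ncard := by
    rw [f3, Set.ncard_image_of_injective _ compl_injective]
  have key : (wallsBetween Λ x y).ncard + (wallsBetween Λ y z).ncard =
      (wallsBetween Λ x z).ncard + 2 * (wallsBetween Λ x y ∩ {A | z ∉ A}).ncard := by
    rw [e1, e2, e3, f1, f2, f4]; ring
  unfold wallParity
  have := congrArg (Nat.cast (R := ZMod 2)) key
  push_cast at this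
  rw [this]
  have h2 : (2 : ZMod 2) = 0 := rfl
  rw [h2]; ring

theorem wallParity_smul {G : Type*} [Group G] [MulAction G Y]
    (hs : ∀ g : G, ∀ A ∈ Λ, g • A ∈ Λ) (g : G) (x y : Y) :
    wallParity Λ (g • x) (g • y) = wallParity Λ x y := by
  unfold wallParity
  have : wallsBetween Λ (g • x) (g • y) = (fun A => g • A) '' wallsBetween Λ x y := by
    ext A
    simp only [wallsBetween, Set.mem_ofPred_eq, Set.mem_image]
    constructor
    · rintro ⟨h1, h2, h3⟩
      refine ⟨g⁻¹ • A, ⟨hs _ _ h1, ?_, ?_⟩, smul_inv_smul g A⟩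
      · rwa [Set.mem_inv_smul_set_iff]
      · rwa [Set.mem_inv_smul_set_iff]
    · rintro ⟨B, ⟨h1, h2, h3⟩, rfl⟩
      exact ⟨hs _ _ h1, by rwa [Set.smul_mem_smul_set_iff], by rwa [Set.smul_mem_smul_set_iff]⟩
  rw [this, Set.ncard_image_of_injective _ (MulAction.injective g)]

theorem wallsBetween_finite_of_chain {R : Y → Y → Prop}
    (hR : ∀ x y, R x y → (wallsBetween Λ x y).Finite) {x y : Y}
    (h : Relation.ReflTransGen R x y) : (wallsBetween Λ x y).Finite := by
  induction h with
  | refl =>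
    convert Set.finite_empty
    ext A; simp [wallsBetween]
  | tail _ h ih =>
    refine (ih.union (hR _ _ h)).subset ?_
    intro A hA
    simp only [wallsBetween, Set.mem_union, Set.mem_ofPred_eq] at *
    tauto

end WallCount

section Orbits

variable {G : Type*} [Group G]

/-- Equivariant maps exist as soon as stabilizers allow it. -/
theorem exists_equivariant {P Q : Type*} [MulAction G P] [MulAction G Q]
    (h : ∀ p : P, ∃ q : Q, ∀ g : G, g • p = p → g • q = q) :
    ∃ f : P → Q, ∀ (g : G) (p : P), f (g • p) = g • f p := by
  classical
  choose q hq using h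
  let rep : P → P := fun p => (Quotient.out (Quotient.mk (MulAction.orbitRel G P) p) : P)
  have hrep : ∀ p, ∃ g : G, g • rep p = p := by
    intro p
    have : p ∈ MulAction.orbit G (rep p) :=
      MulAction.orbitRel_apply.1
        (Quotient.exact (Quotient.out_eq (Quotient.mk (MulAction.orbitRel G P) p)).symm)
    exact this
  have hrepg : ∀ (g : G) p, rep (g • p) = rep p := by
    intro g p
    have : Quotient.mk (MulAction.orbitRel G P) (g • p) = Quotient.mk _ p :=
      Quotient.sound ⟨g, rfl⟩
    simp only [rep, this]
  choose t ht using hrep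
  refine ⟨fun p => t p • q (rep p), fun g p => ?_⟩
  have h1 := ht (g • p)
  rw [hrepg] at h1
  have h2 : ((t p)⁻¹ * g⁻¹ * t (g • p)) • rep p = rep p := by
    rw [mul_smul, mul_smul, h1, inv_smul_smul, inv_smul_eq_iff, ht]
  have h3 := hq _ _ h2
  rw [mul_smul, mul_smul, inv_smul_eq_iff, inv_smul_eq_iff] at h3
  simp only [hrepg]
  exact h3

/-- If a relation to a second `G`-set is finite-valued on finitely many orbit representatives,
then its fibres have finitely many orbits under the stabilizers. -/
theorem exists_finite_stabilizer_orbits {P S : Type*} [MulAction G P] [MulAction G S]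
    {F : Set P} (hF : F.Finite) (I : P → S → Prop)
    (hI : ∀ (g : G) p s, I p s → I (g • p) (g • s)) (hfin : ∀ p, {s | I p s}.Finite) (s : S) :
    ∃ F' : Set P, F'.Finite ∧ ∀ p, (∃ g : G, g • p ∈ F) → I p s →
      ∃ k ∈ MulAction.stabilizer G s, ∃ f ∈ F', p = k • f := by
  classical
  have hT : (⋃ x ∈ F, {s | I x s}).Finite := hF.biUnion fun x _ => hfin x
  let g0 : S → G := fun t => if h : ∃ g : G, g • t = s then h.choose else 1
  refine ⟨Set.image2 (fun t x => g0 t • x) (⋃ x ∈ F, {s | I x s}) F, hT.image2 _ hF, ?_⟩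
  rintro p ⟨g, hg⟩ hp
  have ht : ∃ g' : G, g' • (g • s) = s := ⟨g⁻¹, inv_smul_smul _ _⟩
  have hg0 : g0 (g • s) • g • s = s := by
    simp only [g0, dif_pos ht]; exact ht.choose_spec
  refine ⟨(g0 (g • s) * g)⁻¹, ?_, g0 (g • s) • g • p, ?_, ?_⟩
  · rw [inv_mem_iff, MulAction.mem_stabilizer_iff, mul_smul, hg0]
  · refine ⟨g • s, ?_, g • p, hg, rfl⟩
    simp only [Set.mem_iUnion]
    exact ⟨g • p, hg, hI _ _ _ hp⟩
  · rw [← mul_smul (g0 (g • s)) g p, inv_smul_smul]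

/-- The image of a finitely generated subgroup is finitely generated. -/
theorem Subgroup.FG.map_hom {G' : Type*} [Group G'] {K : Subgroup G} (h : K.FG) (f : G →* G') :
    (K.map f).FG := by
  obtain ⟨S, hS, hf⟩ := (Subgroup.fg_iff K).1 h
  rw [← hS, MonoidHom.map_closure]
  exact (Subgroup.fg_iff _).2 ⟨_, rfl, hf.image f⟩

/-- A group acting on a connected graph with finitely many orbits of edges and finitely generated
vertex stabilizers is finitely generated. -/
theorem fg_of_connected_action {P : Type*} [MulAction G P] (K : Subgroup G) (R : P → P → Prop)
    (p0 : P) (hconn : ∀ k ∈ K, Relation.ReflTransGen R p0 (k • p0))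
    {F : Set (P × P)} (hF : F.Finite)
    (hR : ∀ p p', R p p' → ∃ k ∈ K, ∃ f ∈ F, p = k • f.1 ∧ p' = k • f.2)
    (hst : ∀ p, Relation.ReflTransGen R p0 p → (MulAction.stabilizer G p ⊓ K).FG)
    : K.FG := by
  classical
  let F0 : Set P := insert p0 ((Prod.fst '' F) ∪ (Prod.snd '' F))
  have hF0 : F0.Finite := ((hF.image _).union (hF.image _)).insert _
  -- representatives that are translates of reachable points
  have hstab : ∀ f ∈ F0, (∃ k ∈ K, Relation.ReflTransGen R p0 (k • f)) →
      (MulAction.stabilizer G f ⊓ K).FG := by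
    rintro f - ⟨k, hk, h⟩
    have h1 := hst _ h
    have : MulAction.stabilizer G f ⊓ K =
        (MulAction.stabilizer G (k • f) ⊓ K).map (MulAut.conj k⁻¹).toMonoidHom := by
      ext x
      simp only [Subgroup.mem_inf, MulAction.mem_stabilizer_iff, Subgroup.mem_map,
        MulEquiv.coe_toMonoidHom, MulAut.conj_apply, inv_inv]
      constructor
      · rintro ⟨hx, hxK⟩
        exact ⟨k * x * k⁻¹, ⟨by rw [mul_smul, mul_smul, inv_smul_smul, hx],
          K.mul_mem (K.mul_mem hk hxK) (K.inv_mem hk)⟩, by group⟩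
      · rintro ⟨y, ⟨hy, hyK⟩, rfl⟩
        exact ⟨by rw [mul_smul, mul_smul, hy, inv_smul_smul],
          K.mul_mem (K.mul_mem (K.inv_mem hk) hyK) hk⟩
    rw [this]
    exact h1.map_hom _
  let tr : P → P → G := fun f f' => if h : ∃ k ∈ K, k • f = f' then h.choose else 1
  have trK : ∀ f f', tr f f' ∈ K := by
    intro f f'
    by_cases h : ∃ k ∈ K, k • f = f'
    · simp only [tr, dif_pos h]; exact h.choose_spec.1
    · simp only [tr, dif_neg h]; exact K.one_mem
  have trs : ∀ f f', (∃ k ∈ K, k • f = f') → tr f f' • f = f' := by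
    intro f f' h
    simp only [tr, dif_pos h]; exact h.choose_spec.2
  let st : P → Subgroup G := fun f =>
    if ∃ k ∈ K, Relation.ReflTransGen R p0 (k • f) then MulAction.stabilizer G f ⊓ K else ⊥
  let L : Subgroup G := (⨆ f : F0, st f) ⊔ Subgroup.closure (Set.image2 tr F0 F0)
  have hLK : L ≤ K := by
    refine sup_le (iSup_le fun f => ?_) ?_
    · by_cases h : ∃ k ∈ K, Relation.ReflTransGen R p0 (k • (f : P))
      · simp only [st, if_pos h]; exact inf_le_right
      · simp only [st, if_neg h]; exact bot_le
    · rw [Subgroup.closure_le]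
      rintro _ ⟨f, -, f', -, rfl⟩
      exact trK f f'
  have hLfg : L.FG := by
    have : Finite F0 := hF0
    refine Subgroup.FG.sup (Subgroup.FG.iSup _ fun f => ?_) ?_
    · by_cases h : ∃ k ∈ K, Relation.ReflTransGen R p0 (k • (f : P))
      · simp only [st, if_pos h]; exact hstab _ f.2 h
      · simp only [st, if_neg h]; exact Subgroup.FG.bot
    · exact (Subgroup.fg_iff _).2 ⟨_, rfl, hF0.image2 _ hF0⟩
  have hLst : ∀ f ∈ F0, (∃ k ∈ K, Relation.ReflTransGen R p0 (k • f)) →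
      ∀ k ∈ K, k • f = f → k ∈ L := by
    intro f hf h k hk hkf
    refine (le_sup_left : _ ≤ L) ((le_iSup (fun f : F0 => st f) ⟨f, hf⟩) ?_)
    simp only [st, if_pos h]
    exact ⟨hkf, hk⟩
  have hLtr : ∀ f ∈ F0, ∀ f' ∈ F0, tr f f' ∈ L := fun f hf f' hf' =>
    (le_sup_right : _ ≤ L) (Subgroup.subset_closure ⟨f, hf, f', hf', rfl⟩)
  have main : ∀ p, Relation.ReflTransGen R p0 p → ∃ l ∈ L, ∃ f ∈ F0, p = l • f := by
    intro p hp
    induction hp with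
    | refl => exact ⟨1, L.one_mem, p0, Set.mem_insert _ _, (one_smul _ _).symm⟩
    | @tail p p' hp h ih =>
      obtain ⟨l, hl, f, hf, rfl⟩ := ih
      obtain ⟨k, hk, ⟨x, y⟩, hxy, h1, rfl⟩ := hR _ _ h
      have hx : x ∈ F0 := Or.inr (Or.inl ⟨_, hxy, rfl⟩)
      have hy : y ∈ F0 := Or.inr (Or.inr ⟨_, hxy, rfl⟩)
      simp only at h1 ⊢
      have hlK := hLK hl
      have ht := trs f x ⟨k⁻¹ * l, K.mul_mem (K.inv_mem hk) hlK, by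
        rw [mul_smul, h1, inv_smul_smul]⟩
      have hz : l⁻¹ * k * tr f x ∈ L := by
        refine hLst f hf ⟨l, hlK, hp⟩ _
          (K.mul_mem (K.mul_mem (K.inv_mem hlK) hk) (trK _ _)) ?_
        rw [mul_smul, mul_smul, ht, ← h1, inv_smul_smul]
      have hk' : k ∈ L := by
        have := L.mul_mem (L.mul_mem hl hz) (L.inv_mem (hLtr f hf x hx))
        simpa [mul_assoc] using this
      exact ⟨k, hk', y, hy, rfl⟩
  have : K = L := by
    refine le_antisymm (fun k hk => ?_) hLK
    obtain ⟨l, hl, f, hf, h⟩ := main _ (hconn k hk)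
    have h0 : p0 ∈ F0 := Set.mem_insert _ _
    have ht := trs p0 f ⟨l⁻¹ * k, K.mul_mem (K.inv_mem (hLK hl)) hk, by
      rw [mul_smul, h, inv_smul_smul]⟩
    have hz : k⁻¹ * l * tr p0 f ∈ L := by
      refine hLst p0 h0 ⟨1, K.one_mem, by rw [one_smul]⟩ _
        (K.mul_mem (K.mul_mem (K.inv_mem hk) (hLK hl)) (trK _ _)) ?_
      rw [mul_smul, mul_smul, ht, ← h, inv_smul_smul]
    have := L.mul_mem (L.mul_mem hl (hLtr p0 h0 f hf)) (L.inv_mem hz)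
    simpa [mul_assoc] using this
  rw [this]; exact hLfg

end Orbits

section TreeSides

variable {X : Type*} {Γ : SimpleGraph X}

/-- The vertices closer to `u'` than to `u`. -/
def treeSide (Γ : SimpleGraph X) (u u' : X) : Set X := {x | Γ.dist x u' < Γ.dist x u}

theorem walk_length_of_cross {Z : Set X} {u u' : X}
    (hZ : ∀ a b, Γ.Adj a b → a ∉ Z → b ∈ Z → a = u ∧ b = u') {x y : X} (w : Γ.Walk x y)
    (hx : x ∉ Z) (hy : y ∈ Z) : Γ.dist x u + 1 + Γ.dist u' y ≤ w.length := by
  induction w with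
  | nil => exact absurd hy hx
  | @cons a b c h w ih =>
    by_cases hb : b ∈ Z
    · obtain ⟨rfl, rfl⟩ := hZ _ _ h hx hb
      have := SimpleGraph.dist_le w
      simp only [SimpleGraph.dist_self, SimpleGraph.Walk.length_cons]
      omega
    · have h1 := ih hb hy
      have h2 : Γ.dist a u ≤ Γ.dist b u + 1 := by
        by_cases hr : Γ.Reachable b u
        · obtain ⟨q, hq⟩ := hr.exists_walk_length_eq_dist
          have := SimpleGraph.dist_le (SimpleGraph.Walk.cons h q)
          rw [SimpleGraph.Walk.length_cons, hq] at this
          exact this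
        · have : ¬ Γ.Reachable a u := fun h' => hr (h.symm.reachable.trans h')
          rw [SimpleGraph.dist_eq_zero_of_not_reachable this]
          omega
      rw [SimpleGraph.Walk.length_cons]
      omega

theorem treeSide_aux (hT : Γ.IsTree) {u u' : X} (h : Γ.Adj u u') :
    (∀ a b, Γ.Adj a b → a ∉ treeSide Γ u u' → b ∈ treeSide Γ u u' → a = u ∧ b = u') ∧
      u' ∈ treeSide Γ u u' ∧ u ∉ treeSide Γ u u' := by
  have hbr := SimpleGraph.isAcyclic_iff_forall_adj_isBridge.1 hT.2 h
  rw [SimpleGraph.isBridge_iff] at hbr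
  let Z : Set X := {x | (Γ.deleteEdges {s(u, u')}).Reachable u' x}
  have hu' : u' ∈ Z := SimpleGraph.Reachable.refl _
  have hu : u ∉ Z := fun h => hbr h.symm
  have hZ : ∀ a b, Γ.Adj a b → a ∉ Z → b ∈ Z → a = u ∧ b = u' := by
    intro a b hab ha hb
    by_contra hne
    by_cases he : s(a, b) = s(u, u')
    · rw [Sym2.eq_iff] at he
      rcases he with he | ⟨rfl, rfl⟩
      · exact hne he
      · exact ha hu'
    · refine ha (SimpleGraph.Reachable.trans hb (SimpleGraph.Adj.reachable ?_))
      rw [SimpleGraph.deleteEdges_adj]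
      refine ⟨hab.symm, fun h => he ?_⟩
      rw [Sym2.eq_swap]; exact h
  have hZ' : ∀ a b, Γ.Adj a b → a ∉ Zᶜ → b ∈ Zᶜ → a = u' ∧ b = u := by
    intro a b hab ha hb
    exact (hZ b a hab.symm hb (not_not.1 ha)).symm
  have hEq : treeSide Γ u u' = Z := by
    ext x
    obtain ⟨p, hp⟩ := hT.1.exists_walk_length_eq_dist x u
    obtain ⟨q, hq⟩ := hT.1.exists_walk_length_eq_dist x u'
    by_cases hx : x ∈ Z
    · have := walk_length_of_cross hZ' p (not_not.2 hx) hu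
      simp only [hx, iff_true]
      change Γ.dist x u' < Γ.dist x u
      omega
    · have := walk_length_of_cross hZ q hx hu'
      simp only [hx, iff_false]
      change ¬ (Γ.dist x u' < Γ.dist x u)
      omega
  rw [hEq]
  exact ⟨hZ, hu', hu⟩

theorem treeSide_cross (hT : Γ.IsTree) {u u' a b : X} (h : Γ.Adj u u') (hab : Γ.Adj a b)
    (ha : a ∉ treeSide Γ u u') (hb : b ∈ treeSide Γ u u') : a = u ∧ b = u' :=
  (treeSide_aux hT h).1 a b hab ha hb

theorem treeSide_dist (hT : Γ.IsTree) {u u' x y : X} (h : Γ.Adj u u')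
    (hx : x ∉ treeSide Γ u u') (hy : y ∈ treeSide Γ u u') :
    Γ.dist x y = Γ.dist x u + 1 + Γ.dist u' y := by
  obtain ⟨p, hp⟩ := hT.1.exists_walk_length_eq_dist x y
  have h1 := walk_length_of_cross (treeSide_aux hT h).1 p hx hy
  have h2 := hT.1.dist_triangle (u := x) (v := u) (w := y)
  have h3 := hT.1.dist_triangle (u := u) (v := u') (w := y)
  rw [SimpleGraph.dist_eq_one_iff_adj.2 h] at h3
  omega

theorem treeSide_compl (hT : Γ.IsTree) {u u' : X} (h : Γ.Adj u u') :
    (treeSide Γ u u')ᶜ = treeSide Γ u' u := by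
  ext x
  constructor
  · intro hx
    have := treeSide_dist hT h hx (treeSide_aux hT h).2.1
    simp only [SimpleGraph.dist_self] at this
    change Γ.dist x u < Γ.dist x u'
    omega
  · intro hx hx'
    exact lt_asymm (show Γ.dist x u < Γ.dist x u' from hx) hx'

theorem Nested.compl_left {Y : Type*} {A B : Set Y} (h : Nested A B) : Nested Aᶜ B := by
  unfold Nested at *
  rw [compl_compl]
  tauto

theorem Nested.compl_right {Y : Type*} {A B : Set Y} (h : Nested A B) : Nested A Bᶜ := by
  unfold Nested at *
  rw [compl_compl]
  tauto

theorem treeSide_nested (hT : Γ.IsTree) {u u' v v' : X} (h : Γ.Adj u u') (h' : Γ.Adj v v') :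
    Nested (treeSide Γ u u') (treeSide Γ v v') := by
  have key : ∀ {u u' v v' : X}, Γ.Adj u u' → Γ.Adj v v' → v ∉ treeSide Γ u u' →
      v' ∉ treeSide Γ u u' → u ∉ treeSide Γ v v' → u' ∉ treeSide Γ v v' →
      treeSide Γ u u' ⊆ (treeSide Γ v v')ᶜ := by
    intro u u' v v' h h' a1 a2 a3 a4 x hx hx'
    have e1 := treeSide_dist hT h' a4 hx'
    have e2 := treeSide_dist hT h a2 hx
    omega
  by_cases hne : (u = v ∧ u' = v') ∨ (u = v' ∧ u' = v)
  · rcases hne with ⟨rfl, rfl⟩ | ⟨rfl, rfl⟩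
    · exact Or.inl subset_rfl
    · exact Or.inr (Or.inl (by rw [treeSide_compl hT h']))
  have c1 : (v ∈ treeSide Γ u u' ↔ v' ∈ treeSide Γ u u') := by
    constructor
    · intro ha
      by_contra hb
      have := treeSide_cross hT h h'.symm hb ha
      exact hne (Or.inr ⟨this.1.symm, this.2.symm⟩)
    · intro hb
      by_contra ha
      have := treeSide_cross hT h h' ha hb
      exact hne (Or.inl ⟨this.1.symm, this.2.symm⟩)
  have c2 : (u ∈ treeSide Γ v v' ↔ u' ∈ treeSide Γ v v') := by
    constructor
    · intro ha
      by_contra hb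
      have := treeSide_cross hT h' h.symm hb ha
      exact hne (Or.inr ⟨this.2, this.1⟩)
    · intro hb
      by_contra ha
      have := treeSide_cross hT h' h ha hb
      exact hne (Or.inl this)
  have n1 : ∀ {u u' x : X}, Γ.Adj u u' → x ∈ treeSide Γ u u' → x ∉ treeSide Γ u' u := by
    intro u u' x hu hx
    rw [← treeSide_compl hT hu]
    exact not_not.2 hx
  by_cases a : v ∈ treeSide Γ u u' <;> by_cases b : u ∈ treeSide Γ v v'
  · have := key h.symm h'.symm (n1 h (c1.1 a)) (n1 h a) (n1 h' (c2.1 b)) (n1 h' b)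
    rw [← treeSide_compl hT h, ← treeSide_compl hT h', compl_compl] at this
    exact Or.inr (Or.inr (Or.inl this))
  · have := key h.symm h' (n1 h a) (n1 h (c1.1 a)) (fun h => b (c2.2 h)) b
    rw [← treeSide_compl hT h] at this
    exact Or.inr (Or.inr (Or.inr this))
  · have := key h h'.symm (fun h => a (c1.2 h)) a (n1 h' b) (n1 h' (c2.1 b))
    rw [← treeSide_compl hT h', compl_compl] at this
    exact Or.inl this
  · exact Or.inr (Or.inl (key h h' a (fun h => a (c1.2 h)) b (fun h => b (c2.2 h))))

/-- The halfspaces of a tree. -/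
def treeWalls (Γ : SimpleGraph X) : Set (Set X) := {A | ∃ u u', Γ.Adj u u' ∧ A = treeSide Γ u u'}

theorem exists_treeSide_of_ne (hT : Γ.IsTree) {x y : X} (h : x ≠ y) :
    ∃ x', Γ.Adj x x' ∧ y ∈ treeSide Γ x x' := by
  obtain ⟨p, hp⟩ := hT.1.exists_walk_length_eq_dist x y
  cases p with
  | nil => exact absurd rfl h
  | @cons _ b _ hab w =>
    refine ⟨b, hab, ?_⟩
    have := SimpleGraph.dist_le w
    rw [SimpleGraph.Walk.length_cons] at hp
    change Γ.dist y b < Γ.dist y x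
    rw [SimpleGraph.dist_comm, Γ.dist_comm (u := y)]
    omega

theorem treeWalls_separates (hT : Γ.IsTree) : SeparatesPoints (treeWalls Γ) := by
  intro x y h
  by_contra hne
  obtain ⟨x', hx, hy⟩ := exists_treeSide_of_ne hT hne
  exact (treeSide_aux hT hx).2.2 ((h _ ⟨x, x', hx, rfl⟩).2 hy)

theorem treeSide_unique (hT : Γ.IsTree) {u v w y : X} (hv : Γ.Adj u v) (hw : Γ.Adj u w)
    (h1 : y ∈ treeSide Γ u v) (h2 : y ∈ treeSide Γ u w) : v = w := by
  by_cases h : w ∈ treeSide Γ u v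
  · exact (treeSide_cross hT hv hw (treeSide_aux hT hv).2.2 h).2.symm
  · have e1 := treeSide_dist hT hv h h1
    have e2 := treeSide_dist hT hv (treeSide_aux hT hv).2.2 h1
    rw [SimpleGraph.dist_eq_one_iff_adj.2 hw.symm] at e1
    rw [SimpleGraph.dist_self] at e2
    change Γ.dist y w < Γ.dist y u at h2
    rw [SimpleGraph.dist_comm, Γ.dist_comm (u := y)] at h2
    omega

/-- `m` lies on the majority side of every wall. -/
def IsMedian {Y : Type*} (𝓗 : Set (Set Y)) (m x y z : Y) : Prop :=
  ∀ A ∈ 𝓗, (m ∈ A ↔ (x ∈ A ∧ y ∈ A) ∨ (x ∈ A ∧ z ∈ A) ∨ (y ∈ A ∧ z ∈ A))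

theorem exists_treeMedian (hT : Γ.IsTree) (x y z : X) : ∃ m, IsMedian (treeWalls Γ) m x y z := by
  have : Nonempty X := ⟨x⟩
  let f : X → ℕ := fun m => Γ.dist m x + Γ.dist m y + Γ.dist m z
  let m : X := Function.argmin f
  have hm : ∀ w, f m ≤ f w := fun w => Function.argmin_le f w
  have key : ∀ u u', Γ.Adj u u' → m ∈ treeSide Γ u u' →
      (x ∈ treeSide Γ u u' ∧ y ∈ treeSide Γ u u') ∨ (x ∈ treeSide Γ u u' ∧ z ∈ treeSide Γ u u') ∨
        (y ∈ treeSide Γ u u' ∧ z ∈ treeSide Γ u u') := by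
    intro u u' h hmu
    have h1 := hm u
    have near : ∀ w, w ∉ treeSide Γ u u' → Γ.dist m w = Γ.dist m u' + 1 + Γ.dist u w := by
      intro w hw
      have e := treeSide_dist hT h hw hmu
      have e1 := Γ.dist_comm (u := m) (v := w)
      have e2 := Γ.dist_comm (u := u) (v := w)
      have e3 := Γ.dist_comm (u := m) (v := u')
      omega
    have far : ∀ w, Γ.dist u w ≤ Γ.dist m w + Γ.dist m u' + 1 := by
      intro w
      have e1 := hT.1.dist_triangle (u := u) (v := u') (w := w)
      have e2 := hT.1.dist_triangle (u := u') (v := m) (w := w)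
      rw [SimpleGraph.dist_eq_one_iff_adj.2 h] at e1
      have e3 := Γ.dist_comm (u := u') (v := m)
      omega
    have fx := far x
    have fy := far y
    have fz := far z
    simp only [f] at h1
    by_cases hx : x ∈ treeSide Γ u u' <;> by_cases hy : y ∈ treeSide Γ u u' <;>
      by_cases hz : z ∈ treeSide Γ u u' <;> simp only [hx, hy, hz, and_self, and_false, false_and,
        or_false, or_true]
    · have := near y hy; have := near z hz; omega
    · have := near x hx; have := near z hz; omega
    · have := near x hx; have := near y hy; omega
    · have := near x hx; have := near y hy; omega
  refine ⟨m, ?_⟩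
  rintro _ ⟨u, u', h, rfl⟩
  refine ⟨key u u' h, fun h3 => ?_⟩
  by_contra hmu
  have hmu' : m ∈ treeSide Γ u' u := by rw [← treeSide_compl hT h]; exact hmu
  have h4 := key u' u h.symm hmu'
  rw [← treeSide_compl hT h] at h4
  simp only [Set.mem_compl_iff] at h4
  tauto

theorem IsMedian.unique {Y : Type*} {𝓗 : Set (Set Y)} (hs : SeparatesPoints 𝓗)
    {m m' x y z x' y' z' : Y} (h : IsMedian 𝓗 m x y z) (h' : IsMedian 𝓗 m' x' y' z')
    (he : ∀ A ∈ 𝓗, ((x ∈ A ∧ y ∈ A) ∨ (x ∈ A ∧ z ∈ A) ∨ (y ∈ A ∧ z ∈ A)) ↔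
      ((x' ∈ A ∧ y' ∈ A) ∨ (x' ∈ A ∧ z' ∈ A) ∨ (y' ∈ A ∧ z' ∈ A))) : m = m' :=
  hs _ _ fun A hA => by rw [h A hA, h' A hA, he A hA]

end TreeSides

section TreeAction

variable {G : Type*} [Group G] {X : Type*} [MulAction G X] {Γ : SimpleGraph X}

theorem dist_smul_eq (hadj : ∀ (g : G) a b, Γ.Adj a b → Γ.Adj (g • a) (g • b)) (g : G) (x y : X) :
    Γ.dist (g • x) (g • y) = Γ.dist x y := by
  have key : ∀ (g : G) (x y : X), Γ.Reachable x y → Γ.dist (g • x) (g • y) ≤ Γ.dist x y := by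
    intro g x y hr
    obtain ⟨p, hp⟩ := hr.exists_walk_length_eq_dist
    let f : Γ →g Γ := ⟨fun x => g • x, fun h => hadj g _ _ h⟩
    have := SimpleGraph.dist_le (p.map f)
    rw [SimpleGraph.Walk.length_map, hp] at this
    exact this
  have hre : ∀ (g : G) (x y : X), Γ.Reachable x y → Γ.Reachable (g • x) (g • y) := by
    intro g x y hr
    let f : Γ →g Γ := ⟨fun x => g • x, fun h => hadj g _ _ h⟩
    exact hr.map f
  by_cases hr : Γ.Reachable x y
  · refine le_antisymm (key g x y hr) ?_
    have := key g⁻¹ _ _ (hre g x y hr)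
    rwa [inv_smul_smul, inv_smul_smul] at this
  · have hr' : ¬ Γ.Reachable (g • x) (g • y) := fun h => hr (by
      have := hre g⁻¹ _ _ h
      rwa [inv_smul_smul, inv_smul_smul] at this)
    rw [SimpleGraph.dist_eq_zero_of_not_reachable hr,
      SimpleGraph.dist_eq_zero_of_not_reachable hr']

theorem smul_treeSide (hadj : ∀ (g : G) a b, Γ.Adj a b → Γ.Adj (g • a) (g • b)) (g : G) (u u' : X) :
    g • treeSide Γ u u' = treeSide Γ (g • u) (g • u') := by
  ext x
  rw [Set.mem_smul_set_iff_inv_smul_mem]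
  change Γ.dist _ _ < Γ.dist _ _ ↔ Γ.dist _ _ < Γ.dist _ _
  rw [← dist_smul_eq hadj g, ← dist_smul_eq hadj g (g⁻¹ • x) u, smul_inv_smul]

theorem smul_treeSide_eq_self (hT : Γ.IsTree)
    (hadj : ∀ (g : G) a b, Γ.Adj a b → Γ.Adj (g • a) (g • b)) {g : G} {u u' : X} (h : Γ.Adj u u')
    (hg : g • treeSide Γ u u' = treeSide Γ u u') : g • u = u ∧ g • u' = u' := by
  rw [smul_treeSide hadj] at hg
  have h' := hadj g _ _ h
  obtain ⟨-, h1, h2⟩ := treeSide_aux hT h'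
  rw [hg] at h1 h2
  exact treeSide_cross hT h h' h2 h1

theorem isWallSystem_treeWalls (hT : Γ.IsTree)
    (hadj : ∀ (g : G) a b, Γ.Adj a b → Γ.Adj (g • a) (g • b)) :
    IsWallSystem G (treeWalls Γ) where
  compl_mem := by
    rintro _ ⟨u, u', h, rfl⟩
    exact ⟨u', u, h.symm, treeSide_compl hT h⟩
  smul_mem := by
    rintro g _ ⟨u, u', h, rfl⟩
    exact ⟨_, _, hadj g _ _ h, smul_treeSide hadj g u u'⟩
  nested := by
    rintro _ ⟨u, u', h, rfl⟩ _ ⟨v, v', h', rfl⟩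
    exact treeSide_nested hT h h'
  finite := by
    intro x y
    refine wallsBetween_finite_of_chain (R := Γ.Adj) ?_
      ((SimpleGraph.reachable_iff_reflTransGen _ _).1 (hT.1 x y))
    intro a b hab
    refine (Set.finite_singleton (treeSide Γ a b)).subset ?_
    rintro _ ⟨⟨u, u', h, rfl⟩, h1, h2⟩
    obtain ⟨rfl, rfl⟩ := treeSide_cross hT h hab h1 h2
    rfl

/-- `K₀` has index at most two in `K`. -/
def IndexLeTwo (K₀ K : Subgroup G) : Prop :=
  K₀ ≤ K ∧ ∀ g ∈ K, ∀ h ∈ K, g ∉ K₀ → h ∉ K₀ → g⁻¹ * h ∈ K₀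

theorem elliptic_of_indexLeTwo (hT : Γ.IsTree)
    (hadj : ∀ (g : G) a b, Γ.Adj a b → Γ.Adj (g • a) (g • b))
    (hinv : ∀ (g : G) a b, Γ.Adj a b → ¬ (g • a = b ∧ g • b = a)) {K₀ K : Subgroup G}
    (hK : IndexLeTwo K₀ K) (h0 : ∃ x : X, ∀ k ∈ K₀, k • x = x) : ∃ x : X, ∀ k ∈ K, k • x = x := by
  by_cases hex : ∃ g ∈ K, g ∉ K₀
  swap
  · push Not at hex
    obtain ⟨x, hx⟩ := h0
    exact ⟨x, fun k hk => hx k (hex k hk)⟩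
  obtain ⟨g, hg, hg0⟩ := hex
  have hginv : g⁻¹ ∉ K₀ := fun h => hg0 (inv_mem_iff.1 h)
  have hg2 : g * g ∈ K₀ := by
    have := hK.2 _ (K.inv_mem hg) _ hg hginv hg0
    rwa [inv_inv] at this
  have hconj : ∀ k ∈ K₀, g⁻¹ * k * g ∈ K₀ := by
    intro k hk
    rw [mul_assoc]
    refine hK.2 _ hg _ (K.mul_mem (hK.1 hk) hg) hg0 fun h => hg0 ?_
    exact (Subgroup.mul_mem_cancel_left _ hk).1 h
  let Fx : Set X := {x | ∀ k ∈ K₀, k • x = x}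
  have : Nonempty Fx := ⟨⟨h0.choose, h0.choose_spec⟩⟩
  let f : Fx → ℕ := fun x => Γ.dist (x : X) (g • (x : X))
  let m : Fx := Function.argmin f
  have hm : ∀ w, f m ≤ f w := fun w => Function.argmin_le f w
  obtain ⟨u, hu⟩ := m
  simp only [f] at hm
  have hgu : g • u ∈ Fx := by
    intro k hk
    have := hu _ (hconj k hk)
    rwa [mul_smul, mul_smul, inv_smul_eq_iff] at this
  have hggu : g • g • u = u := by rw [← mul_smul]; exact hu _ hg2
  by_cases hne : u = g • u
  · refine ⟨u, fun k hk => ?_⟩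
    by_cases hk0 : k ∈ K₀
    · exact hu k hk0
    · have := hu _ (hK.2 _ hg _ hk hg0 hk0)
      rw [mul_smul, inv_smul_eq_iff] at this
      rw [this, ← hne]
  · exfalso
    obtain ⟨u1, ha, hs⟩ := exists_treeSide_of_ne hT hne
    have hu1 : u1 ∈ Fx := by
      intro k hk
      have h1 := hadj k _ _ ha
      rw [hu k hk] at h1
      refine treeSide_unique hT h1 ha (y := g • u) ?_ hs
      have := Set.smul_mem_smul_set (a := k) hs
      rwa [smul_treeSide hadj, hgu k hk, hu k hk] at this
    have h2 := hm ⟨u1, hu1⟩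
    simp only at h2
    by_cases h3 : g • u1 ∈ treeSide Γ u u1
    · have e1 := treeSide_dist hT ha (treeSide_aux hT ha).2.2 h3
      have e2 := treeSide_dist hT ha (treeSide_aux hT ha).2.2 hs
      rw [SimpleGraph.dist_self] at e1
      have hs' := Set.smul_mem_smul_set (a := g) hs
      rw [smul_treeSide hadj, hggu] at hs'
      change Γ.dist _ _ < Γ.dist _ _ at hs'
      omega
    · have := treeSide_cross hT ha (hadj g _ _ ha).symm h3 hs
      exact hinv g _ _ ha ⟨this.2, this.1⟩

/-- A subgroup fixing a vertex fixes a vertex in every invariant subtree. -/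
theorem exists_fixed_of_invariant (hT : Γ.IsTree)
    (hadj : ∀ (g : G) a b, Γ.Adj a b → Γ.Adj (g • a) (g • b)) {M : Set X} (hne : M.Nonempty)
    (hc : (Γ.induce M).Connected) {K : Subgroup G} (hM : ∀ k ∈ K, ∀ x ∈ M, k • x ∈ M) {x : X}
    (hx : ∀ k ∈ K, k • x = x) : ∃ m ∈ M, ∀ k ∈ K, k • m = m := by
  have : Nonempty M := hne.to_subtype
  let f : M → ℕ := fun m => Γ.dist x (m : X)
  let m : M := Function.argmin f
  have hm : ∀ w, f m ≤ f w := fun w => Function.argmin_le f w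
  have nosep : ∀ n : M, f n = f m → ∀ y y' : M, Γ.Adj y y' →
      x ∈ treeSide Γ y y' → (n : X) ∉ treeSide Γ y y' → False := by
    intro n hn y y' h h1 h2
    have e := treeSide_dist hT h h2 h1
    have e2 := hm y'
    rw [← hn] at e2
    simp only [f] at e2
    rw [Γ.dist_comm] at e2
    have e3 := Γ.dist_comm (u := x) (v := y')
    omega
  have same : ∀ n : M, f n = f m → ∀ y y' : M, Γ.Adj y y' →
      (x ∈ treeSide Γ y y' ↔ (n : X) ∈ treeSide Γ y y') := by
    intro n hn y y' h
    constructor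
    · intro h1
      by_contra h2
      exact nosep n hn y y' h h1 h2
    · intro h1
      by_contra h2
      rw [← Set.mem_compl_iff, treeSide_compl hT h] at h2
      refine nosep n hn y' y h.symm h2 ?_
      rw [← treeSide_compl hT h]
      exact not_not.2 h1
  have uniq : ∀ n : M, f n = f m → n = m := by
    intro n hn
    have step : ∀ y y' : M, Γ.Adj y y' → ∀ c : ℤ, (Γ.dist (n : X) y : ℤ) - Γ.dist (m : X) y = c →
        (Γ.dist (n : X) y' : ℤ) - Γ.dist (m : X) y' = c := by
      intro y y' h c hc
      have a1 := same n hn y y' h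
      rw [same m rfl y y' h] at a1
      have b : ∀ w : X, w ∈ treeSide Γ y y' → Γ.dist w y = Γ.dist w y' + 1 := by
        intro w hw
        have := treeSide_dist hT h (treeSide_aux hT h).2.2 hw
        rw [SimpleGraph.dist_self, Γ.dist_comm, Γ.dist_comm (v := w)] at this
        omega
      have b' : ∀ w : X, w ∉ treeSide Γ y y' → Γ.dist w y' = Γ.dist w y + 1 := by
        intro w hw
        have := treeSide_dist hT h hw (treeSide_aux hT h).2.1
        rw [SimpleGraph.dist_self] at this
        omega
      by_cases hw : (m : X) ∈ treeSide Γ y y'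
      · have := b _ hw; have := b _ (a1.1 hw); omega
      · have := b' _ hw; have := b' _ (fun h => hw (a1.2 h)); omega
    have : ∀ y : M, (Γ.dist (n : X) y : ℤ) - Γ.dist (m : X) y = - Γ.dist (m : X) n := by
      intro y
      have := (SimpleGraph.reachable_iff_reflTransGen _ _).1 (hc n y)
      induction this with
      | refl => simp
      | tail _ h ih => exact step _ _ h _ ih
    have h1 := this m
    rw [SimpleGraph.dist_self, Γ.dist_comm] at h1
    have h2 : Γ.dist (m : X) n = 0 := by omega
    exact Subtype.ext (hT.1.dist_eq_zero_iff.1 h2).symm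
  refine ⟨m, m.2, fun k hk => ?_⟩
  have := uniq ⟨k • m, hM k hk m m.2⟩ (by
    simp only [f]
    conv_lhs => rw [← hx k hk]
    exact dist_smul_eq hadj k _ _)
  exact congrArg Subtype.val this

end TreeAction

/-- `s` lies just inside the wall `A`. -/
def JustInside {S : Type*} (𝓦 : Set (Set S)) (A : Set S) (s : S) : Prop :=
  s ∈ A ∧ ∀ B ∈ 𝓦, B ⊂ A → s ∉ B

section JustInside

variable {S : Type*} {𝓦 : Set (Set S)}

theorem JustInside.eq_of_mem {A B : Set S} {s t : S} (hn : Nested B A)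
    (hc : ∀ A ∈ 𝓦, Aᶜ ∈ 𝓦) (hB : B ∈ 𝓦) (hs : JustInside 𝓦 A s) (ht : JustInside 𝓦 A t) :
    s ∈ B → t ∈ B := by
  intro h
  by_contra h'
  rcases hn with h1 | h1 | h1 | h1
  · by_cases he : B = A
    · exact h' (he ▸ ht.1)
    · exact hs.2 B hB (h1.ssubset_of_ne he) h
  · exact h1 h hs.1
  · by_cases he : Bᶜ = A
    · have := hs.1
      rw [← he] at this
      exact this h
    · exact ht.2 _ (hc _ hB) (h1.ssubset_of_ne he) h'
  · exact h1 h' ht.1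

theorem JustInside.unique (hn : ∀ A ∈ 𝓦, ∀ B ∈ 𝓦, Nested A B) (hc : ∀ A ∈ 𝓦, Aᶜ ∈ 𝓦)
    (hsep : SeparatesPoints 𝓦) {A : Set S} (hA : A ∈ 𝓦) {s t : S} (hs : JustInside 𝓦 A s)
    (ht : JustInside 𝓦 A t) : s = t :=
  hsep _ _ fun B hB => ⟨hs.eq_of_mem (hn B hB A hA) hc hB ht, ht.eq_of_mem (hn B hB A hA) hc hB hs⟩

theorem JustInside.smul {G : Type*} [Group G] [MulAction G S] (hs : ∀ g : G, ∀ A ∈ 𝓦, g • A ∈ 𝓦)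
    {A : Set S} {s : S} (h : JustInside 𝓦 A s) (g : G) : JustInside 𝓦 (g • A) (g • s) := by
  refine ⟨Set.smul_mem_smul_set h.1, fun B hB hlt hm => ?_⟩
  refine h.2 (g⁻¹ • B) (hs _ _ hB) ?_ (by rwa [Set.mem_inv_smul_set_iff])
  rw [ssubset_iff_subset_ne] at hlt ⊢
  refine ⟨?_, fun h => hlt.2 ?_⟩
  · rw [Set.smul_set_subset_iff_subset_inv_smul_set, inv_inv]; exact hlt.1
  · rw [← h, smul_inv_smul]

end JustInside

section DualTree

variable {S : Type*}

/-- Unoriented walls. -/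
abbrev UnorientedWall (𝓦 : Set (Set S)) : Type _ :=
  {P : Set (Set S) // ∃ A ∈ 𝓦, P = {A, Aᶜ}}

/-- The incidence graph between points and the walls they are next to. -/
def dualGraph (𝓦 : Set (Set S)) : SimpleGraph (S ⊕ UnorientedWall 𝓦) where
  Adj a b := match a, b with
    | .inl s, .inr P => ∃ A ∈ P.1, JustInside 𝓦 A s
    | .inr P, .inl s => ∃ A ∈ P.1, JustInside 𝓦 A s
    | _, _ => False
  symm := ⟨by rintro (s | P) (t | Q) h <;> exact h⟩
  loopless := ⟨by rintro (s | P) h <;> exact h⟩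

theorem UnorientedWall.mem {𝓦 : Set (Set S)} (hc : ∀ A ∈ 𝓦, Aᶜ ∈ 𝓦) (P : UnorientedWall 𝓦)
    {A : Set S} (hA : A ∈ P.1) : A ∈ 𝓦 ∧ P.1 = {A, Aᶜ} := by
  obtain ⟨P, B, hB, rfl⟩ := P
  rcases hA with rfl | rfl
  · exact ⟨hB, rfl⟩
  · exact ⟨hc _ hB, by simp only [compl_compl]; exact Set.pair_comm _ _⟩

theorem dualGraph_isAcyclic {𝓦 : Set (Set S)} (hn : ∀ A ∈ 𝓦, ∀ B ∈ 𝓦, Nested A B)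
    (hc : ∀ A ∈ 𝓦, Aᶜ ∈ 𝓦) (hsep : SeparatesPoints 𝓦)
    (hunit : ∀ A ∈ 𝓦, ∃ s, JustInside 𝓦 A s) : (dualGraph 𝓦).IsAcyclic := by
  rw [SimpleGraph.isAcyclic_iff_forall_adj_isBridge]
  have key : ∀ s P, (dualGraph 𝓦).Adj (.inl s) (.inr P) →
      (dualGraph 𝓦).IsBridge s(.inl s, .inr P) := by
    rintro s P ⟨A, hAP, hs⟩
    obtain ⟨hA, hP⟩ := P.mem hc hAP
    rw [SimpleGraph.isBridge_iff]
    let Z : Set (S ⊕ UnorientedWall 𝓦) :=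
      {x | match x with
        | .inl t => t ∈ A
        | .inr Q => ∃ B ∈ Q.1, B ⊂ A}
    have hPZ : ¬ ∃ B ∈ P.1, B ⊂ A := by
      rintro ⟨B, hB, hlt⟩
      rw [hP] at hB
      rcases hB with rfl | rfl
      · exact hlt.ne rfl
      · obtain ⟨t, ht⟩ := hunit _ (hc _ hA)
        exact ht.1 (hlt.1 ht.1)
    have cross : ∀ (t : S) (Q : UnorientedWall 𝓦), (dualGraph 𝓦).Adj (.inl t) (.inr Q) →
        ¬ (t = s ∧ Q = P) → (t ∈ A ↔ ∃ B ∈ Q.1, B ⊂ A) := by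
      rintro t Q ⟨B, hBQ, ht⟩ hne
      obtain ⟨hB, hQ⟩ := Q.mem hc hBQ
      have hAB : A ≠ B := by
        rintro rfl
        exact hne ⟨ht.unique hn hc hsep hA hs, Subtype.ext (hQ.trans hP.symm)⟩
      constructor
      · intro htA
        rcases hn B hB A hA with h1 | h1 | h1 | h1
        · exact ⟨B, hBQ, h1.ssubset_of_ne hAB.symm⟩
        · exact absurd htA (h1 ht.1)
        · by_cases he : Bᶜ = A
          · rw [← he] at htA
            exact absurd ht.1 htA
          · exact ⟨Bᶜ, by rw [hQ]; exact Or.inr rfl, h1.ssubset_of_ne he⟩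
        · refine absurd htA (ht.2 A hA (Set.ssubset_iff_subset_ne.2 ⟨?_, hAB⟩))
          exact Set.compl_subset_compl.1 h1
      · rintro ⟨C, hC, hlt⟩
        rw [hQ] at hC
        rcases hC with rfl | rfl
        · exact hlt.1 ht.1
        · by_contra htA
          refine ht.2 Aᶜ (hc _ hA) (Set.ssubset_iff_subset_ne.2 ⟨?_, ?_⟩) htA
          · exact Set.compl_subset_comm.1 hlt.1
          · rintro rfl
            rw [compl_compl] at hlt
            exact hlt.ne rfl
    have inv : ∀ x y, ((dualGraph 𝓦).deleteEdges {s(.inl s, .inr P)}).Adj x y → x ∈ Z → y ∈ Z := by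
      rintro (t | Q) (t' | Q') h hx
      · exact (SimpleGraph.deleteEdges_adj.1 h).1.elim
      · rw [SimpleGraph.deleteEdges_adj] at h
        refine (cross t Q' h.1 ?_).1 hx
        rintro ⟨rfl, rfl⟩
        exact h.2 rfl
      · rw [SimpleGraph.deleteEdges_adj] at h
        refine (cross t' Q h.1.symm ?_).2 hx
        rintro ⟨rfl, rfl⟩
        exact h.2 Sym2.eq_swap
      · exact (SimpleGraph.deleteEdges_adj.1 h).1.elim
    intro hr
    rw [SimpleGraph.reachable_iff_reflTransGen] at hr
    have hall : ∀ y, Relation.ReflTransGen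
        ((dualGraph 𝓦).deleteEdges {s(.inl s, .inr P)}).Adj (.inl s) y → y ∈ Z := by
      intro y hy
      induction hy with
      | refl => exact hs.1
      | tail _ h ih => exact inv _ _ h ih
    exact hPZ (hall _ hr)
  rintro (s | P) (t | Q) h
  · exact h.elim
  · exact key s Q h
  · rw [Sym2.eq_swap]; exact key t P h.symm
  · exact h.elim

theorem JustInside.eq_compl {𝓦 : Set (Set S)} (hn : ∀ A ∈ 𝓦, ∀ B ∈ 𝓦, Nested A B)
    (hc : ∀ A ∈ 𝓦, Aᶜ ∈ 𝓦) {A B : Set S} (hA : A ∈ 𝓦) (hB : B ∈ 𝓦) {s t : S}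
    (ht : JustInside 𝓦 A t) (hs : JustInside 𝓦 Aᶜ s) (h1 : s ∈ B) (h2 : t ∉ B) : B = Aᶜ := by
  by_contra hne
  rcases hn B hB A hA with h | h | h | h
  · exact hs.1 (h h1)
  · exact hs.2 B hB (h.ssubset_of_ne hne) h1
  · refine ht.2 _ (hc _ hB) (h.ssubset_of_ne ?_) h2
    rintro rfl
    exact hne (compl_compl B).symm
  · exact h h2 ht.1

theorem dualGraph_connected {𝓦 : Set (Set S)} [Nonempty S] (hn : ∀ A ∈ 𝓦, ∀ B ∈ 𝓦, Nested A B)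
    (hc : ∀ A ∈ 𝓦, Aᶜ ∈ 𝓦) (hfin : ∀ x y, (wallsBetween 𝓦 x y).Finite)
    (hsep : SeparatesPoints 𝓦) (hunit : ∀ A ∈ 𝓦, ∃ s, JustInside 𝓦 A s) :
    (dualGraph 𝓦).Connected := by
  have key : ∀ (n : ℕ) (s t : S), (wallsBetween 𝓦 s t).ncard ≤ n →
      (dualGraph 𝓦).Reachable (.inl s) (.inl t) := by
    intro n
    induction n with
    | zero =>
      intro s t h
      have h0 : wallsBetween 𝓦 s t = ∅ := (Set.ncard_eq_zero (hfin s t)).1 (Nat.le_zero.1 h)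
      have : s = t := by
        refine hsep _ _ fun A hA => ⟨fun h1 => ?_, fun h1 => ?_⟩
        · by_contra h2
          have : Aᶜ ∈ wallsBetween 𝓦 s t := ⟨hc _ hA, not_not.2 h1, h2⟩
          rw [h0] at this
          exact this
        · by_contra h2
          have : A ∈ wallsBetween 𝓦 s t := ⟨hA, h2, h1⟩
          rw [h0] at this
          exact this
      rw [this]
    | succ n ih =>
      intro s t h
      by_cases h0 : (wallsBetween 𝓦 s t).Nonempty
      · obtain ⟨A, hA⟩ := (hfin s t).exists_minimal h0
        obtain ⟨⟨hA, hsA, htA⟩, hmin⟩ := hA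
        have ht : JustInside 𝓦 A t := by
          refine ⟨htA, fun B hB hlt htB => ?_⟩
          exact hlt.2 (hmin ⟨hB, fun h => hsA (hlt.1 h), htB⟩ hlt.1)
        obtain ⟨s0, hs0⟩ := hunit _ (hc _ hA)
        have hlt : wallsBetween 𝓦 s s0 ⊂ wallsBetween 𝓦 s t := by
          refine ⟨?_, fun h => ?_⟩
          · rintro B ⟨hB, h1, h2⟩
            refine ⟨hB, h1, ?_⟩
            by_contra h3
            have := ht.eq_compl hn hc hA hB hs0 h2 h3
            rw [this] at h1
            exact h1 hsA
          · exact hs0.1 (h ⟨hA, hsA, htA⟩).2.2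
        have hcard := Set.ncard_lt_ncard hlt (hfin s t)
        refine (ih s s0 (by omega)).trans ?_
        let P : UnorientedWall 𝓦 := ⟨{A, Aᶜ}, A, hA, rfl⟩
        have e1 : (dualGraph 𝓦).Adj (.inl s0) (.inr P) := ⟨Aᶜ, Or.inr rfl, hs0⟩
        have e2 : (dualGraph 𝓦).Adj (.inr P) (.inl t) := ⟨A, Or.inl rfl, ht⟩
        exact e1.reachable.trans e2.reachable
      · refine ih s t ?_
        rw [Set.not_nonempty_iff_eq_empty.1 h0, Set.ncard_empty]
        exact Nat.zero_le _
  have toPoint : ∀ x, ∃ s : S, (dualGraph 𝓦).Reachable x (.inl s) := by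
    rintro (s | P)
    · exact ⟨s, SimpleGraph.Reachable.refl _⟩
    · obtain ⟨A, hA, hP⟩ := P.2
      obtain ⟨s, hs⟩ := hunit A hA
      refine ⟨s, SimpleGraph.Adj.reachable ?_⟩
      exact ⟨A, by rw [hP]; exact Or.inl rfl, hs⟩
  refine SimpleGraph.connected_iff _ |>.2 ⟨fun x y => ?_, inferInstance⟩
  obtain ⟨s, hs⟩ := toPoint x
  obtain ⟨t, ht⟩ := toPoint y
  exact hs.trans ((key _ s t le_rfl).trans ht.symm)

end DualTree

section MinimalSubtree

variable {G : Type u} [Group G]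

/-- Vertex sets of nonempty invariant connected subgraphs. -/
def IsInvariantSubtree (G : Type*) [Group G] {X : Type*} [MulAction G X] (Γ : SimpleGraph X)
    (M : Set X) : Prop :=
  M.Nonempty ∧ (∀ g : G, ∀ x ∈ M, g • x ∈ M) ∧ (Γ.induce M).Connected

theorem exists_minimal_subtree {X : Type*} [MulAction G X] {Γ : SimpleGraph X}
    (hΓ : Γ.Connected) {F : Set X} (hF : F.Finite) (hFX : ∀ x : X, ∃ g : G, g • x ∈ F) :
    ∃ M, IsInvariantSubtree G Γ M ∧ ∀ M' ⊆ M, IsInvariantSubtree G Γ M' → M' = M := by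
  classical
  have hex : ∃ n, ∃ M, IsInvariantSubtree G Γ M ∧ (M ∩ F).ncard = n := by
    refine ⟨_, Set.univ, ⟨?_, fun _ _ _ => trivial, ?_⟩, rfl⟩
    · exact @Set.univ_nonempty _ hΓ.nonempty
    · exact (SimpleGraph.Iso.connected_iff (SimpleGraph.induceUnivIso Γ)).2 hΓ
  obtain ⟨M, hM, hn⟩ := Nat.find_spec hex
  refine ⟨M, hM, fun M' hle hM' => ?_⟩
  have h1 : (M ∩ F).ncard ≤ (M' ∩ F).ncard := by
    rw [hn]
    exact Nat.find_min' hex ⟨M', hM', rfl⟩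
  have h2 := Set.eq_of_subset_of_ncard_le (Set.inter_subset_inter_left F hle) h1
    (hF.inter_of_right M)
  refine Set.Subset.antisymm hle fun x hx => ?_
  obtain ⟨g, hg⟩ := hFX x
  have : g • x ∈ M' ∩ F := by rw [h2]; exact ⟨hM.2.1 g x hx, hg⟩
  have := hM'.2.1 g⁻¹ _ this.1
  rwa [inv_smul_smul] at this

/-- The `G`-tree given by a minimal invariant subtree. -/
def GTree.ofMinimal {X : Type u} [MulAction G X] {Γ : SimpleGraph X} (hT : Γ.IsTree)
    (hadj : ∀ (g : G) a b, Γ.Adj a b → Γ.Adj (g • a) (g • b))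
    (hinv : ∀ (g : G) a b, Γ.Adj a b → ¬ (g • a = b ∧ g • b = a)) {M : Set X}
    (hM : IsInvariantSubtree G Γ M) (hmin : ∀ M' ⊆ M, IsInvariantSubtree G Γ M' → M' = M) :
    GTree G where
  V := M
  graph := Γ.induce M
  nonempty := hM.1.to_subtype
  connected := hM.2.2
  acyclic := hT.2.induce M
  act g x := ⟨g • (x : X), hM.2.1 g x x.2⟩
  act_one w := Subtype.ext (one_smul G _)
  act_mul g h w := Subtype.ext (mul_smul g h _)
  act_adj g a b h := hadj g _ _ h
  noInversion g a b h h' := hinv g _ _ h ⟨congrArg Subtype.val h'.1, congrArg Subtype.val h'.2⟩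
  minimal S hne hS hc := by
    have := hmin (Subtype.val '' S) (by rintro _ ⟨x, -, rfl⟩; exact x.2) ⟨hne.image _, ?_, ?_⟩
    · ext x
      simp only [Set.mem_univ, iff_true]
      have hx : (x : X) ∈ Subtype.val '' S := by rw [this]; exact x.2
      obtain ⟨y, hy, h⟩ := hx
      exact Subtype.ext h ▸ hy
    · rintro g _ ⟨x, hx, rfl⟩
      exact ⟨_, hS g x hx, rfl⟩
    · rw [SimpleGraph.connected_iff] at hc ⊢
      refine ⟨?_, (hne.image _).to_subtype⟩
      let f : ((Γ.induce M).induce S) →g Γ.induce (Subtype.val '' S) :=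
        ⟨fun x => ⟨x.1.1, x.1, x.2, rfl⟩, fun h => h⟩
      rintro ⟨_, x, hx, rfl⟩ ⟨_, y, hy, rfl⟩
      exact (hc.1 ⟨x, hx⟩ ⟨y, hy⟩).map f

end MinimalSubtree

section DualGTree

variable {G : Type u} [Group G] {S : Type u} [MulAction G S] {𝓦 : Set (Set S)}

/-- The action on unoriented walls. -/
@[reducible]
def unorientedWallAction (hs : ∀ g : G, ∀ A ∈ 𝓦, g • A ∈ 𝓦) : MulAction G (UnorientedWall 𝓦) where
  smul g P := ⟨(fun A => g • A) '' P.1, by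
    obtain ⟨A, hA, hP⟩ := P.2
    refine ⟨g • A, hs g A hA, ?_⟩
    rw [hP, Set.image_pair, Set.smul_set_compl]⟩
  one_smul P := by
    refine Subtype.ext ?_
    change (fun A => (1 : G) • A) '' P.1 = P.1
    simp
  mul_smul g h P := by
    refine Subtype.ext ?_
    change (fun A => (g * h) • A) '' P.1 = (fun A => g • A) '' ((fun A => h • A) '' P.1)
    rw [Set.image_image]
    simp only [mul_smul]

/-- The `G`-tree dual to a wall system in which every wall has a point just inside it. -/
theorem exists_dual_gtree [Nonempty S] (hW : IsWallSystem G 𝓦) (hsep : SeparatesPoints 𝓦)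
    (hunit : ∀ A ∈ 𝓦, ∃ s, JustInside 𝓦 A s)
    (hS : ∃ F : Set S, F.Finite ∧ ∀ s, ∃ g : G, g • s ∈ F)
    (hWF : ∃ F : Set (Set S), F.Finite ∧ ∀ A ∈ 𝓦, ∃ g : G, g • A ∈ F) :
    ∃ T : GTree G,
      (∀ a b, T.graph.Adj a b → ∃ A ∈ 𝓦, T.edgeStab a b = MulAction.stabilizer G A) ∧
      (∀ w, (∃ s : S, T.vertexStab w = MulAction.stabilizer G s) ∨
        ∃ A ∈ 𝓦, IndexLeTwo (MulAction.stabilizer G A) (T.vertexStab w)) ∧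
      ∀ K : Subgroup G, (∃ s : S, ∀ k ∈ K, k • s = s) → T.EllipticSubgroup K := by
  let _ := unorientedWallAction (G := G) hW.smul_mem
  let Γ := dualGraph 𝓦
  have hsm : ∀ (g : G) (P : UnorientedWall 𝓦), (g • P).1 = (fun A => g • A) '' P.1 :=
    fun _ _ => rfl
  have hT : Γ.IsTree := ⟨dualGraph_connected hW.nested hW.compl_mem hW.finite hsep hunit,
    dualGraph_isAcyclic hW.nested hW.compl_mem hsep hunit⟩
  have hadj' : ∀ (g : G) s P, Γ.Adj (.inl s) (.inr P) → Γ.Adj (.inl (g • s)) (.inr (g • P)) := by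
    rintro g s P ⟨A, hA, hs⟩
    exact ⟨g • A, ⟨A, hA, rfl⟩, hs.smul hW.smul_mem g⟩
  have hadj : ∀ (g : G) a b, Γ.Adj a b → Γ.Adj (g • a) (g • b) := by
    rintro g (s | P) (t | Q) h
    · exact h.elim
    · exact hadj' g s Q h
    · exact (hadj' g t P h.symm).symm
    · exact h.elim
  have hinv : ∀ (g : G) a b, Γ.Adj a b → ¬ (g • a = b ∧ g • b = a) := by
    rintro g (s | P) (t | Q) h ⟨h1, h2⟩
    · exact h
    · exact Sum.inl_ne_inr h1
    · exact Sum.inr_ne_inl h1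
    · exact h
  obtain ⟨FS, hFS, hFS'⟩ := hS
  obtain ⟨FW, hFW, hFW'⟩ := hWF
  have hfinP : {P : UnorientedWall 𝓦 | ∃ A ∈ FW, P.1 = {A, Aᶜ}}.Finite := by
    refine Set.Finite.of_finite_image ((hFW.image fun A => ({A, Aᶜ} : Set (Set S))).subset ?_)
      (Subtype.val_injective.injOn)
    rintro _ ⟨P, ⟨A, hA, hP⟩, rfl⟩
    exact ⟨A, hA, hP.symm⟩
  obtain ⟨M, hM, hmin⟩ := exists_minimal_subtree (G := G) hT.1
    (F := Sum.inl '' FS ∪ Sum.inr '' {P : UnorientedWall 𝓦 | ∃ A ∈ FW, P.1 = {A, Aᶜ}})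
    ((hFS.image _).union (hfinP.image _)) (by
      rintro (s | P)
      · obtain ⟨g, hg⟩ := hFS' s
        exact ⟨g, Or.inl ⟨_, hg, rfl⟩⟩
      · obtain ⟨A, hA, hP⟩ := P.2
        obtain ⟨g, hg⟩ := hFW' A hA
        refine ⟨g, Or.inr ⟨g • P, ⟨_, hg, ?_⟩, rfl⟩⟩
        rw [hsm, hP, Set.image_pair, Set.smul_set_compl])
  have estab : ∀ s P, Γ.Adj (.inl s) (.inr P) → ∃ A ∈ 𝓦,
      ∀ g : G, (g • s = s ∧ g • P = P) ↔ g ∈ MulAction.stabilizer G A := by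
    rintro s P ⟨A, hA, hs⟩
    obtain ⟨hAW, hP⟩ := P.mem hW.compl_mem hA
    refine ⟨A, hAW, fun g => ?_⟩
    rw [MulAction.mem_stabilizer_iff]
    constructor
    · rintro ⟨h1, h2⟩
      have h3 : g • A ∈ P.1 := by
        rw [← h2]; exact ⟨A, hA, rfl⟩
      rw [hP] at h3
      rcases h3 with h3 | h3
      · exact h3
      · have h4 := Set.smul_mem_smul_set (a := g) hs.1
        rw [h3, h1] at h4
        exact absurd hs.1 h4
    · intro h
      refine ⟨?_, Subtype.ext ?_⟩
      · have := hs.smul hW.smul_mem g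
        rw [h] at this
        exact this.unique hW.nested hW.compl_mem hsep hAW hs
      · rw [hsm, hP, Set.image_pair, Set.smul_set_compl, h]
  refine ⟨GTree.ofMinimal hT hadj hinv hM hmin, ?_, ?_, ?_⟩
  · rintro ⟨s | P, ha⟩ ⟨t | Q, hb⟩ h
    · exact h.elim
    · obtain ⟨A, hA, h1⟩ := estab s Q h
      refine ⟨A, hA, ?_⟩
      ext g
      rw [← h1 g]
      constructor
      · rintro ⟨e1, e2⟩
        exact ⟨Sum.inl_injective (congrArg Subtype.val e1),
          Sum.inr_injective (congrArg Subtype.val e2)⟩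
      · rintro ⟨e1, e2⟩
        exact ⟨Subtype.ext (congrArg Sum.inl e1), Subtype.ext (congrArg Sum.inr e2)⟩
    · obtain ⟨A, hA, h1⟩ := estab t P h.symm
      refine ⟨A, hA, ?_⟩
      ext g
      rw [← h1 g]
      constructor
      · rintro ⟨e1, e2⟩
        exact ⟨Sum.inl_injective (congrArg Subtype.val e2),
          Sum.inr_injective (congrArg Subtype.val e1)⟩
      · rintro ⟨e1, e2⟩
        exact ⟨Subtype.ext (congrArg Sum.inr e2), Subtype.ext (congrArg Sum.inl e1)⟩
    · exact h.elim
  · rintro ⟨s | P, ha⟩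
    · refine Or.inl ⟨s, ?_⟩
      ext g
      constructor
      · intro h
        exact Sum.inl_injective (congrArg Subtype.val h)
      · intro h
        exact Subtype.ext (congrArg Sum.inl h)
    · obtain ⟨A, hA, hP⟩ := P.2
      refine Or.inr ⟨A, hA, ?_, ?_⟩
      · intro g hg
        refine Subtype.ext (congrArg Sum.inr (Subtype.ext ?_))
        rw [MulAction.mem_stabilizer_iff] at hg
        rw [hsm, hP, Set.image_pair, Set.smul_set_compl, hg]
      · have flip : ∀ g ∈ (GTree.ofMinimal hT hadj hinv hM hmin).vertexStab ⟨Sum.inr P, ha⟩,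
            g ∉ MulAction.stabilizer G A → g • A = Aᶜ := by
          intro g hg hgA
          have h1 : g • P = P := Sum.inr_injective (congrArg Subtype.val hg)
          have h3 : g • A ∈ (g • P).1 := ⟨A, by rw [hP]; exact Or.inl rfl, rfl⟩
          rw [h1, hP] at h3
          rcases h3 with h3 | h3
          · exact absurd h3 hgA
          · exact h3
        intro g hg h hh hgA hhA
        rw [MulAction.mem_stabilizer_iff, mul_smul, flip h hh hhA, ← flip g hg hgA, inv_smul_smul]
  · rintro K ⟨s, hs⟩
    obtain ⟨m, hm, hk⟩ := exists_fixed_of_invariant hT hadj hM.1 hM.2.2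
      (fun k _ x hx => hM.2.1 k x hx) (K := K) (x := Sum.inl s)
      (fun k hk => congrArg Sum.inl (hs k hk))
    exact ⟨⟨m, hm⟩, fun k hk' => Subtype.ext (hk k hk')⟩

end DualGTree

section BlowUp

variable {S U : Type*} {𝓦 : Set (Set S)} {𝓤 : Set (Set U)}

/-- The largest wall separating `x` from `s`, seen from `x`. -/
def topWall (𝓦 : Set (Set S)) (s x : S) : Set S := ⋃₀ wallsBetween 𝓦 s x

theorem wallsBetween_chain (hn : ∀ A ∈ 𝓦, ∀ B ∈ 𝓦, Nested A B) {s x : S} {A B : Set S}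
    (hA : A ∈ wallsBetween 𝓦 s x) (hB : B ∈ wallsBetween 𝓦 s x) : A ⊆ B ∨ B ⊆ A := by
  rcases hn A hA.1 B hB.1 with h | h | h | h
  · exact Or.inl h
  · exact absurd hB.2.2 (h hA.2.2)
  · exact absurd (h hA.2.1) hB.2.1
  · exact Or.inr (Set.compl_subset_compl.1 h)

theorem topWall_mem (hn : ∀ A ∈ 𝓦, ∀ B ∈ 𝓦, Nested A B) (hc : ∀ A ∈ 𝓦, Aᶜ ∈ 𝓦)
    (hfin : ∀ x y, (wallsBetween 𝓦 x y).Finite) (hsep : SeparatesPoints 𝓦) {s x : S} (h : x ≠ s) :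
    topWall 𝓦 s x ∈ wallsBetween 𝓦 s x := by
  have hne : (wallsBetween 𝓦 s x).Nonempty := by
    by_contra h0
    rw [Set.not_nonempty_iff_eq_empty] at h0
    refine h (hsep _ _ fun A hA => ⟨fun h1 => ?_, fun h1 => ?_⟩)
    · by_contra h2
      exact (h0 ▸ (⟨hA, h2, h1⟩ : A ∈ wallsBetween 𝓦 s x) : A ∈ (∅ : Set (Set S)))
    · by_contra h2
      exact (h0 ▸ (⟨hc _ hA, not_not.2 h1, h2⟩ : Aᶜ ∈ wallsBetween 𝓦 s x) :
        Aᶜ ∈ (∅ : Set (Set S)))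
  obtain ⟨A, hA⟩ := (hfin s x).exists_maximal hne
  have : topWall 𝓦 s x = A := by
    refine Set.Subset.antisymm (Set.sUnion_subset fun B hB => ?_) (Set.subset_sUnion_of_mem hA.1)
    rcases wallsBetween_chain hn hB hA.1 with h | h
    · exact h
    · exact hA.2 hB h
  rw [this]
  exact hA.1

theorem topWall_congr (hn : ∀ A ∈ 𝓦, ∀ B ∈ 𝓦, Nested A B) {s x x' : S} {A : Set S} (hA : A ∈ 𝓦)
    (hs : s ∉ A) (hx : x ∈ A) (hx' : x' ∈ A) : topWall 𝓦 s x = topWall 𝓦 s x' := by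
  have key : ∀ x x', x ∈ A → x' ∈ A → topWall 𝓦 s x ⊆ topWall 𝓦 s x' := by
    intro x x' hx hx'
    refine Set.sUnion_subset fun B hB => ?_
    rcases wallsBetween_chain hn hB ⟨hA, hs, hx⟩ with h | h
    · exact h.trans (Set.subset_sUnion_of_mem ⟨hA, hs, hx'⟩)
    · exact Set.subset_sUnion_of_mem ⟨hB.1, hB.2.1, h hx'⟩
  exact (key x x' hx hx').antisymm (key x' x hx' hx)

open Classical in
/-- The retraction of the blow-up onto the copy of `U` attached at `s`. -/
noncomputable def blowRetract (𝓦 : Set (Set S)) (p : Set S → U) (s : S) (z : S × U) : U :=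
  if z.1 = s then z.2 else p (topWall 𝓦 s z.1)

/-- The walls of the blow-up. -/
def blowWalls (𝓦 : Set (Set S)) (𝓤 : Set (Set U)) (p : Set S → U) : Set (Set (S × U)) :=
  {D | (∃ A ∈ 𝓦, D = Prod.fst ⁻¹' A) ∨ ∃ s, ∃ H ∈ 𝓤, D = blowRetract 𝓦 p s ⁻¹' H}

variable (p : Set S → U)

theorem blowRetract_const (hn : ∀ A ∈ 𝓦, ∀ B ∈ 𝓦, Nested A B) {s : S} {A : Set S} (hA : A ∈ 𝓦)
    (hs : s ∉ A) {z z' : S × U} (hz : z.1 ∈ A) (hz' : z'.1 ∈ A) :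
    blowRetract 𝓦 p s z = blowRetract 𝓦 p s z' := by
  have h1 : z.1 ≠ s := fun h => hs (h ▸ hz)
  have h2 : z'.1 ≠ s := fun h => hs (h ▸ hz')
  simp only [blowRetract, if_neg h1, if_neg h2, topWall_congr hn hA hs hz hz']

theorem fst_preimage_subset (hn : ∀ A ∈ 𝓦, ∀ B ∈ 𝓦, Nested A B) {s : S} {A : Set S} (hA : A ∈ 𝓦)
    (hs : s ∉ A) (H : Set U) : Prod.fst ⁻¹' A ⊆ blowRetract 𝓦 p s ⁻¹' H ∨
      Prod.fst ⁻¹' A ⊆ (blowRetract 𝓦 p s ⁻¹' H)ᶜ := by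
  by_cases h : ∃ z : S × U, z.1 ∈ A ∧ blowRetract 𝓦 p s z ∈ H
  · obtain ⟨z, hz, hzH⟩ := h
    refine Or.inl fun z' hz' => ?_
    change blowRetract 𝓦 p s z' ∈ H
    rwa [blowRetract_const p hn hA hs hz' hz]
  · push Not at h
    exact Or.inr fun z' hz' => h z' hz'

variable {G : Type*} [Group G] [MulAction G S] [MulAction G U]

theorem smul_wallsBetween (hs : ∀ g : G, ∀ A ∈ 𝓦, g • A ∈ 𝓦) (g : G) (x y : S) :
    wallsBetween 𝓦 (g • x) (g • y) = (fun A => g • A) '' wallsBetween 𝓦 x y := by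
  ext A
  simp only [wallsBetween, Set.mem_ofPred_eq, Set.mem_image]
  constructor
  · rintro ⟨h1, h2, h3⟩
    refine ⟨g⁻¹ • A, ⟨hs _ _ h1, ?_, ?_⟩, smul_inv_smul g A⟩
    · rwa [Set.mem_inv_smul_set_iff]
    · rwa [Set.mem_inv_smul_set_iff]
  · rintro ⟨B, ⟨h1, h2, h3⟩, rfl⟩
    exact ⟨hs _ _ h1, by rwa [Set.smul_mem_smul_set_iff], by rwa [Set.smul_mem_smul_set_iff]⟩

theorem smul_topWall (hs : ∀ g : G, ∀ A ∈ 𝓦, g • A ∈ 𝓦) (g : G) (s x : S) :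
    topWall 𝓦 (g • s) (g • x) = g • topWall 𝓦 s x := by
  unfold topWall
  rw [smul_wallsBetween hs]
  ext y
  simp only [Set.mem_sUnion, Set.mem_image, exists_exists_and_eq_and,
    Set.mem_smul_set_iff_inv_smul_mem]

theorem blowRetract_smul (hW : IsWallSystem G 𝓦) (hsep : SeparatesPoints 𝓦)
    (hp : ∀ g : G, ∀ A ∈ 𝓦, p (g • A) = g • p A) (g : G) (s : S) (z : S × U) :
    blowRetract 𝓦 p (g • s) (g • z) = g • blowRetract 𝓦 p s z := by
  by_cases h : z.1 = s
  · have h' : (g • z).1 = g • s := congrArg (g • ·) h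
    simp only [blowRetract, if_pos h, if_pos h']
    rfl
  · have h' : (g • z).1 ≠ g • s := fun h' => h (MulAction.injective g h')
    simp only [blowRetract, if_neg h, if_neg h']
    change p (topWall 𝓦 (g • s) (g • z.1)) = _
    rw [smul_topWall hW.smul_mem,
      hp _ _ (topWall_mem hW.nested hW.compl_mem hW.finite hsep h).1]

theorem smul_blowRetract_preimage (hW : IsWallSystem G 𝓦) (hsep : SeparatesPoints 𝓦)
    (hp : ∀ g : G, ∀ A ∈ 𝓦, p (g • A) = g • p A) (g : G) (s : S) (H : Set U) :
    g • (blowRetract 𝓦 p s ⁻¹' H) = blowRetract 𝓦 p (g • s) ⁻¹' (g • H) := by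
  ext z
  rw [Set.mem_smul_set_iff_inv_smul_mem, Set.mem_preimage, Set.mem_preimage,
    Set.mem_smul_set_iff_inv_smul_mem, ← blowRetract_smul p hW hsep hp, inv_smul_smul]

theorem smul_fst_preimage (g : G) (A : Set S) :
    g • (Prod.fst ⁻¹' A : Set (S × U)) = Prod.fst ⁻¹' (g • A) := by
  ext z
  rw [Set.mem_smul_set_iff_inv_smul_mem, Set.mem_preimage, Set.mem_preimage,
    Set.mem_smul_set_iff_inv_smul_mem]
  rfl

theorem isWallSystem_blowWalls (hW : IsWallSystem G 𝓦) (hsep : SeparatesPoints 𝓦)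
    (hU : IsWallSystem G 𝓤) (hp : ∀ g : G, ∀ A ∈ 𝓦, p (g • A) = g • p A) :
    IsWallSystem G (blowWalls 𝓦 𝓤 p) where
  compl_mem := by
    rintro _ (⟨A, hA, rfl⟩ | ⟨s, H, hH, rfl⟩)
    · exact Or.inl ⟨_, hW.compl_mem _ hA, rfl⟩
    · exact Or.inr ⟨s, _, hU.compl_mem _ hH, rfl⟩
  smul_mem := by
    rintro g _ (⟨A, hA, rfl⟩ | ⟨s, H, hH, rfl⟩)
    · exact Or.inl ⟨_, hW.smul_mem g _ hA, smul_fst_preimage g A⟩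
    · exact Or.inr ⟨_, _, hU.smul_mem g _ hH, smul_blowRetract_preimage p hW hsep hp g s H⟩
  nested := by
    have mixed : ∀ A ∈ 𝓦, ∀ s, ∀ H : Set U,
        Nested (Prod.fst ⁻¹' A) (blowRetract 𝓦 p s ⁻¹' H) := by
      intro A hA s H
      by_cases hs : s ∈ A
      · rcases fst_preimage_subset p hW.nested (hW.compl_mem _ hA) (not_not.2 hs) H with h | h
        · exact Or.inr (Or.inr (Or.inl h))
        · exact Or.inr (Or.inr (Or.inr h))
      · rcases fst_preimage_subset p hW.nested hA hs H with h | h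
        · exact Or.inl h
        · exact Or.inr (Or.inl h)
    rintro _ (⟨A, hA, rfl⟩ | ⟨s, H, hH, rfl⟩) _ (⟨B, hB, rfl⟩ | ⟨t, H', hH', rfl⟩)
    · rcases hW.nested A hA B hB with h | h | h | h
      · exact Or.inl (Set.preimage_mono h)
      · exact Or.inr (Or.inl (Set.preimage_mono h))
      · exact Or.inr (Or.inr (Or.inl (Set.preimage_mono h)))
      · exact Or.inr (Or.inr (Or.inr (Set.preimage_mono h)))
    · exact mixed A hA t H'
    · rcases mixed B hB s H with h | h | h | h
      · exact Or.inr (Or.inr (Or.inr (Set.compl_subset_compl.2 h)))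
      · exact Or.inr (Or.inl (Set.subset_compl_comm.1 h))
      · exact Or.inr (Or.inr (Or.inl (Set.compl_subset_comm.1 h)))
      · exact Or.inl (Set.compl_subset_compl.1 h)
    · by_cases hst : t = s
      · subst hst
        rcases hU.nested H hH H' hH' with h | h | h | h
        · exact Or.inl (Set.preimage_mono h)
        · exact Or.inr (Or.inl (Set.preimage_mono h))
        · exact Or.inr (Or.inr (Or.inl (Set.preimage_mono h)))
        · exact Or.inr (Or.inr (Or.inr (Set.preimage_mono h)))
      · obtain ⟨hA, hsA, htA⟩ := topWall_mem hW.nested hW.compl_mem hW.finite hsep hst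
        have h1 := fst_preimage_subset p hW.nested hA hsA H
        have h2 := fst_preimage_subset p hW.nested (hW.compl_mem _ hA) (not_not.2 htA) H'
        rw [Set.preimage_compl] at h2
        rcases h1 with h1 | h1 <;> rcases h2 with h2 | h2
        · exact Or.inr (Or.inr (Or.inl ((Set.compl_subset_compl.2 h1).trans h2)))
        · exact Or.inr (Or.inr (Or.inr ((Set.compl_subset_compl.2 h1).trans h2)))
        · exact Or.inl ((Set.subset_compl_comm.1 h1).trans h2)
        · exact Or.inr (Or.inl ((Set.subset_compl_comm.1 h1).trans h2))
  finite := by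
    intro z z'
    let I : Set S := {s | blowRetract 𝓦 p s z ≠ blowRetract 𝓦 p s z'}
    have hI : I.Finite := by
      refine Set.Finite.of_finite_image (f := fun s => {A ∈ wallsBetween 𝓦 z.1 z'.1 | s ∈ A})
        ((hW.finite z.1 z'.1).finite_subsets.subset ?_) ?_
      · rintro _ ⟨s, -, rfl⟩
        exact Set.sep_subset _ _
      · have key : ∀ s ∈ I, ∀ t ∈ I, {A ∈ wallsBetween 𝓦 z.1 z'.1 | s ∈ A} =
            {A ∈ wallsBetween 𝓦 z.1 z'.1 | t ∈ A} → ∀ A ∈ 𝓦, s ∈ A → t ∈ A := by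
          intro s hs t ht he A hA hsA
          by_contra htA
          have n1 : ¬ (z.1 ∈ A ∧ z'.1 ∈ A) := fun h =>
            ht (blowRetract_const p hW.nested hA htA h.1 h.2)
          have n2 : ¬ (z.1 ∈ Aᶜ ∧ z'.1 ∈ Aᶜ) := fun h =>
            hs (blowRetract_const p hW.nested (hW.compl_mem _ hA) (not_not.2 hsA) h.1 h.2)
          by_cases hz : z.1 ∈ A
          · have : Aᶜ ∈ {A ∈ wallsBetween 𝓦 z.1 z'.1 | t ∈ A} :=
              ⟨⟨hW.compl_mem _ hA, not_not.2 hz, fun h => n1 ⟨hz, h⟩⟩, htA⟩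
            rw [← he] at this
            exact this.2 hsA
          · have : A ∈ {A ∈ wallsBetween 𝓦 z.1 z'.1 | s ∈ A} :=
              ⟨⟨hA, hz, by by_contra h; exact n2 ⟨hz, h⟩⟩, hsA⟩
            rw [he] at this
            exact htA this.2
        intro s hs t ht he
        exact hsep _ _ fun A hA => ⟨key s hs t ht he A hA, key t ht s hs he.symm A hA⟩
    refine (((hW.finite z.1 z'.1).image fun A => Prod.fst ⁻¹' A).union (hI.biUnion fun s _ =>
      (hU.finite (blowRetract 𝓦 p s z) (blowRetract 𝓦 p s z')).image
        fun H => blowRetract 𝓦 p s ⁻¹' H)).subset ?_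
    rintro _ ⟨⟨A, hA, rfl⟩ | ⟨s, H, hH, rfl⟩, h1, h2⟩
    · exact Or.inl ⟨A, ⟨hA, h1, h2⟩, rfl⟩
    · refine Or.inr (Set.mem_biUnion (x := s) ?_ ⟨H, ⟨hH, h1, h2⟩, rfl⟩)
      intro he
      have h1' : blowRetract 𝓦 p s z ∉ H := h1
      rw [he] at h1'
      exact h1' h2

theorem stabilizer_blowWalls [Nonempty U] (hW : IsWallSystem G 𝓦) (hsep : SeparatesPoints 𝓦)
    (hne : ∀ H ∈ 𝓤, H.Nonempty ∧ Hᶜ.Nonempty) (hp : ∀ g : G, ∀ A ∈ 𝓦, p (g • A) = g • p A)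
    {D : Set (S × U)} (hD : D ∈ blowWalls 𝓦 𝓤 p) :
    (∃ A ∈ 𝓦, MulAction.stabilizer G D ≤ MulAction.stabilizer G A) ∨
      ∃ H ∈ 𝓤, MulAction.stabilizer G D ≤ MulAction.stabilizer G H := by
  rcases hD with ⟨A, hA, rfl⟩ | ⟨s, H, hH, rfl⟩
  · refine Or.inl ⟨A, hA, fun g hg => ?_⟩
    rw [MulAction.mem_stabilizer_iff, smul_fst_preimage] at hg
    exact Prod.fst_surjective.preimage_injective hg
  · refine Or.inr ⟨H, hH, fun g hg => ?_⟩
    rw [MulAction.mem_stabilizer_iff, smul_blowRetract_preimage p hW hsep hp] at hg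
    have self : ∀ (t : S) (y : U), blowRetract 𝓦 p t (t, y) = y := fun t y => by
      simp [blowRetract]
    by_cases hs : g • s = s
    · rw [hs] at hg
      rw [MulAction.mem_stabilizer_iff]
      ext y
      have := Set.ext_iff.1 hg (s, y)
      rwa [Set.mem_preimage, Set.mem_preimage, self] at this
    · exfalso
      obtain ⟨hA, h1, h2⟩ := topWall_mem hW.nested hW.compl_mem hW.finite hsep hs
      obtain ⟨⟨a, ha⟩, ⟨b, hb⟩⟩ := hne H hH
      have c1 : (g • s, g • a) ∈ blowRetract 𝓦 p (g • s) ⁻¹' (g • H) := by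
        rw [Set.mem_preimage, self]; exact Set.smul_mem_smul_set ha
      have c2 : (g • s, g • b) ∉ blowRetract 𝓦 p (g • s) ⁻¹' (g • H) := by
        rw [Set.mem_preimage, self, Set.smul_mem_smul_set_iff]; exact hb
      rw [hg] at c1 c2
      rw [Set.mem_preimage] at c1 c2
      rw [blowRetract_const p hW.nested hA h1 (z' := (g • s, g • b)) h2 h2] at c1
      exact c2 c1

end BlowUp

/-- The one-skeleton of a connected `G`-complex whose triangles are all the triples of pairwise
related vertices, and whose first cohomology modulo two vanishes. -/
structure FlagComplex (G V : Type*) [Group G] [MulAction G V] where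
  R : V → V → Prop
  refl : ∀ a, R a a
  symm : ∀ {a b}, R a b → R b a
  smul : ∀ (g : G) {a b}, R a b → R (g • a) (g • b)
  conn : ∀ a b, Relation.ReflTransGen R a b
  cocycle : ∀ c : V → V → ZMod 2,
    (∀ a b d, R a b → R b d → R a d → c a b + c b d = c a d) →
      ∃ χ : V → ZMod 2, ∀ a b, R a b → c a b = χ a + χ b

namespace FlagComplex

variable {G V : Type*} [Group G] [MulAction G V] (X : FlagComplex G V)

/-- The oriented edges entering `A`. -/
def cut (A : Set V) : Set (V × V) := {e | X.R e.1 e.2 ∧ e.1 ∉ A ∧ e.2 ∈ A}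

/-- Two oriented edges entering `A` are neighbours if they are sides of a common triangle. -/
def CutStep (A : Set V) (e e' : V × V) : Prop :=
  e ∈ X.cut A ∧ e' ∈ X.cut A ∧ ((e.1 = e'.1 ∧ X.R e.2 e'.2) ∨ (e.2 = e'.2 ∧ X.R e.1 e'.1))

/-- A halfspace whose boundary is a (nonempty, connected) track. -/
def Track (A : Set V) : Prop :=
  (X.cut A).Nonempty ∧
    ∀ e ∈ X.cut A, ∀ e' ∈ X.cut A, Relation.ReflTransGen (X.CutStep A) e e'

variable {X}

theorem mem_cut_compl {A : Set V} {a b : V} : (a, b) ∈ X.cut Aᶜ ↔ (b, a) ∈ X.cut A := by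
  constructor
  · rintro ⟨h1, h2, h3⟩
    exact ⟨X.symm h1, h3, not_not.1 h2⟩
  · rintro ⟨h1, h2, h3⟩
    exact ⟨X.symm h1, not_not.2 h3, h2⟩

theorem cut_compl_subset {A B : Set V} (h : X.cut A ⊆ X.cut B) : X.cut Aᶜ ⊆ X.cut Bᶜ := by
  rintro ⟨a, b⟩ hab
  exact mem_cut_compl.2 (h (mem_cut_compl.1 hab))

theorem CutStep.symm {A : Set V} {e e' : V × V} (h : X.CutStep A e e') : X.CutStep A e' e := by
  obtain ⟨h1, h2, h3 | h3⟩ := h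
  · exact ⟨h2, h1, Or.inl ⟨h3.1.symm, X.symm h3.2⟩⟩
  · exact ⟨h2, h1, Or.inr ⟨h3.1.symm, X.symm h3.2⟩⟩

theorem reflTransGen_cutStep_symm {A : Set V} {e e' : V × V}
    (h : Relation.ReflTransGen (X.CutStep A) e e') : Relation.ReflTransGen (X.CutStep A) e' e := by
  induction h with
  | refl => exact .refl
  | tail _ h ih => exact .head h.symm ih

theorem Track.compl {A : Set V} (h : X.Track A) : X.Track Aᶜ := by
  obtain ⟨⟨⟨a, b⟩, he⟩, hc⟩ := h
  refine ⟨⟨(b, a), mem_cut_compl.2 he⟩, ?_⟩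
  rintro ⟨x, y⟩ hxy ⟨x', y'⟩ hxy'
  have := hc _ (mem_cut_compl.1 hxy) _ (mem_cut_compl.1 hxy')
  refine this.lift Prod.swap ?_
  rintro ⟨p, q⟩ ⟨p', q'⟩ ⟨h1, h2, h3⟩
  exact ⟨mem_cut_compl.2 h1, mem_cut_compl.2 h2, h3.symm⟩

theorem mem_cut_smul {A : Set V} (g : G) {a b : V} :
    (a, b) ∈ X.cut (g • A) ↔ (g⁻¹ • a, g⁻¹ • b) ∈ X.cut A := by
  simp only [cut, Set.mem_ofPred_eq, Set.mem_smul_set_iff_inv_smul_mem]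
  refine and_congr ⟨fun h => X.smul _ h, fun h => ?_⟩ Iff.rfl
  have := X.smul g h
  rwa [smul_inv_smul, smul_inv_smul] at this

theorem smul_mem_cut_smul {A : Set V} (g : G) {a b : V} (h : (a, b) ∈ X.cut A) :
    (g • a, g • b) ∈ X.cut (g • A) := by
  rw [mem_cut_smul, inv_smul_smul, inv_smul_smul]; exact h

theorem cut_smul_subset {A B : Set V} (g : G) (h : X.cut A ⊆ X.cut B) :
    X.cut (g • A) ⊆ X.cut (g • B) := by
  rintro ⟨a, b⟩ hab
  exact (mem_cut_smul g).2 (h ((mem_cut_smul g).1 hab))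

theorem Track.smul {A : Set V} (g : G) (h : X.Track A) : X.Track (g • A) := by
  obtain ⟨⟨⟨a, b⟩, he⟩, hc⟩ := h
  refine ⟨⟨(g • a, g • b), smul_mem_cut_smul g he⟩, ?_⟩
  rintro ⟨x, y⟩ hxy ⟨x', y'⟩ hxy'
  have := hc _ ((mem_cut_smul g).1 hxy) _ ((mem_cut_smul g).1 hxy')
  have := this.lift (p := X.CutStep (g • A)) (fun e => (g • e.1, g • e.2)) (by
    rintro ⟨p, q⟩ ⟨p', q'⟩ ⟨h1, h2, h3⟩
    refine ⟨smul_mem_cut_smul g h1, smul_mem_cut_smul g h2, ?_⟩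
    rcases h3 with h3 | h3
    · exact Or.inl ⟨congrArg (g • ·) h3.1, X.smul g h3.2⟩
    · exact Or.inr ⟨congrArg (g • ·) h3.1, X.smul g h3.2⟩)
  simpa only [Function.onFun, smul_inv_smul] using this

theorem mem_cut_of_step {A B : Set V} (hAB : X.cut A ⊆ X.cut B) {e e' : V × V}
    (he : e ∈ X.cut A) (h : X.CutStep B e e') : e' ∈ X.cut A := by
  obtain ⟨a, b⟩ := e
  obtain ⟨c, d⟩ := e'
  obtain ⟨h1, h2, h3⟩ := h
  obtain ⟨he1, he2, he3⟩ := he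
  rcases h3 with ⟨rfl, h3⟩ | ⟨rfl, h3⟩
  · refine ⟨h2.1, he2, ?_⟩
    by_contra hd
    exact (hAB (show (d, b) ∈ X.cut A from ⟨X.symm h3, hd, he3⟩)).2.1 h2.2.2
  · refine ⟨h2.1, ?_, he3⟩
    intro hc
    exact h2.2.1 (hAB (show (a, c) ∈ X.cut A from ⟨h3, he2, hc⟩)).2.2

theorem Track.cut_subset {A A' B : Set V} (hA' : X.Track A') (h : X.cut A ⊆ X.cut B)
    (h' : X.cut A' ⊆ X.cut B) {e : V × V} (he : e ∈ X.cut A) (he' : e ∈ X.cut A') :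
    X.cut A' ⊆ X.cut A := by
  intro e1 he1
  have := hA'.2 e he' e1 he1
  clear he1
  induction this with
  | refl => exact he
  | tail _ hs ih => exact mem_cut_of_step h ih ⟨h' hs.1, h' hs.2.1, hs.2.2⟩

theorem eq_of_cut_eq {A A' : Set V} (h : X.cut A = X.cut A') (hne : (X.cut A).Nonempty) :
    A = A' := by
  obtain ⟨⟨a, b⟩, hab⟩ := hne
  have hab' := hab
  rw [h] at hab'
  have step : ∀ x y, X.R x y → (x ∈ A ↔ x ∈ A') → (y ∈ A ↔ y ∈ A') := by
    intro x y hxy hx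
    have h1 := Set.ext_iff.1 h (x, y)
    have h2 := Set.ext_iff.1 h (y, x)
    simp only [cut, Set.mem_ofPred_eq, hxy, X.symm hxy, true_and] at h1 h2
    tauto
  ext x
  have := X.conn a x
  induction this with
  | refl => exact iff_of_false hab.2.1 hab'.2.1
  | tail _ hs ih => exact step _ _ hs ih

theorem Track.eq_of_mem {A A' B : Set V} (hA : X.Track A) (hA' : X.Track A')
    (h : X.cut A ⊆ X.cut B) (h' : X.cut A' ⊆ X.cut B) {e : V × V} (he : e ∈ X.cut A)
    (he' : e ∈ X.cut A') : A = A' :=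
  eq_of_cut_eq ((hA.cut_subset h' h he' he).antisymm (hA'.cut_subset h h' he he')) hA.1

theorem exists_track {B : Set V} {e₀ : V × V} (he₀ : e₀ ∈ X.cut B) :
    ∃ A, X.Track A ∧ X.cut A ⊆ X.cut B ∧ e₀ ∈ X.cut A := by
  classical
  let C : Set (V × V) := {e | Relation.ReflTransGen (X.CutStep B) e₀ e}
  have hCB : C ⊆ X.cut B := by
    intro e he
    rcases Relation.ReflTransGen.cases_tail he with h | ⟨_, -, h⟩
    · exact h ▸ he₀
    · exact h.2.1
  have hstep : ∀ e e', X.CutStep B e e' → (e ∈ C ↔ e' ∈ C) := fun e e' h =>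
    ⟨fun he => he.tail h, fun he => he.tail h.symm⟩
  let c : V → V → ZMod 2 := fun a b => if (a, b) ∈ C ∨ (b, a) ∈ C then 1 else 0
  have out : ∀ a b, a ∈ B ∨ b ∉ B → (a, b) ∉ C := by
    intro a b h hC
    have := hCB hC
    rcases h with h | h
    · exact this.2.1 h
    · exact h this.2.2
  have f1 : ∀ a b d, X.R a b → X.R b d → X.R a d → a ∉ B → b ∈ B → d ∈ B →
      ((a, b) ∈ C ↔ (a, d) ∈ C) := fun a b d h1 h2 h3 ha hb hd =>
    hstep _ _ ⟨⟨h1, ha, hb⟩, ⟨h3, ha, hd⟩, Or.inl ⟨rfl, h2⟩⟩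
  have f2 : ∀ a b d, X.R a b → X.R b d → X.R a d → a ∉ B → b ∉ B → d ∈ B →
      ((a, d) ∈ C ↔ (b, d) ∈ C) := fun a b d h1 h2 h3 ha hb hd =>
    hstep _ _ ⟨⟨h3, ha, hd⟩, ⟨h2, hb, hd⟩, Or.inr ⟨rfl, h1⟩⟩
  have t2 : (1 : ZMod 2) + 1 = 0 := rfl
  obtain ⟨χ, hχ⟩ := X.cocycle c (by
    intro a b d hab hbd had
    have hba := X.symm hab
    have hdb := X.symm hbd
    have hda := X.symm had
    by_cases ha : a ∈ B <;> by_cases hb : b ∈ B <;> by_cases hd : d ∈ B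
    · simp [c, out, ha, hb, hd]
    · have := f1 d a b hda hab hdb hd ha hb
      simp [c, out, ha, hb, hd, this]
    · have := f1 b a d hba had hbd hb ha hd
      by_cases h : (b, d) ∈ C <;> simp [c, out, ha, hb, hd, this, h, t2]
    · have := f2 b d a hbd hda hba hb hd ha
      simp [c, out, ha, hb, hd, this]
    · have := f1 a b d hab hbd had ha hb hd
      simp [c, out, ha, hb, hd, this]
    · have := f2 a d b had hdb hab ha hd hb
      by_cases h : (d, b) ∈ C <;> simp [c, out, ha, hb, hd, this, h, t2]
    · have := f2 a b d hab hbd had ha hb hd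
      simp [c, out, ha, hb, hd, this]
    · simp [c, out, ha, hb, hd])
  let A : Set V := {v | χ v ≠ χ e₀.1}
  have z2 : ∀ x y z : ZMod 2, x + y = 1 → (x = z ↔ y ≠ z) := by decide
  have z3 : ∀ x y : ZMod 2, x + y = 0 → x = y := by decide
  have hone : ∀ a b, (a, b) ∈ C → χ a + χ b = 1 := by
    intro a b h
    rw [← hχ a b (hCB h).1]
    simp only [c, if_pos (Or.inl h : (a, b) ∈ C ∨ (b, a) ∈ C)]
  have hCA : C ⊆ X.cut A := by
    intro e he
    refine ⟨(hCB he).1, ?_⟩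
    induction he with
    | refl => exact ⟨fun h => h rfl, (z2 _ _ _ (hone _ _ .refl)).1 rfl⟩
    | @tail x y hx hs ih =>
      have hy := hone _ _ (hx.tail hs)
      have hx' := hone _ _ hx
      rcases hs.2.2 with ⟨h1, -⟩ | ⟨h1, -⟩
      · have a1 : y.1 ∉ A := h1 ▸ ih.1
        exact ⟨a1, (z2 _ _ _ hy).1 (not_not.1 a1)⟩
      · have a1 : y.2 ∈ A := h1 ▸ ih.2
        exact ⟨not_not.2 ((z2 _ _ _ hy).2 a1), a1⟩
  have hAC : X.cut A ⊆ C := by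
    rintro ⟨a, b⟩ ⟨h1, h2, h3⟩
    by_contra hC
    by_cases hC' : (b, a) ∈ C
    · exact (hCA hC').2.1 h3
    · have := hχ a b h1
      simp only [c, if_neg (not_or.2 ⟨hC, hC'⟩)] at this
      have h4 := z3 _ _ this.symm
      exact h3 (h4 ▸ not_not.1 h2)
  have hEq : X.cut A = C := hAC.antisymm hCA
  have hreach : ∀ e ∈ C, Relation.ReflTransGen (X.CutStep A) e₀ e := by
    intro e he
    induction he with
    | refl => exact .refl
    | @tail x y hx hs ih =>
      exact ih.tail ⟨hCA hx, hCA (hx.tail hs), hs.2.2⟩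
  have h0 : e₀ ∈ C := Relation.ReflTransGen.refl
  refine ⟨A, ⟨⟨e₀, hCA h0⟩, fun e he e' he' => ?_⟩, hEq ▸ hCB, hCA h0⟩
  exact (reflTransGen_cutStep_symm (hreach e (hAC he))).trans (hreach e' (hAC he'))

/-- If a halfspace is constant along edges inside a track halfspace, then it is constant on it. -/
theorem Track.subset_or_subset_compl {A A' : Set V} (hA : X.Track A)
    (h : ∀ x ∈ A, ∀ y ∈ A, X.R x y → (x ∈ A' ↔ y ∈ A')) : A ⊆ A' ∨ A ⊆ A'ᶜ := by
  obtain ⟨⟨⟨a, b⟩, hab⟩, hc⟩ := hA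
  have h1 : ∀ e ∈ X.cut A, (e.2 ∈ A' ↔ b ∈ A') := by
    intro e he
    have := hc _ hab _ he
    clear he
    induction this with
    | refl => exact Iff.rfl
    | tail _ hs ih =>
      rcases hs.2.2 with h3 | h3
      · exact Iff.trans (h _ hs.1.2.2 _ hs.2.1.2.2 h3.2).symm ih
      · rw [← h3.1]
        exact ih
  have h2 : ∀ x ∈ A, (x ∈ A' ↔ b ∈ A') := by
    intro x hx
    have hconn := X.conn a x
    have hor : ∀ y, Relation.ReflTransGen X.R a y → y ∈ A → (y ∈ A' ↔ b ∈ A') := by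
      intro y hy
      induction hy with
      | refl => exact fun h => absurd h hab.2.1
      | @tail p q _ hs ih =>
        intro hq
        by_cases hp : p ∈ A
        · rw [← ih hp]
          exact h _ hq _ hp (X.symm hs)
        · exact h1 (p, q) ⟨hs, hp, hq⟩
    exact hor x hconn hx
  by_cases hb : b ∈ A'
  · exact Or.inl fun x hx => (h2 x hx).2 hb
  · exact Or.inr fun x hx hx' => hb ((h2 x hx).1 hx')

theorem Track.nested_of_subset {A A' B B' : Set V} (hA : X.Track A) (hA' : X.Track A')
    (h : X.cut A ⊆ X.cut B) (h' : X.cut A' ⊆ X.cut B') (hB : B ⊆ B') : Nested A A' := by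
  obtain ⟨⟨a, b⟩, hab⟩ := hA'.1
  have h1 : ∀ e ∈ X.cut A', (e.1 ∈ A ↔ a ∈ A) := by
    intro e he
    have := hA'.2 _ hab _ he
    clear he
    induction this with
    | refl => exact Iff.rfl
    | @tail p q _ hs ih =>
      rcases hs.2.2 with h3 | h3
      · rw [← h3.1]
        exact ih
      · refine Iff.trans ?_ ih
        have o1 : p.1 ∉ B := fun hp => (h' hs.1).2.1 (hB hp)
        have o2 : q.1 ∉ B := fun hp => (h' hs.2.1).2.1 (hB hp)
        constructor
        · intro hq
          by_contra hp
          exact o2 (h (show (p.1, q.1) ∈ X.cut A from ⟨h3.2, hp, hq⟩)).2.2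
        · intro hp
          by_contra hq
          exact o1 (h (show (q.1, p.1) ∈ X.cut A from ⟨X.symm h3.2, hq, hp⟩)).2.2
  by_cases ha : a ∈ A
  · have := hA.compl.subset_or_subset_compl (A' := A') (by
      have : ∀ x ∈ Aᶜ, ∀ y ∈ Aᶜ, X.R x y → y ∈ A' → x ∈ A' := by
        intro x hx y _ hxy hy
        by_contra hx'
        exact hx ((h1 (x, y) ⟨hxy, hx', hy⟩).2 ha)
      exact fun x hx y hy hxy => ⟨this y hy x hx (X.symm hxy), this x hx y hy hxy⟩)
    exact Or.inr (Or.inr this)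
  · have := hA.subset_or_subset_compl (A' := A') (by
      have : ∀ x ∈ A, ∀ y ∈ A, X.R x y → y ∈ A' → x ∈ A' := by
        intro x hx y _ hxy hy
        by_contra hx'
        exact ha ((h1 (x, y) ⟨hxy, hx', hy⟩).1 hx)
      exact fun x hx y hy hxy => ⟨this y hy x hx (X.symm hxy), this x hx y hy hxy⟩)
    rcases this with h | h
    · exact Or.inl h
    · exact Or.inr (Or.inl h)

end FlagComplex

theorem Nested.of_subset_of_compl {Y : Type*} {A B : Set Y} (h : Nested A B) (P : Set Y → Set Y → Prop)
    (hP : ∀ A B, A ⊆ B → P A B) (hl : ∀ A B, P Aᶜ B → P A B) (hr : ∀ A B, P A Bᶜ → P A B) :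
    P A B := by
  rcases h with h | h | h | h
  · exact hP _ _ h
  · exact hr _ _ (hP _ _ h)
  · exact hl _ _ (hP _ _ h)
  · exact hl _ _ (hr _ _ (hP _ _ h))

theorem IsWallSystem.preimage {G Y V : Type*} [Group G] [MulAction G Y] [MulAction G V]
    {𝓗 : Set (Set Y)} (h : IsWallSystem G 𝓗) {f : V → Y} (hf : ∀ (g : G) v, f (g • v) = g • f v) :
    IsWallSystem G ((fun D => f ⁻¹' D) '' 𝓗) where
  compl_mem := by
    rintro _ ⟨D, hD, rfl⟩
    exact ⟨Dᶜ, h.compl_mem D hD, rfl⟩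
  smul_mem := by
    rintro g _ ⟨D, hD, rfl⟩
    refine ⟨g • D, h.smul_mem g D hD, ?_⟩
    ext v
    simp only [Set.mem_preimage, Set.mem_smul_set_iff_inv_smul_mem, hf]
  nested := by
    rintro _ ⟨D, hD, rfl⟩ _ ⟨D', hD', rfl⟩
    rcases h.nested D hD D' hD' with h | h | h | h
    · exact Or.inl (Set.preimage_mono h)
    · exact Or.inr (Or.inl (Set.preimage_mono h))
    · exact Or.inr (Or.inr (Or.inl (Set.preimage_mono (f := f) h)))
    · exact Or.inr (Or.inr (Or.inr (Set.preimage_mono (f := f) h)))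
  finite := by
    intro x y
    refine ((h.finite (f x) (f y)).image (fun D => f ⁻¹' D)).subset ?_
    rintro _ ⟨⟨D, hD, rfl⟩, h1, h2⟩
    exact ⟨D, ⟨hD, h1, h2⟩, rfl⟩

namespace FlagComplex

variable {G V : Type*} [Group G] [MulAction G V] {X : FlagComplex G V}

variable (X) in
/-- The halfspaces bounded by the tracks of a pattern of walls. -/
def trackWalls (𝓑 : Set (Set V)) : Set (Set V) :=
  {A | X.Track A ∧ ∃ B ∈ 𝓑, X.cut A ⊆ X.cut B}

theorem isWallSystem_trackWalls {𝓑 : Set (Set V)} (h : IsWallSystem G 𝓑) :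
    IsWallSystem G (X.trackWalls 𝓑) where
  compl_mem := by
    rintro A ⟨hA, B, hB, hAB⟩
    exact ⟨hA.compl, Bᶜ, h.compl_mem B hB, cut_compl_subset hAB⟩
  smul_mem := by
    rintro g A ⟨hA, B, hB, hAB⟩
    exact ⟨hA.smul g, g • B, h.smul_mem g B hB, cut_smul_subset g hAB⟩
  nested := by
    rintro A ⟨hA, B, hB, hAB⟩ A' ⟨hA', B', hB', hAB'⟩
    refine (h.nested B hB B' hB').of_subset_of_compl
      (fun B B' => ∀ A A', X.Track A → X.Track A' → X.cut A ⊆ X.cut B → X.cut A' ⊆ X.cut B' →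
        Nested A A') ?_ ?_ ?_ A A' hA hA' hAB hAB'
    · exact fun B B' h A A' hA hA' h1 h2 => hA.nested_of_subset hA' h1 h2 h
    · intro B B' h A A' hA hA' h1 h2
      have := (h Aᶜ A' hA.compl hA' (cut_compl_subset h1) h2).compl_left
      rwa [compl_compl] at this
    · intro B B' h A A' hA hA' h1 h2
      have := (h A A'ᶜ hA hA'.compl h1 (cut_compl_subset h2)).compl_right
      rwa [compl_compl] at this
  finite := by
    intro x y
    refine wallsBetween_finite_of_chain (R := X.R) (fun x y hxy => ?_) (X.conn x y)
    have key : ∀ A ∈ wallsBetween (X.trackWalls 𝓑) x y, ∃ B ∈ wallsBetween 𝓑 x y,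
        X.cut A ⊆ X.cut B := by
      rintro A ⟨⟨hA, B, hB, hAB⟩, hx, hy⟩
      have := hAB (show (x, y) ∈ X.cut A from ⟨hxy, hx, hy⟩)
      exact ⟨B, ⟨hB, this.2.1, this.2.2⟩, hAB⟩
    choose! φ hφ using key
    refine Set.Finite.of_finite_image ((h.finite x y).subset (Set.image_subset_iff.2
      fun A hA => (hφ A hA).1)) (f := φ) ?_
    intro A hA A' hA' he
    exact hA.1.1.eq_of_mem hA'.1.1 (hφ A hA).2 (he ▸ (hφ A' hA').2)
      (e := (x, y)) ⟨hxy, hA.2⟩ ⟨hxy, hA'.2⟩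

/-- The stabilizer of a track fixes one of the walls defining it. -/
theorem exists_stabilizer_le {Y : Type*} [MulAction G Y] {𝓗 : Set (Set Y)} (h : IsWallSystem G 𝓗)
    {f : V → Y} (hf : ∀ (g : G) v, f (g • v) = g • f v) {A : Set V}
    (hA : A ∈ X.trackWalls ((fun D => f ⁻¹' D) '' 𝓗)) :
    ∃ D ∈ 𝓗, MulAction.stabilizer G A ≤ MulAction.stabilizer G D := by
  obtain ⟨⟨⟨⟨a, b⟩, hab⟩, -⟩, -, ⟨D, hD, rfl⟩, hAD⟩ := hA
  let I : Set (Set Y) := {D | D ∈ 𝓗 ∧ X.cut A ⊆ X.cut (f ⁻¹' D)}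
  have hI : I ⊆ wallsBetween 𝓗 (f a) (f b) := fun D hD =>
    ⟨hD.1, (hD.2 hab).2.1, (hD.2 hab).2.2⟩
  obtain ⟨M, hM⟩ := ((h.finite _ _).subset hI).exists_minimal ⟨D, hD, hAD⟩
  have hle : ∀ D ∈ I, M ⊆ D := by
    intro D hD
    rcases wallsBetween_chain h.nested (hI hM.1) (hI hD) with h | h
    · exact h
    · exact hM.2 hD h
  have hsm : ∀ g ∈ MulAction.stabilizer G A, ∀ D ∈ I, g • D ∈ I := by
    intro g hg D hD
    refine ⟨h.smul_mem g D hD.1, ?_⟩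
    have := cut_smul_subset g hD.2
    rw [MulAction.mem_stabilizer_iff.1 hg] at this
    convert this using 2
    ext v
    simp only [Set.mem_preimage, Set.mem_smul_set_iff_inv_smul_mem, hf]
  refine ⟨M, hM.1.1, fun g hg => ?_⟩
  refine Set.Subset.antisymm ?_ (hle _ (hsm g hg _ hM.1))
  have := hle _ (hsm g⁻¹ (inv_mem hg) _ hM.1)
  rwa [Set.subset_smul_set_iff, inv_inv] at this

variable (X) in
/-- The ordered triples spanning a (possibly degenerate) simplex. -/
def Tri (e : V × V × V) : Prop := X.R e.1 e.2.1 ∧ X.R e.1 e.2.2 ∧ X.R e.2.1 e.2.2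

end FlagComplex

/-- The triples having at least two of their members in `A`. -/
def majority {V : Type*} (A : Set V) : Set (V × V × V) :=
  {e | (e.1 ∈ A ∧ e.2.1 ∈ A) ∨ (e.1 ∈ A ∧ e.2.2 ∈ A) ∨ (e.2.1 ∈ A ∧ e.2.2 ∈ A)}

theorem majority_compl {V : Type*} (A : Set V) : majority Aᶜ = (majority A)ᶜ := by
  ext e
  simp only [majority, Set.mem_ofPred_eq, Set.mem_compl_iff]
  tauto

theorem majority_mono {V : Type*} {A B : Set V} (h : A ⊆ B) : majority A ⊆ majority B := by
  rintro e (h1 | h1 | h1)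
  · exact Or.inl ⟨h h1.1, h h1.2⟩
  · exact Or.inr (Or.inl ⟨h h1.1, h h1.2⟩)
  · exact Or.inr (Or.inr ⟨h h1.1, h h1.2⟩)

theorem smul_mem_majority_iff {G V : Type*} [Group G] [MulAction G V] (g : G) (A : Set V)
    (e : V × V × V) : g • e ∈ majority A ↔ e ∈ majority (g⁻¹ • A) := by
  simp only [majority, Set.mem_ofPred_eq, Set.mem_inv_smul_set_iff, Prod.smul_fst, Prod.smul_snd]

theorem mem_majority_diag {V : Type*} (A : Set V) (v : V) : (v, v, v) ∈ majority A ↔ v ∈ A := by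
  simp [majority]

namespace FlagComplex

variable {G V : Type*} [Group G] [MulAction G V] {X : FlagComplex G V}

theorem not_separated {A B : Set V} (h : X.cut A ⊆ X.cut B ∨ X.cut A ⊆ X.cut Bᶜ) {a b : V}
    (hab : X.R a b) (hB : a ∈ B ↔ b ∈ B) : a ∈ A ↔ b ∈ A := by
  have key : ∀ {a b}, X.R a b → (a ∈ B ↔ b ∈ B) → b ∈ A → a ∈ A := by
    intro a b hab hB hb
    by_contra ha
    rcases h with h | h
    · have := h (show (a, b) ∈ X.cut A from ⟨hab, ha, hb⟩)
      exact this.2.1 (hB.2 this.2.2)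
    · have := h (show (a, b) ∈ X.cut A from ⟨hab, ha, hb⟩)
      exact this.2.2 (hB.1 (not_not.1 this.2.1))
  exact ⟨key (X.symm hab) hB.symm, key hab hB⟩

theorem exists_mem_of_majority {B : Set V} {e : V × V × V} (he : X.Tri e) (hB : e ∈ majority B) :
    ∃ v ∈ B, ∀ A, (X.cut A ⊆ X.cut B ∨ X.cut A ⊆ X.cut Bᶜ) → (v ∈ A ↔ e ∈ majority A) := by
  obtain ⟨a, b, c⟩ := e
  obtain ⟨h1, h2, h3⟩ := he
  rcases hB with h | h | h
  · refine ⟨a, h.1, fun A hA => ?_⟩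
    have := not_separated hA h1 (iff_of_true h.1 h.2)
    simp only [majority, Set.mem_ofPred_eq]
    tauto
  · refine ⟨a, h.1, fun A hA => ?_⟩
    have := not_separated hA h2 (iff_of_true h.1 h.2)
    simp only [majority, Set.mem_ofPred_eq]
    tauto
  · refine ⟨b, h.1, fun A hA => ?_⟩
    have := not_separated hA h3 (iff_of_true h.1 h.2)
    simp only [majority, Set.mem_ofPred_eq]
    tauto

/-- The tracks of a pattern of walls separate as many triples as the walls themselves. -/
theorem majority_congr_of_trackWalls {𝓑 : Set (Set V)} (h𝓑 : IsWallSystem G 𝓑) {e e' : V × V × V}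
    (he : X.Tri e) (he' : X.Tri e')
    (h : ∀ A ∈ X.trackWalls 𝓑, e ∈ majority A ↔ e' ∈ majority A) {B : Set V} (hB : B ∈ 𝓑) :
    e ∈ majority B ↔ e' ∈ majority B := by
  classical
  have hT := isWallSystem_trackWalls (X := X) h𝓑
  let Λ : Set (Set V) := {A | X.Track A ∧ (X.cut A ⊆ X.cut B ∨ X.cut A ⊆ X.cut Bᶜ)}
  have hΛT : Λ ⊆ X.trackWalls 𝓑 := by
    rintro A ⟨hA, h | h⟩
    · exact ⟨hA, B, hB, h⟩
    · exact ⟨hA, Bᶜ, h𝓑.compl_mem B hB, h⟩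
  have hΛc : ∀ A ∈ Λ, Aᶜ ∈ Λ := by
    rintro A ⟨hA, h | h⟩
    · exact ⟨hA.compl, Or.inr (cut_compl_subset h)⟩
    · refine ⟨hA.compl, Or.inl ?_⟩
      have := cut_compl_subset h
      rwa [compl_compl] at this
  have hΛf : ∀ x y, (wallsBetween Λ x y).Finite := fun x y =>
    (hT.finite x y).subset fun A hA => ⟨hΛT hA.1, hA.2⟩
  have key1 : ∀ B' : Set V, (∀ A ∈ Λ, X.cut A ⊆ X.cut B' ∨ X.cut A ⊆ X.cut B'ᶜ) →
      (∀ A, X.Track A → X.cut A ⊆ X.cut B' → A ∈ Λ) → ∀ x y, X.R x y → x ∉ B' → y ∈ B' →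
      wallParity Λ x y = 1 := by
    intro B' hB1 hB2 x y hxy hx hy
    obtain ⟨A, hA, hAB, hmem⟩ := exists_track (show (x, y) ∈ X.cut B' from ⟨hxy, hx, hy⟩)
    have : wallsBetween Λ x y = {A} := by
      refine Set.Subset.antisymm ?_ (Set.singleton_subset_iff.2 ⟨hB2 A hA hAB, hmem.2⟩)
      rintro A' ⟨hA', hxA, hyA⟩
      have hmem' : (x, y) ∈ X.cut A' := ⟨hxy, hxA, hyA⟩
      rcases hB1 A' hA' with h | h
      · exact hA'.1.eq_of_mem hA h hAB hmem' hmem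
      · exact absurd hy (h hmem').2.2
    simp [wallParity, this]
  let χ : V → ZMod 2 := fun x => if x ∈ B then 1 else 0
  have t2 : (1 : ZMod 2) + 1 = 0 := rfl
  have hedge : ∀ x y, X.R x y → wallParity Λ x y = χ x + χ y := by
    intro x y hxy
    by_cases hx : x ∈ B <;> by_cases hy : y ∈ B
    · have : wallsBetween Λ x y = ∅ := Set.eq_empty_of_forall_notMem fun A hA =>
        hA.2.1 ((not_separated hA.1.2 hxy (iff_of_true hx hy)).2 hA.2.2)
      simp [wallParity, this, χ, hx, hy, t2]
    · rw [key1 Bᶜ (fun A hA => by rw [compl_compl]; exact hA.2.symm) (fun A h1 h2 => ⟨h1, Or.inr h2⟩)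
        x y hxy (not_not.2 hx) hy]
      simp [χ, hx, hy]
    · rw [key1 B (fun A hA => hA.2) (fun A h1 h2 => ⟨h1, Or.inl h2⟩) x y hxy hx hy]
      simp [χ, hx, hy]
    · have : wallsBetween Λ x y = ∅ := Set.eq_empty_of_forall_notMem fun A hA =>
        hA.2.1 ((not_separated hA.1.2 hxy (iff_of_false hx hy)).2 hA.2.2)
      simp [wallParity, this, χ, hx, hy]
  have z4 : ∀ a b c : ZMod 2, a + b + (b + c) = a + c := by decide
  have hall : ∀ x y, wallParity Λ x y = χ x + χ y := by
    intro x y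
    have := X.conn x y
    induction this with
    | refl =>
      have : wallsBetween Λ x x = ∅ := Set.eq_empty_of_forall_notMem fun A hA => hA.2.1 hA.2.2
      have z5 : ∀ a : ZMod 2, a + a = 0 := by decide
      simp [wallParity, this, z5]
    | @tail b c _ hs ih =>
      rw [← wallParity_add hΛc hΛf x b c, ih, hedge _ _ hs, z4]
  have key : ∀ e e', X.Tri e → X.Tri e' →
      (∀ A ∈ X.trackWalls 𝓑, e ∈ majority A ↔ e' ∈ majority A) → e ∈ majority B →
      e' ∈ majority B := by
    intro e e' he he' h h1
    by_contra h2
    obtain ⟨v, hv, hvA⟩ := exists_mem_of_majority he h1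
    have h3 : e' ∈ majority Bᶜ := by rw [majority_compl]; exact h2
    obtain ⟨v', hv', hvA'⟩ := exists_mem_of_majority he' h3
    have : wallsBetween Λ v v' = ∅ := Set.eq_empty_of_forall_notMem fun A hA => by
      have e1 := hvA A hA.1.2
      have e2 := hvA' A (by rw [compl_compl]; exact hA.1.2.symm)
      exact hA.2.1 (e1.2 ((h A (hΛT hA.1)).2 (e2.1 hA.2.2)))
    have h4 := hall v v'
    have hv'' : v' ∉ B := hv'
    simp [wallParity, this, χ, hv, hv''] at h4
  exact ⟨key e e' he he' h, key e' e he' he fun A hA => (h A hA).symm⟩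

end FlagComplex

section Cocycles

variable {G E : Type*} [Group G] [MulAction G E]

/-- The invariant one-cocycles modulo two on a set with a `G`-action. -/
def InvariantCocycle (G : Type*) {E : Type*} [Group G] [MulAction G E] (c : E → E → ZMod 2) :
    Prop :=
  (∀ x y z, c x y + c y z = c x z) ∧ ∀ (g : G) x y, c (g • x) (g • y) = c x y

theorem finite_invariantCocycle (hG : Group.FG G)
    (hE : ∃ F : Set E, F.Finite ∧ ∀ e, ∃ g : G, g • e ∈ F) :
    {c : E → E → ZMod 2 | InvariantCocycle G c}.Finite := by
  rcases isEmpty_or_nonempty E with hemp | ⟨⟨e₀⟩⟩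
  · exact Set.toFinite _
  obtain ⟨D, hD⟩ := Group.fg_def.1 hG
  obtain ⟨F, hF, hFE⟩ := hE
  have := hF.to_subtype
  let ρ : (E → E → ZMod 2) → (D → ZMod 2) × (F → ZMod 2) := fun c =>
    (fun d => c e₀ (d.1 • e₀), fun f => c e₀ f.1)
  refine Set.Finite.of_finite_image (f := ρ) (Set.toFinite _) ?_
  rintro c ⟨hc1, hc2⟩ c' ⟨hc1', hc2'⟩ heq
  have h1 : ∀ d ∈ D, c e₀ (d • e₀) = c' e₀ (d • e₀) := fun d hd =>
    congrFun (congrArg Prod.fst heq) ⟨d, hd⟩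
  have h2 : ∀ f ∈ F, c e₀ f = c' e₀ f := fun f hf => congrFun (congrArg Prod.snd heq) ⟨f, hf⟩
  have z1 : ∀ a : ZMod 2, a + a = a → a = 0 := by decide
  have z2 : ∀ a b d : ZMod 2, a + b = d → b = a + d := by decide
  have z3 : ∀ a b : ZMod 2, a + b = 0 → a = b := by decide
  have h3 : ∀ g : G, c e₀ (g • e₀) = c' e₀ (g • e₀) := by
    intro g
    have hg : g ∈ Subgroup.closure (D : Set G) := by rw [hD]; trivial
    induction hg using Subgroup.closure_induction with
    | mem x hx => exact h1 x hx
    | one => rw [one_smul, z1 _ (hc1 e₀ e₀ e₀), z1 _ (hc1' e₀ e₀ e₀)]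
    | mul x y _ _ hx hy =>
      rw [← hc1 e₀ (x • e₀), ← hc1' e₀ (x • e₀), mul_smul, hc2, hc2', hx, hy]
    | inv x _ hx =>
      have e1 := hc1 e₀ (x⁻¹ • e₀) e₀
      have e2 := hc1' e₀ (x⁻¹ • e₀) e₀
      rw [← hc2 x (x⁻¹ • e₀) e₀, smul_inv_smul, z1 _ (hc1 e₀ e₀ e₀)] at e1
      rw [← hc2' x (x⁻¹ • e₀) e₀, smul_inv_smul, z1 _ (hc1' e₀ e₀ e₀)] at e2
      rw [z3 _ _ e1, z3 _ _ e2, hx]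
  have h4 : ∀ e, c e₀ e = c' e₀ e := by
    intro e
    obtain ⟨g, hg⟩ := hFE e
    rw [← hc1 e₀ (g⁻¹ • e₀), ← hc1' e₀ (g⁻¹ • e₀), h3, ← hc2 g (g⁻¹ • e₀), ← hc2' g (g⁻¹ • e₀),
      smul_inv_smul, h2 _ hg]
  funext x y
  rw [z2 _ _ _ (hc1 e₀ x y), z2 _ _ _ (hc1' e₀ x y), h4, h4]

end Cocycles

theorem IsWallSystem.majority {G V : Type*} [Group G] [MulAction G V] {W : Set (Set V)}
    (hW : IsWallSystem G W) : IsWallSystem G (majority '' W) where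
  compl_mem := by
    rintro _ ⟨A, hA, rfl⟩
    exact ⟨Aᶜ, hW.compl_mem A hA, majority_compl A⟩
  smul_mem := by
    rintro g _ ⟨A, hA, rfl⟩
    refine ⟨g • A, hW.smul_mem g A hA, ?_⟩
    ext e
    rw [Set.mem_smul_set_iff_inv_smul_mem, smul_mem_majority_iff, inv_inv]
  nested := by
    rintro _ ⟨A, hA, rfl⟩ _ ⟨B, hB, rfl⟩
    unfold Nested
    rw [← majority_compl, ← majority_compl]
    exact (hW.nested A hA B hB).imp majority_mono
      (Or.imp majority_mono (Or.imp majority_mono majority_mono))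
  finite := by
    rintro ⟨a, b, c⟩ ⟨a', b', c'⟩
    refine (((hW.finite a a').union (hW.finite a b')).union
      ((hW.finite b a').union (hW.finite b b'))).image _root_.majority |>.subset ?_
    rintro _ ⟨⟨A, hA, rfl⟩, h1, h2⟩
    refine ⟨A, ?_, rfl⟩
    have h1' : a ∉ A ∨ b ∉ A := not_and_or.1 fun h => h1 (Or.inl h)
    have h2' : a' ∈ A ∨ b' ∈ A := by
      rcases h2 with h | h | h
      exacts [Or.inl h.1, Or.inl h.1, Or.inr h.1]
    rcases h1' with h | h <;> rcases h2' with h' | h'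
    exacts [Or.inl (Or.inl ⟨hA, h, h'⟩), Or.inl (Or.inr ⟨hA, h, h'⟩),
      Or.inr (Or.inl ⟨hA, h, h'⟩), Or.inr (Or.inr ⟨hA, h, h'⟩)]

namespace FlagComplex

variable {G V : Type*} [Group G] [MulAction G V] {X : FlagComplex G V}

theorem Tri.smul {e : V × V × V} (he : X.Tri e) (g : G) : X.Tri (g • e) :=
  ⟨X.smul g he.1, X.smul g he.2.1, X.smul g he.2.2⟩

variable (X) in
/-- The type of (possibly degenerate) simplices. -/
abbrev Simplex : Type _ := {e : V × V × V // X.Tri e}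

instance : MulAction G X.Simplex where
  smul g e := ⟨g • e.1, e.2.smul g⟩
  one_smul e := Subtype.ext (one_smul G e.1)
  mul_smul g h e := Subtype.ext (mul_smul g h e.1)

theorem coe_smul (g : G) (e : X.Simplex) : ((g • e : X.Simplex) : V × V × V) = g • e.1 := rfl

variable (X) in
/-- The halfspace of simplices defined by a halfspace of vertices. -/
def simplexWall (A : Set V) : Set X.Simplex := Subtype.val ⁻¹' majority A

theorem isWallSystem_simplexWall {W : Set (Set V)} (hW : IsWallSystem G W) :
    IsWallSystem G (X.simplexWall '' W) := by
  have := hW.majority.preimage (f := (Subtype.val : X.Simplex → _)) (fun g e => coe_smul g e)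
  rwa [Set.image_image] at this

theorem simplexWall_compl (A : Set V) : X.simplexWall Aᶜ = (X.simplexWall A)ᶜ := by
  rw [simplexWall, majority_compl]; rfl

theorem simplexWall_smul (g : G) (A : Set V) : X.simplexWall (g • A) = g • X.simplexWall A := by
  ext e
  rw [Set.mem_smul_set_iff_inv_smul_mem]
  change e.1 ∈ majority _ ↔ g⁻¹ • e.1 ∈ majority _
  rw [smul_mem_majority_iff, inv_inv]

theorem simplexWall_subset {A B : Set V} : X.simplexWall A ⊆ X.simplexWall B ↔ A ⊆ B := by
  refine ⟨fun h v hv => ?_, fun h => Set.preimage_mono (majority_mono h)⟩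
  have := @h ⟨(v, v, v), X.refl v, X.refl v, X.refl v⟩ ((mem_majority_diag A v).2 hv)
  exact (mem_majority_diag B v).1 this

theorem simplexWall_injective : Function.Injective X.simplexWall := fun _ _ h =>
  (simplexWall_subset.1 h.le).antisymm (simplexWall_subset.1 h.ge)

theorem exists_justInside {W : Set (Set V)} (hW : IsWallSystem G W) (hWt : ∀ A ∈ W, X.Track A)
    {A : Set V} (hA : A ∈ W) : ∃ e : X.Simplex, JustInside (X.simplexWall '' W) (X.simplexWall A) e := by
  suffices h : ∃ e, X.Tri e ∧ e ∈ majority A ∧ ∀ A' ∈ W, A' ⊂ A → e ∉ majority A' by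
    obtain ⟨e, he, h1, h2⟩ := h
    refine ⟨⟨e, he⟩, h1, ?_⟩
    rintro _ ⟨A', hA', rfl⟩ hlt
    exact h2 A' hA' ⟨simplexWall_subset.1 hlt.1, fun h => hlt.2 (simplexWall_subset.2 h)⟩
  by_contra hcon
  push Not at hcon
  let N : V → Set (Set V) := fun b => {A' | A' ∈ W ∧ A' ⊂ A ∧ b ∈ A'}
  have hNW : ∀ a b, (a, b) ∈ X.cut A → N b ⊆ wallsBetween W a b := fun a b hab A' h =>
    ⟨h.1, fun ha => hab.2.1 (h.2.1.1 ha), h.2.2⟩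
  have hNne : ∀ a b, (a, b) ∈ X.cut A → (N b).Nonempty := by
    intro a b hab
    obtain ⟨A', h1, h2, h3⟩ := hcon (a, b, b) ⟨hab.1, hab.1, X.refl b⟩ (Or.inr (Or.inr ⟨hab.2.2, hab.2.2⟩))
    refine ⟨A', h1, h2, ?_⟩
    simp only [majority, Set.mem_ofPred_eq] at h3
    tauto
  have hmax : ∀ e : V × V, ∃ M : Set V, e ∈ X.cut A → M ∈ N e.2 ∧ ∀ A' ∈ N e.2, A' ⊆ M := by
    rintro ⟨a, b⟩
    by_cases hab : (a, b) ∈ X.cut A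
    swap
    · exact ⟨∅, fun h => absurd h hab⟩
    obtain ⟨M, hM⟩ := ((hW.finite a b).subset (hNW a b hab)).exists_maximal (hNne a b hab)
    refine ⟨M, fun _ => ⟨hM.1, fun A' hA' => ?_⟩⟩
    rcases wallsBetween_chain hW.nested (hNW a b hab hM.1) (hNW a b hab hA') with h | h
    · exact hM.2 hA' h
    · exact h
  choose M hM using hmax
  have hstep : ∀ e e', X.CutStep A e e' → M e = M e' := by
    rintro ⟨a, b⟩ ⟨a', b'⟩ ⟨h1, h2, h3⟩
    obtain ⟨m1, m2⟩ := hM _ h1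
    obtain ⟨m1', m2'⟩ := hM _ h2
    rcases h3 with ⟨h3, h4⟩ | ⟨h3, h4⟩
    · dsimp only at h3 h4 m1 m2 m1' m2'
      subst h3
      obtain ⟨A', n1, n2, n3⟩ := hcon (a, b, b') ⟨h1.1, h2.1, h4⟩
        (Or.inr (Or.inr ⟨h1.2.2, h2.2.2⟩))
      have ha : a ∉ A' := fun h => h1.2.1 (n2.1 h)
      simp only [majority, Set.mem_ofPred_eq, ha, false_and, false_or] at n3
      have hb := m2 A' ⟨n1, n2, n3.1⟩
      have hb' := m2' A' ⟨n1, n2, n3.2⟩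
      exact (m2' _ ⟨m1.1, m1.2.1, hb n3.2⟩).antisymm (m2 _ ⟨m1'.1, m1'.2.1, hb' n3.1⟩)
    · dsimp only at h3 h4 m1 m2 m1' m2'
      subst h3
      exact (m2' _ m1).antisymm (m2 _ m1')
  obtain ⟨⟨e₀, he₀⟩, hconn⟩ := hWt A hA
  have hconst : ∀ e ∈ X.cut A, M e = M e₀ := by
    intro e he
    have := hconn e₀ he₀ e he
    clear he
    induction this with
    | refl => rfl
    | tail _ hs ih => rw [← ih, hstep _ _ hs]
  have hm0 := (hM e₀ he₀).1
  have hcut : X.cut A ⊆ X.cut (M e₀) := by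
    intro e he
    have := (hM e he).1
    rw [hconst e he] at this
    exact ⟨he.1, fun h => he.2.1 (this.2.1.1 h), this.2.2⟩
  have := (hWt A hA).eq_of_mem (hWt _ hm0.1) hcut subset_rfl he₀ (hcut he₀)
  exact hm0.2.1.ne this.symm

theorem exists_separated_pair {W : Set (Set V)} (hW : IsWallSystem G W)
    (hWt : ∀ A ∈ W, X.Track A) {A : Set V} (hA : A ∈ W) : ∃ e e' : X.Simplex,
      e ∉ X.simplexWall A ∧ e' ∈ X.simplexWall A ∧
      ∀ B ∈ W, e ∉ X.simplexWall B → e' ∈ X.simplexWall B → B = A := by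
  obtain ⟨e, he⟩ := exists_justInside hW hWt (hW.compl_mem A hA)
  obtain ⟨e', he'⟩ := exists_justInside hW hWt hA
  have hS := isWallSystem_simplexWall (X := X) hW
  refine ⟨e, e', ?_, he'.1, fun B hB h1 h2 => ?_⟩
  · have := he.1
    rw [simplexWall_compl] at this
    exact this
  rw [simplexWall_compl] at he
  have hAm : X.simplexWall A ∈ X.simplexWall '' W := ⟨A, hA, rfl⟩
  have hBm : X.simplexWall B ∈ X.simplexWall '' W := ⟨B, hB, rfl⟩
  have := he'.eq_compl hS.nested hS.compl_mem hAm (hS.compl_mem _ hBm) he h1 (not_not.2 h2)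
  exact simplexWall_injective (compl_injective this)

/-- A maximal family of walls, for a property implying that they are tracks. -/
theorem exists_maximal_walls (hG : Group.FG G)
    (hE : ∃ F : Set X.Simplex, F.Finite ∧ ∀ e, ∃ g : G, g • e ∈ F) (P : Set (Set V) → Prop)
    (hP : ∀ W, P W → IsWallSystem G W ∧ ∀ A ∈ W, X.Track A) (h0 : P ∅) :
    ∃ W, P W ∧ ∀ W', P W' → W ⊆ W' → W' = W := by
  let closed : Set (Set V) → Prop := fun Λ => (∀ A ∈ Λ, Aᶜ ∈ Λ) ∧ ∀ g : G, ∀ A ∈ Λ, g • A ∈ Λ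
  let c : Set (Set V) → X.Simplex → X.Simplex → ZMod 2 := fun Λ => wallParity (X.simplexWall '' Λ)
  let Z : Set (Set V) → Set (X.Simplex → X.Simplex → ZMod 2) := fun W => c '' {Λ | Λ ⊆ W ∧ closed Λ}
  have hsub : ∀ W, P W → ∀ Λ ⊆ W, closed Λ → IsWallSystem G Λ := fun W hW Λ hΛ hc =>
    { compl_mem := hc.1
      smul_mem := hc.2
      nested := fun A hA B hB => (hP W hW).1.nested A (hΛ hA) B (hΛ hB)
      finite := fun x y => ((hP W hW).1.finite x y).subset fun A hA => ⟨hΛ hA.1, hA.2⟩ }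
  have hZ : ∀ W, P W → Z W ⊆ {c | InvariantCocycle G c} := by
    rintro W hW _ ⟨Λ, ⟨hΛ, hc⟩, rfl⟩
    have := isWallSystem_simplexWall (X := X) (hsub W hW Λ hΛ hc)
    exact ⟨wallParity_add this.compl_mem this.finite, wallParity_smul this.smul_mem⟩
  have hinj : ∀ W, P W → ∀ Λ ⊆ W, closed Λ → ∀ Λ' ⊆ W, closed Λ' → c Λ = c Λ' → Λ ⊆ Λ' := by
    intro W hW Λ hΛ hc Λ' hΛ' hc' heq A hA
    by_contra hA'
    obtain ⟨e, e', h1, h2, h3⟩ := exists_separated_pair (hP W hW).1 (hP W hW).2 (hΛ hA)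
    have h4 : wallsBetween (X.simplexWall '' Λ) e e' = {X.simplexWall A} := by
      refine Set.Subset.antisymm ?_ (Set.singleton_subset_iff.2 ⟨⟨A, hA, rfl⟩, h1, h2⟩)
      rintro _ ⟨⟨B, hB, rfl⟩, h5, h6⟩
      rw [h3 B (hΛ hB) h5 h6]; rfl
    have h5 : wallsBetween (X.simplexWall '' Λ') e e' = ∅ := by
      refine Set.eq_empty_of_forall_notMem ?_
      rintro _ ⟨⟨B, hB, rfl⟩, h5, h6⟩
      exact hA' (h3 B (hΛ' hB) h5 h6 ▸ hB)
    have h6 := congrFun (congrFun heq e) e'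
    simp [c, wallParity, h4, h5] at h6
  have hfin : {z | ∃ W, P W ∧ Z W = z}.Finite := by
    refine (finite_invariantCocycle (E := X.Simplex) hG hE).finite_subsets.subset ?_
    rintro _ ⟨W, hW, rfl⟩
    exact hZ W hW
  obtain ⟨_, ⟨W, hW, rfl⟩, hmax⟩ := hfin.exists_maximal ⟨_, ∅, h0, rfl⟩
  refine ⟨W, hW, fun W' hW' hWW' => ?_⟩
  have hle : Z W ⊆ Z W' := Set.image_mono fun Λ hΛ => ⟨hΛ.1.trans hWW', hΛ.2⟩
  have hcl : ∀ W, P W → closed W := fun W hW => ⟨(hP W hW).1.compl_mem, (hP W hW).1.smul_mem⟩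
  obtain ⟨Λ, ⟨hΛ, hc⟩, heq⟩ := hmax ⟨W', hW', rfl⟩ hle ⟨W', ⟨subset_rfl, hcl W' hW'⟩, rfl⟩
  exact ((hinj W' hW' W' subset_rfl (hcl W' hW') Λ (hΛ.trans hWW') hc heq.symm).trans hΛ).antisymm
    hWW'

end FlagComplex

/-- The space of classes of points not separated by a wall system. -/
theorem IsWallSystem.exists_quotient {G : Type*} {E : Type u} [Group G] [MulAction G E]
    {𝓔 : Set (Set E)} (h : IsWallSystem G 𝓔) :
    ∃ (S : Type u) (_ : MulAction G S) (π : E → S) (𝓦 : Set (Set S)), Function.Surjective π ∧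
      (∀ (g : G) e, π (g • e) = g • π e) ∧ IsWallSystem G 𝓦 ∧ SeparatesPoints 𝓦 ∧
      𝓔 = (fun A => π ⁻¹' A) '' 𝓦 := by
  let R : Setoid E :=
    { r := fun x y => ∀ A ∈ 𝓔, x ∈ A ↔ y ∈ A
      iseqv := ⟨fun _ _ _ => Iff.rfl, fun h A hA => (h A hA).symm,
        fun h h' A hA => (h A hA).trans (h' A hA)⟩ }
  have hsm : ∀ (g : G) (x y : E), R x y → R (g • x) (g • y) := by
    intro g x y hxy A hA
    rw [← Set.mem_inv_smul_set_iff, ← Set.mem_inv_smul_set_iff]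
    exact hxy _ (h.smul_mem g⁻¹ A hA)
  let act : MulAction G (Quotient R) :=
    { smul := fun g => Quotient.map (fun x => g • x) (hsm g)
      one_smul := by
        rintro ⟨x⟩
        exact congrArg (Quotient.mk R) (one_smul G x)
      mul_smul := by
        rintro g g' ⟨x⟩
        exact congrArg (Quotient.mk R) (mul_smul g g' x) }
  let π : E → Quotient R := Quotient.mk R
  have hπ : Function.Surjective π := Quotient.mk_surjective
  have hsat : ∀ A ∈ 𝓔, π ⁻¹' (π '' A) = A := by
    intro A hA
    refine Set.Subset.antisymm ?_ (Set.subset_preimage_image π A)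
    rintro x ⟨y, hy, hyx⟩
    exact ((Quotient.exact hyx : R y x) A hA).1 hy
  have hpre : ∀ (g : G) (B : Set (Quotient R)), π ⁻¹' (g • B) = g • π ⁻¹' B := by
    intro g B
    ext x
    rw [Set.mem_smul_set_iff_inv_smul_mem, Set.mem_preimage, Set.mem_smul_set_iff_inv_smul_mem]
    rfl
  have hsub : ∀ {A B : Set (Quotient R)}, π ⁻¹' A ⊆ π ⁻¹' B → A ⊆ B := by
    intro A B hAB s hs
    obtain ⟨x, rfl⟩ := hπ s
    exact hAB hs
  refine ⟨Quotient R, act, π, {B | π ⁻¹' B ∈ 𝓔}, hπ, fun _ _ => rfl, ⟨?_, ?_, ?_, ?_⟩, ?_, ?_⟩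
  · exact fun B hB => h.compl_mem _ hB
  · intro g B hB
    change _ ∈ 𝓔
    rw [hpre]
    exact h.smul_mem g _ hB
  · intro A hA B hB
    exact (h.nested _ hA _ hB).imp (fun h => hsub h) (Or.imp (fun h => hsub h)
      (Or.imp (fun h => hsub h) (fun h => hsub h)))
  · intro s t
    obtain ⟨x, rfl⟩ := hπ s
    obtain ⟨y, rfl⟩ := hπ t
    refine Set.Finite.of_finite_image (f := fun B => π ⁻¹' B) ((h.finite x y).subset ?_)
      (hπ.preimage_injective.injOn)
    rintro _ ⟨B, hB, rfl⟩
    exact hB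
  · intro s t hst
    obtain ⟨x, rfl⟩ := hπ s
    obtain ⟨y, rfl⟩ := hπ t
    refine Quotient.sound fun A hA => ?_
    have := hst (π '' A) (show _ ∈ 𝓔 by rw [hsat A hA]; exact hA)
    rwa [← Set.mem_preimage, ← Set.mem_preimage, hsat A hA] at this
  · ext A
    constructor
    · intro hA
      exact ⟨π '' A, show _ ∈ 𝓔 by rw [hsat A hA]; exact hA, hsat A hA⟩
    · rintro ⟨B, hB, rfl⟩
      exact hB

theorem IsMedian.smul {G Y : Type*} [Group G] [MulAction G Y] {𝓗 : Set (Set Y)}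
    (h𝓗 : ∀ g : G, ∀ A ∈ 𝓗, g • A ∈ 𝓗) {m x y z : Y} (h : IsMedian 𝓗 m x y z) (g : G) :
    IsMedian 𝓗 (g • m) (g • x) (g • y) (g • z) := by
  intro A hA
  have := h _ (h𝓗 g⁻¹ A hA)
  simpa only [Set.mem_inv_smul_set_iff] using this

theorem exists_equivariant_on {G P Q : Type*} [Group G] [MulAction G P] [MulAction G Q] [Nonempty Q]
    {M : Set P} (hM : ∀ g : G, ∀ p ∈ M, g • p ∈ M)
    (h : ∀ p ∈ M, ∃ q : Q, ∀ g : G, g • p = p → g • q = q) :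
    ∃ f : P → Q, ∀ (g : G), ∀ p ∈ M, f (g • p) = g • f p := by
  classical
  let _ : MulAction G M :=
    { smul := fun g p => ⟨g • p.1, hM g _ p.2⟩
      one_smul := fun p => Subtype.ext (one_smul G p.1)
      mul_smul := fun g g' p => Subtype.ext (mul_smul g g' p.1) }
  obtain ⟨f, hf⟩ := exists_equivariant (G := G) (P := M) (Q := Q) (fun p => by
    obtain ⟨q, hq⟩ := h p.1 p.2
    exact ⟨q, fun g hg => hq g (congrArg Subtype.val hg)⟩)
  obtain ⟨q₀⟩ := ‹Nonempty Q›
  refine ⟨fun p => if hp : p ∈ M then f ⟨p, hp⟩ else q₀, fun g p hp => ?_⟩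
  beta_reduce
  rw [dif_pos hp, dif_pos (hM g p hp)]
  exact hf g ⟨p, hp⟩

theorem treeWalls_nonempty {X : Type*} {Γ : SimpleGraph X} (hT : Γ.IsTree) :
    ∀ H ∈ treeWalls Γ, H.Nonempty ∧ Hᶜ.Nonempty := by
  rintro _ ⟨u, u', h, rfl⟩
  exact ⟨⟨u', (treeSide_aux hT h).2.1⟩, ⟨u, (treeSide_aux hT h).2.2⟩⟩

namespace FlagComplex

variable {G : Type*} {V : Type u} [Group G] [MulAction G V] {X : FlagComplex G V}

/-- Blowing up a wall system using a tree in which its walls and the vertices are elliptic: if this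
does not create new tracks, then the fibres of the wall system are elliptic in the tree. -/
theorem elliptic_of_maximal {W : Set (Set V)} (hW : IsWallSystem G W) (hWt : ∀ A ∈ W, X.Track A)
    {U : Type*} [MulAction G U] {Γ : SimpleGraph U} (hT : Γ.IsTree)
    (hadj : ∀ (g : G) a b, Γ.Adj a b → Γ.Adj (g • a) (g • b))
    (hWU : ∀ A ∈ W, ∃ u : U, ∀ g ∈ MulAction.stabilizer G A, g • u = u)
    (hVU : ∀ v : V, ∃ u : U, ∀ g : G, g • v = v → g • u = u)
    (hmax : ∀ W', IsWallSystem G W' → (∀ A ∈ W', X.Track A ∧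
      ((∃ B ∈ W, MulAction.stabilizer G A ≤ MulAction.stabilizer G B) ∨
        ∃ u u', Γ.Adj u u' ∧ MulAction.stabilizer G A ≤
          MulAction.stabilizer G u ⊓ MulAction.stabilizer G u')) → W ⊆ W' → W' = W)
    {K : Subgroup G} {e : X.Simplex}
    (hK : ∀ k ∈ K, ∀ A ∈ W, k • e ∈ X.simplexWall A ↔ e ∈ X.simplexWall A) :
    ∃ u : U, ∀ k ∈ K, k • u = u := by
  have : Nonempty U := hT.1.nonempty
  obtain ⟨S, _, π, 𝓦, hπ, hπg, h𝓦, hsep, hE⟩ :=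
    (isWallSystem_simplexWall (X := X) hW).exists_quotient
  have hWl : ∀ A ∈ W, ∃ A' ∈ 𝓦, π ⁻¹' A' = X.simplexWall A := fun A hA => by
    have : X.simplexWall A ∈ (fun A => π ⁻¹' A) '' 𝓦 := hE ▸ ⟨A, hA, rfl⟩
    exact this
  have hWr : ∀ A' ∈ 𝓦, ∃ A ∈ W, X.simplexWall A = π ⁻¹' A' := fun A' hA' => by
    have : π ⁻¹' A' ∈ X.simplexWall '' W := hE ▸ ⟨A', hA', rfl⟩
    exact this
  have hstab : ∀ A' ∈ 𝓦, ∃ A ∈ W, MulAction.stabilizer G A' ≤ MulAction.stabilizer G A := by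
    intro A' hA'
    obtain ⟨A, hA, hAA'⟩ := hWr A' hA'
    refine ⟨A, hA, fun g hg => simplexWall_injective (X := X) ?_⟩
    rw [simplexWall_smul, hAA']
    ext x
    rw [Set.mem_smul_set_iff_inv_smul_mem, Set.mem_preimage, Set.mem_preimage, hπg,
      ← Set.mem_smul_set_iff_inv_smul_mem, MulAction.mem_stabilizer_iff.1 hg]
  obtain ⟨p, hp⟩ := exists_equivariant_on (Q := U) h𝓦.smul_mem (by
    intro A' hA'
    obtain ⟨A, hA, hle⟩ := hstab A' hA'
    obtain ⟨u, hu⟩ := hWU A hA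
    exact ⟨u, fun g hg => hu g (hle hg)⟩)
  obtain ⟨q, hq⟩ := exists_equivariant hVU
  let diag : V → X.Simplex := fun v => ⟨(v, v, v), X.refl v, X.refl v, X.refl v⟩
  let f : V → S × U := fun v => (π (diag v), q v)
  have hf : ∀ (g : G) v, f (g • v) = g • f v := fun g v => Prod.ext (hπg g (diag v)) (hq g v)
  have hU := isWallSystem_treeWalls (G := G) hT hadj
  have hH := isWallSystem_blowWalls p h𝓦 hsep hU hp
  have hB := hH.preimage hf
  have hW' := isWallSystem_trackWalls (X := X) hB
  have heq : X.trackWalls ((fun D => f ⁻¹' D) '' blowWalls 𝓦 (treeWalls Γ) p) = W := by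
    refine hmax _ hW' ?_ ?_
    · intro A hA
      refine ⟨hA.1, ?_⟩
      obtain ⟨D, hD, hle⟩ := exists_stabilizer_le hH hf hA
      rcases stabilizer_blowWalls p h𝓦 hsep (treeWalls_nonempty hT) hp hD with
        ⟨A', hA', h⟩ | ⟨_, ⟨u, u', huu', rfl⟩, h⟩
      · obtain ⟨B, hB, h'⟩ := hstab A' hA'
        exact Or.inl ⟨B, hB, hle.trans (h.trans h')⟩
      · exact Or.inr ⟨u, u', huu', fun g hg => smul_treeSide_eq_self hT hadj huu' (h (hle hg))⟩
    · intro A hA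
      obtain ⟨A', hA', hAA'⟩ := hWl A hA
      refine ⟨hWt A hA, _, ⟨_, Or.inl ⟨A', hA', rfl⟩, rfl⟩, Eq.subset ?_⟩
      congr 1
      ext v
      rw [← mem_majority_diag A v]
      exact (Set.ext_iff.1 hAA' (diag v)).symm
  have hfix : ∀ k ∈ K, k • π e = π e := by
    intro k hk
    refine hsep _ _ fun A' hA' => ?_
    obtain ⟨A, hA, hAA'⟩ := hWr A' hA'
    have := hK k hk A hA
    rwa [hAA', Set.mem_preimage, Set.mem_preimage, hπg] at this
  let r : V → U := fun v => blowRetract 𝓦 p (π e) (f v)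
  obtain ⟨m, hm⟩ := exists_treeMedian hT (r e.1.1) (r e.1.2.1) (r e.1.2.2)
  refine ⟨m, fun k hk => ?_⟩
  have hr : ∀ v, r (k • v) = k • r v := by
    intro v
    have := blowRetract_smul p h𝓦 hsep hp k (π e) (f v)
    rwa [hfix k hk, ← hf] at this
  refine (hm.smul hU.smul_mem k).unique (treeWalls_separates hT) hm fun H hH => ?_
  have := majority_congr_of_trackWalls hB (k • e : X.Simplex).2 e.2
    (fun A hA => hK k hk A (heq ▸ hA)) ⟨_, Or.inr ⟨π e, H, hH, rfl⟩, rfl⟩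
  rw [← hr, ← hr, ← hr]
  exact this

end FlagComplex

section Words

variable {G : Type u} [Group G] {p : ℕ} {H : Fin p → Subgroup G} {n : ℕ}

/-- A free generator of `F ∗ H₁ ∗ ⋯ ∗ H_p`. -/
def genWord (H : Fin p → Subgroup G) {n : ℕ} (k : ULift.{u} (Fin n)) :
    Monoid.CoprodI (relFam H n) :=
  Monoid.CoprodI.of (M := relFam H n) (i := none) (FreeGroup.of k : FreeGroup (ULift.{u} (Fin n)))

/-- An element of a peripheral factor of `F ∗ H₁ ∗ ⋯ ∗ H_p`. -/
def subWord (H : Fin p → Subgroup G) (n : ℕ) (j : Fin p) (h : H j) :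
    Monoid.CoprodI (relFam H n) :=
  Monoid.CoprodI.of (M := relFam H n) (i := some j) h

theorem word_induction {C : Monoid.CoprodI (relFam H n) → Prop} (one : C 1)
    (gen : ∀ k, C (genWord H k)) (gen_inv : ∀ k, C (genWord H k)⁻¹)
    (sub : ∀ j h, C (subWord H n j h)) (mul : ∀ x y, C x → C y → C (x * y)) (w) : C w := by
  induction w using Monoid.CoprodI.induction_on with
  | one => exact one
  | mul x y hx hy => exact mul x y hx hy
  | of i m =>
    cases i with
    | some j => exact sub j m
    | none =>
      let ι : FreeGroup (ULift.{u} (Fin n)) →* Monoid.CoprodI (relFam H n) :=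
        Monoid.CoprodI.of (M := relFam H n) (i := none)
      have : ∀ m : FreeGroup (ULift.{u} (Fin n)), C (ι m) := by
        intro m
        induction m using FreeGroup.induction_on with
        | C1 => rw [map_one]; exact one
        | of x => exact gen x
        | inv_of x _ => rw [map_inv]; exact gen_inv x
        | mul x y hx hy => rw [map_mul]; exact mul _ _ hx hy
      exact this m

/-- A right translation of `G`, twisted by a function to `ZMod 2`. -/
def twistPerm (x : G) (t : G → ZMod 2) : Equiv.Perm (G × ZMod 2) where
  toFun z := (z.1 * x⁻¹, z.2 + t z.1)
  invFun z := (z.1 * x, z.2 - t (z.1 * x))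
  left_inv z := by simp
  right_inv z := by simp

theorem exists_twisted_hom (x : ULift.{u} (Fin n) → G) (t : ULift.{u} (Fin n) → G → ZMod 2)
    (χ : Fin p → G → ZMod 2) :
    ∃ ψ : Monoid.CoprodI (relFam H n) →* Equiv.Perm (G × ZMod 2),
      (∀ k, ψ (genWord H k) = twistPerm (x k) (t k)) ∧
      ∀ j (h : H j), ψ (subWord H n j h) = twistPerm (h : G) fun g => χ j g + χ j (g * (h : G)⁻¹) := by
  let f : ∀ i, relFam H n i →* Equiv.Perm (G × ZMod 2) := fun i => match i with
    | none => (FreeGroup.lift fun k => twistPerm (x k) (t k) :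
        FreeGroup (ULift.{u} (Fin n)) →* Equiv.Perm (G × ZMod 2))
    | some j =>
      ({ toFun := fun h => twistPerm (h : G) fun g => χ j g + χ j (g * (h : G)⁻¹)
         map_one' := by
          have z : ∀ a : ZMod 2, a + a = 0 := by decide
          ext ⟨g, ε⟩ <;> simp [twistPerm, z]
         map_mul' := by
          intro h h'
          have z : ∀ a b c d : ZMod 2, d + (a + c) = d + (a + b) + (b + c) := by decide
          ext ⟨g, ε⟩
          · simp [twistPerm, mul_assoc]
          · simpa [twistPerm, mul_assoc] using z _ _ _ _ } :
        H j →* Equiv.Perm (G × ZMod 2))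
  refine ⟨Monoid.CoprodI.lift f, fun k => ?_, fun j h => ?_⟩
  · exact (Monoid.CoprodI.lift_of (M := relFam H n) f (i := none) _).trans
      FreeGroup.lift_apply_of
  · exact Monoid.CoprodI.lift_of (M := relFam H n) f (i := some j) h

end Words

section ConedCayley

variable {G : Type u} [Group G] {p : ℕ}

/-- The vertices of the coned-off Cayley graph. -/
abbrev ConeVertex (H : Fin p → Subgroup G) : Type u := G ⊕ Σ j, G ⧸ H j

/-- The coned-off Cayley graph with respect to a set of elements and a family of subgroups. -/
def coneRel (H : Fin p → Subgroup G) (D : Set G) : ConeVertex H → ConeVertex H → Prop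
  | .inl g, .inl g' => g⁻¹ * g' ∈ D
  | .inl g, .inr x => (g : G ⧸ H x.1) = x.2
  | .inr x, .inl g => (g : G ⧸ H x.1) = x.2
  | .inr x, .inr y => x = y

variable {H : Fin p → Subgroup G} {D : Set G}

theorem coneRel_smul (g : G) {a b : ConeVertex H} (h : coneRel H D a b) :
    coneRel H D (g • a) (g • b) := by
  rcases a with a | ⟨j, a⟩ <;> rcases b with b | ⟨k, b⟩
  · simpa [coneRel, Sum.smul_inl, mul_assoc] using h
  · exact congrArg (g • ·) (show (a : G ⧸ H k) = b from h)
  · exact congrArg (g • ·) (show (b : G ⧸ H j) = a from h)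
  · exact congrArg (g • ·) (show (⟨j, a⟩ : Σ j, G ⧸ H j) = ⟨k, b⟩ from h)

theorem coneRel_symm (hD : ∀ d ∈ D, d⁻¹ ∈ D) {a b : ConeVertex H} (h : coneRel H D a b) :
    coneRel H D b a := by
  rcases a with a | a <;> rcases b with b | b
  · have := hD _ h
    simpa [coneRel] using this
  · exact h
  · exact h
  · exact (show a = b from h).symm

theorem coneRel_refl (hD : 1 ∈ D) (a : ConeVertex H) : coneRel H D a a := by
  rcases a with a | a
  · simpa [coneRel] using hD
  · exact (rfl : a = a)

/-- The one-cocycles modulo two of the flag complex of a relation. -/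
def IsFlagCocycle {V : Type*} (R : V → V → Prop) (c : V → V → ZMod 2) : Prop :=
  ∀ a b d, R a b → R b d → R a d → c a b + c b d = c a d

theorem IsFlagCocycle.self {V : Type*} {R : V → V → Prop} {c : V → V → ZMod 2}
    (hc : IsFlagCocycle R c) {a : V} (h : R a a) : c a a = 0 := by
  have z : ∀ x : ZMod 2, x + x = x → x = 0 := by decide
  exact z _ (hc a a a h h h)

theorem IsFlagCocycle.comm {V : Type*} {R : V → V → Prop} {c : V → V → ZMod 2}
    (hc : IsFlagCocycle R c) {a b : V} (h : R a a) (h1 : R a b) (h2 : R b a) : c a b = c b a := by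
  have z : ∀ x y : ZMod 2, x + y = 0 → x = y := by decide
  exact z _ _ ((hc a b a h1 h2 h).trans (hc.self h))

variable {n : ℕ} (φ : Monoid.CoprodI (relFam H n) →* G)

/-- The transport homomorphism defined by a function on the edges of the coned-off Cayley graph. -/
def IsTransport (c : ConeVertex H → ConeVertex H → ZMod 2)
    (ψ : Monoid.CoprodI (relFam H n) →* Equiv.Perm (G × ZMod 2)) : Prop :=
  (∀ k, ψ (genWord H k) = twistPerm (φ (genWord H k))
    fun g => c (.inl g) (.inl (g * (φ (genWord H k))⁻¹))) ∧
  ∀ j (h : H j), ψ (subWord H n j h) = twistPerm (h : G)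
    fun g => c (.inl g) (.inr ⟨j, g⟩) +
      c (.inl (g * (h : G)⁻¹)) (.inr ⟨j, ((g * (h : G)⁻¹ : G) : G ⧸ H j)⟩)

/-- The transport along the words of `𝒲` is given by the value of the cocycle on an edge. -/
def IsFilled (𝒲 : Set (Monoid.CoprodI (relFam H n))) : Prop :=
  ∀ D : Set G, 1 ∈ D → (∀ d ∈ D, d⁻¹ ∈ D) → (∀ w ∈ 𝒲, φ w ∈ D) →
    ∀ c, IsFlagCocycle (coneRel H D) c → ∀ ψ, IsTransport φ c ψ →
      ∀ w ∈ 𝒲, ψ w = twistPerm (φ w) fun g => c (.inl g) (.inl (g * (φ w)⁻¹))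

variable {φ}

theorem IsFilled.union {𝒲 𝒲' : Set (Monoid.CoprodI (relFam H n))} (h : IsFilled φ 𝒲)
    (h' : IsFilled φ 𝒲') : IsFilled φ (𝒲 ∪ 𝒲') := by
  rintro D h1 h2 h3 c hc ψ hψ w (hw | hw)
  · exact h D h1 h2 (fun w hw => h3 w (Or.inl hw)) c hc ψ hψ w hw
  · exact h' D h1 h2 (fun w hw => h3 w (Or.inr hw)) c hc ψ hψ w hw

theorem isFilled_sUnion {𝒮 : Set (Set (Monoid.CoprodI (relFam H n)))}
    (h : ∀ 𝒲 ∈ 𝒮, IsFilled φ 𝒲) : IsFilled φ (⋃₀ 𝒮) := by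
  rintro D h1 h2 h3 c hc ψ hψ w ⟨𝒲, h𝒲, hw⟩
  exact h 𝒲 h𝒲 D h1 h2 (fun w hw => h3 w ⟨𝒲, h𝒲, hw⟩) c hc ψ hψ w hw

theorem exists_isFilled (hφ : ∀ j h, φ (subWord H n j h) = h) (w : Monoid.CoprodI (relFam H n)) :
    ∃ 𝒲 : Set (Monoid.CoprodI (relFam H n)), 𝒲.Finite ∧ w ∈ 𝒲 ∧ IsFilled φ 𝒲 := by
  induction w using word_induction with
  | one =>
    refine ⟨{1}, Set.finite_singleton _, rfl, ?_⟩
    rintro D h1 h2 h3 c hc ψ hψ _ rfl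
    ext ⟨g, ε⟩
    · simp [twistPerm]
    · have := hc.self (coneRel_refl h1 (.inl g))
      simp [twistPerm, this]
  | gen k =>
    refine ⟨{genWord H k}, Set.finite_singleton _, rfl, ?_⟩
    rintro D h1 h2 h3 c hc ψ hψ _ rfl
    exact hψ.1 k
  | gen_inv k =>
    refine ⟨{(genWord H k)⁻¹}, Set.finite_singleton _, rfl, ?_⟩
    rintro D h1 h2 h3 c hc ψ hψ _ rfl
    rw [map_inv, hψ.1 k, inv_eq_iff_mul_eq_one]
    have h4 := h3 _ rfl
    rw [map_inv] at h4
    have h5 := h2 _ h4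
    rw [inv_inv] at h5
    ext ⟨g, ε⟩
    · simp [twistPerm]
    · have := hc.comm (a := .inl g) (b := .inl (g * φ (genWord H k))) (coneRel_refl h1 _)
        (by simpa [coneRel] using h5) (by simpa [coneRel] using h4)
      have z : ∀ x y : ZMod 2, x + y + y = x := by decide
      simp [twistPerm, this, z]
  | sub j h =>
    refine ⟨{subWord H n j h}, Set.finite_singleton _, rfl, ?_⟩
    rintro D h1 h2 h3 c hc ψ hψ _ rfl
    rw [hψ.2, hφ]
    have h4 := h3 _ rfl
    rw [hφ] at h4
    congr 1
    funext g
    have e : ((g * (h : G)⁻¹ : G) : G ⧸ H j) = (g : G ⧸ H j) := by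
      rw [QuotientGroup.eq]; simp
    rw [e]
    have := hc (.inl g) (.inl (g * (h : G)⁻¹)) (.inr ⟨j, g⟩)
      (by simpa [coneRel] using h2 _ h4) e rfl
    have z : ∀ x y w : ZMod 2, x + y = w → w + y = x := by decide
    exact z _ _ _ this
  | mul w w' hw hw' =>
    obtain ⟨𝒲, hf, hm, h𝒲⟩ := hw
    obtain ⟨𝒲', hf', hm', h𝒲'⟩ := hw'
    refine ⟨insert (w * w') (𝒲 ∪ 𝒲'), (hf.union hf').insert _, Or.inl rfl, ?_⟩
    rintro D h1 h2 h3 c hc ψ hψ v hv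
    have hU := h𝒲.union h𝒲' D h1 h2 (fun w hw => h3 w (Or.inr hw)) c hc ψ hψ
    rcases hv with rfl | hv
    swap
    · exact hU v hv
    rw [map_mul, hU w (Or.inl hm), hU w' (Or.inr hm')]
    have d1 := h2 _ (h3 w (Or.inr (Or.inl hm)))
    have d2 := h2 _ (h3 w' (Or.inr (Or.inr hm')))
    have d3 := h2 _ (h3 _ (Or.inl rfl))
    ext ⟨g, ε⟩
    · simp [twistPerm, mul_assoc]
    · have := hc (.inl g) (.inl (g * (φ w')⁻¹)) (.inl (g * (φ w')⁻¹ * (φ w)⁻¹))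
        (by simpa [coneRel] using d2)
        (by simpa [coneRel, mul_assoc] using d1)
        (by simpa [coneRel, mul_assoc] using d3)
      simp [twistPerm, mul_assoc, add_assoc] at this ⊢
      exact this

theorem exists_isTransport (c : ConeVertex H → ConeVertex H → ZMod 2) : ∃ ψ, IsTransport φ c ψ :=
  exists_twisted_hom _ _ fun j g => c (.inl g) (.inr ⟨j, g⟩)

theorem IsTransport.exists_twistPerm {c : ConeVertex H → ConeVertex H → ZMod 2}
    {ψ : Monoid.CoprodI (relFam H n) →* Equiv.Perm (G × ZMod 2)} (hψ : IsTransport φ c ψ)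
    (hφ : ∀ j h, φ (subWord H n j h) = h) (w : Monoid.CoprodI (relFam H n)) :
    ∃ t, ψ w = twistPerm (φ w) t := by
  induction w using word_induction with
  | one => exact ⟨0, by ext ⟨g, ε⟩ <;> simp [twistPerm]⟩
  | gen k => exact ⟨_, hψ.1 k⟩
  | gen_inv k =>
    refine ⟨fun g => c (.inl (g * φ (genWord H k))) (.inl g), ?_⟩
    have z : ∀ x y : ZMod 2, x + y + y = x := by decide
    rw [map_inv, hψ.1 k, inv_eq_iff_mul_eq_one]
    ext ⟨g, ε⟩ <;> simp [twistPerm, z]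
  | sub j h => exact ⟨_, by rw [hψ.2 j h, hφ]⟩
  | mul x y hx hy =>
    obtain ⟨t, ht⟩ := hx
    obtain ⟨t', ht'⟩ := hy
    refine ⟨fun g => t' g + t (g * (φ y)⁻¹), ?_⟩
    rw [map_mul, ht, ht']
    ext ⟨g, ε⟩
    · simp [twistPerm, mul_assoc]
    · simp [twistPerm, add_assoc]

/-- A transport homomorphism which factors through `G` is the coboundary of a function. -/
theorem IsTransport.exists_potential {c : ConeVertex H → ConeVertex H → ZMod 2}
    {ψ : Monoid.CoprodI (relFam H n) →* Equiv.Perm (G × ZMod 2)} (hψ : IsTransport φ c ψ)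
    (hφ : ∀ j h, φ (subWord H n j h) = h) (hs : Function.Surjective φ)
    (hker : φ.ker ≤ ψ.ker) :
    ∃ f : G → ZMod 2, ∀ w t, ψ w = twistPerm (φ w) t → ∀ g, t g = f g + f (g * (φ w)⁻¹) := by
  have hfac : ∀ w w', φ w = φ w' → ψ w = ψ w' := by
    intro w w' h
    have h1 : w⁻¹ * w' ∈ φ.ker := by rw [MonoidHom.mem_ker, map_mul, map_inv, h, inv_mul_cancel]
    have h2 := MonoidHom.mem_ker.1 (hker h1)
    rw [map_mul, map_inv] at h2
    exact inv_mul_eq_one.1 h2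
  choose v hv using fun g : G => hs g⁻¹
  have hfst : ∀ g, (ψ (v g) (1, 0)).1 = g := by
    intro g
    obtain ⟨t, ht⟩ := hψ.exists_twistPerm hφ (v g)
    rw [ht, hv]
    simp [twistPerm]
  refine ⟨fun g => (ψ (v g) (1, 0)).2, fun w t ht g => ?_⟩
  have h1 : ψ (w * v g) = ψ (v (g * (φ w)⁻¹)) := hfac _ _ (by simp [hv])
  have h2 : ψ (v (g * (φ w)⁻¹)) (1, 0) = ψ w (ψ (v g) (1, 0)) := by
    rw [← h1, map_mul, Equiv.Perm.mul_apply]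
  have h3 : (ψ (v (g * (φ w)⁻¹)) (1, 0)).2 = (ψ (v g) (1, 0)).2 + t g := by
    rw [h2, ht]
    change _ + t (ψ (v g) (1, 0)).1 = _
    rw [hfst]
  have z : ∀ x y : ZMod 2, x = y + (y + x) := by decide
  beta_reduce
  rw [h3]
  exact z _ _

theorem exists_coboundary (hφ : ∀ j h, φ (subWord H n j h) = h) (hs : Function.Surjective φ)
    {r 𝒲 : Set (Monoid.CoprodI (relFam H n))} (hr : φ.ker = Subgroup.normalClosure r)
    (hrW : r ⊆ 𝒲) (h𝒲 : IsFilled φ 𝒲)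
    (hD : ∀ d, d ∈ D ↔ d = 1 ∨ ∃ w ∈ 𝒲, d = φ w ∨ d = (φ w)⁻¹)
    {c : ConeVertex H → ConeVertex H → ZMod 2} (hc : IsFlagCocycle (coneRel H D) c) :
    ∃ χ : ConeVertex H → ZMod 2, ∀ a b, coneRel H D a b → c a b = χ a + χ b := by
  have z0 : ∀ x : ZMod 2, x + x = 0 := by decide
  have D1 : 1 ∈ D := (hD 1).2 (Or.inl rfl)
  have Dinv : ∀ d ∈ D, d⁻¹ ∈ D := by
    intro d hd
    rcases (hD d).1 hd with rfl | ⟨w, hw, rfl | rfl⟩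
    · simpa using D1
    · exact (hD _).2 (Or.inr ⟨w, hw, Or.inr rfl⟩)
    · exact (hD _).2 (Or.inr ⟨w, hw, Or.inl (inv_inv _)⟩)
  have hrefl := coneRel_refl (H := H) D1
  have hself : ∀ a, c a a = 0 := fun a => hc.self (hrefl a)
  have hcomm : ∀ a b, coneRel H D a b → c a b = c b a := fun a b h =>
    hc.comm (hrefl a) h (coneRel_symm Dinv h)
  obtain ⟨ψ, hψ⟩ := exists_isTransport (φ := φ) c
  have hfill := h𝒲 D D1 Dinv (fun w hw => (hD _).2 (Or.inr ⟨w, hw, Or.inl rfl⟩)) c hc ψ hψ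
  have hker : φ.ker ≤ ψ.ker := by
    rw [hr]
    refine Subgroup.normalClosure_le_normal fun w hw => ?_
    have hw1 : φ w = 1 := by
      rw [← MonoidHom.mem_ker, hr]
      exact Subgroup.subset_normalClosure hw
    rw [SetLike.mem_coe, MonoidHom.mem_ker, hfill w (hrW hw), hw1]
    ext ⟨g, ε⟩ <;> simp [twistPerm, hself]
  obtain ⟨f, hf⟩ := hψ.exists_potential hφ hs hker
  have hW : ∀ w ∈ 𝒲, ∀ g, c (.inl g) (.inl (g * (φ w)⁻¹)) = f g + f (g * (φ w)⁻¹) :=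
    fun w hw g => hf w _ (hfill w hw) g
  have hH : ∀ j (h : H j) g, c (.inl g) (.inr ⟨j, g⟩) +
      c (.inl (g * (h : G)⁻¹)) (.inr ⟨j, ((g * (h : G)⁻¹ : G) : G ⧸ H j)⟩) =
      f g + f (g * (h : G)⁻¹) := by
    intro j h g
    have := hf (subWord H n j h) _ ((hψ.2 j h).trans (by rw [hφ])) g
    rwa [hφ] at this
  have hcone : ∀ j (g : G), c (.inl g) (.inr ⟨j, g⟩) =
      f g + (f (g : G ⧸ H j).out + c (.inl (g : G ⧸ H j).out) (.inr ⟨j, g⟩)) := by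
    intro j g
    have hm : (g : G ⧸ H j).out⁻¹ * g ∈ H j := by
      rw [← QuotientGroup.eq, QuotientGroup.out_eq']
    have := hH j ⟨_, hm⟩ g
    have e : g * ((g : G ⧸ H j).out⁻¹ * g)⁻¹ = (g : G ⧸ H j).out := by group
    simp only [e, QuotientGroup.out_eq'] at this
    have z : ∀ x y u v : ZMod 2, x + y = u + v → x = u + (v + y) := by decide
    exact z _ _ _ _ this
  refine ⟨Sum.elim f fun x => f x.2.out + c (.inl x.2.out) (.inr x), ?_⟩
  rintro (g | ⟨j, x⟩) (g' | ⟨k, y⟩) hab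
  · rcases (hD _).1 (show g⁻¹ * g' ∈ D from hab) with h | ⟨w, hw, h | h⟩
    · obtain rfl := inv_mul_eq_one.1 h
      simp [hself, z0]
    · have e : g = g' * (φ w)⁻¹ := by rw [← h]; group
      rw [hcomm _ _ hab, add_comm]
      subst e
      exact hW w hw g'
    · have e : g' = g * (φ w)⁻¹ := by rw [← h]; group
      subst e
      exact hW w hw g
  · obtain rfl : (g : G ⧸ H k) = y := hab
    exact hcone k g
  · rw [hcomm _ _ hab, add_comm]
    obtain rfl : (g' : G ⧸ H j) = x := hab
    exact hcone j g'
  · have h : (Sum.inr ⟨j, x⟩ : ConeVertex H) = .inr ⟨k, y⟩ := congrArg Sum.inr (show (⟨j, x⟩ : Σ j, G ⧸ H j) = ⟨k, y⟩ from hab)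
    rw [h, hself, z0]

theorem coneRel_conn (hφ : ∀ j h, φ (subWord H n j h) = h) (hs : Function.Surjective φ)
    (D1 : 1 ∈ D) (Dinv : ∀ d ∈ D, d⁻¹ ∈ D) (hg : ∀ k, φ (genWord H k) ∈ D)
    (a b : ConeVertex H) : Relation.ReflTransGen (coneRel H D) a b := by
  have key : ∀ w (g : G), Relation.ReflTransGen (coneRel H D) (.inl g) (.inl (g * φ w)) := by
    intro w
    induction w using word_induction with
    | one => intro g; rw [map_one, mul_one]
    | gen k => exact fun g => .single (by simpa [coneRel] using hg k)
    | gen_inv k => exact fun g => .single (by simpa [coneRel] using Dinv _ (hg k))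
    | sub j h =>
      intro g
      refine .tail (b := .inr ⟨j, g⟩)
        (.single (show coneRel H D (.inl g) (.inr ⟨j, g⟩) from rfl)) ?_
      change ((g * φ (subWord H n j h) : G) : G ⧸ H j) = g
      rw [hφ, QuotientGroup.mk_mul_of_mem _ h.2]
    | mul x y hx hy =>
      intro g
      rw [map_mul, ← mul_assoc]
      exact (hx g).trans (hy _)
  have key' : ∀ g g' : G, Relation.ReflTransGen (coneRel H D) (.inl g) (.inl g') := by
    intro g g'
    obtain ⟨w, hw⟩ := hs (g⁻¹ * g')
    have := key w g
    rwa [hw, mul_inv_cancel_left] at this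
  have hinl : ∀ a : ConeVertex H, ∃ g : G, coneRel H D (.inl g) a := by
    rintro (g | ⟨j, x⟩)
    · exact ⟨g, coneRel_refl D1 _⟩
    · exact ⟨x.out, QuotientGroup.out_eq' x⟩
  obtain ⟨g, hga⟩ := hinl a
  obtain ⟨g', hgb⟩ := hinl b
  exact .head (coneRel_symm Dinv hga) ((key' g g').tail hgb)

/-- A relatively finitely presented group acts on a cocompact simply connected complex, with
trivial edge stabilizers, and with vertex stabilizers trivial or conjugate to a peripheral
subgroup. -/
theorem RelFinitelyPresented.exists_flagComplex (h : RelFinitelyPresented H) :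
    ∃ (V : Type u) (_ : MulAction G V) (X : FlagComplex G V), Nonempty V ∧
      (∃ F : Set X.Simplex, F.Finite ∧ ∀ e : X.Simplex, ∃ g : G, g • e ∈ F) ∧
      (∀ a b, X.R a b → a ≠ b → ∀ g : G, g • a = a → g • b = b → g = 1) ∧
      (∀ v : V, (∀ g : G, g • v = v → g = 1) ∨
        ∃ j, ∃ g : G, MulAction.stabilizer G v = (H j).map (MulAut.conj g).toMonoidHom) ∧
      ∀ j, ∃ v : V, ∀ h ∈ H j, h • v = v := by
  obtain ⟨n, φ, hs, hφ, r, hrf, hr⟩ := h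
  replace hφ : ∀ j h, φ (subWord H n j h) = h := hφ
  choose 𝒱 hf hm h𝒱 using exists_isFilled hφ
  have hfin : (r ∪ Set.range (genWord (n := n) H)).Finite := hrf.union (Set.finite_range _)
  set 𝒲 := ⋃₀ (𝒱 '' (r ∪ Set.range (genWord (n := n) H))) with h𝒲
  have hW : IsFilled φ 𝒲 := isFilled_sUnion (by rintro _ ⟨w, -, rfl⟩; exact h𝒱 w)
  have hWf : 𝒲.Finite := (hfin.image _).sUnion (by rintro _ ⟨w, -, rfl⟩; exact hf w)
  have hsub : r ∪ Set.range (genWord (n := n) H) ⊆ 𝒲 := fun w hw => ⟨𝒱 w, ⟨w, hw, rfl⟩, hm w⟩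
  let D : Set G := {d | d = 1 ∨ ∃ w ∈ 𝒲, d = φ w ∨ d = (φ w)⁻¹}
  have hDf : D.Finite := by
    refine ((Set.finite_singleton (1 : G)).union
      ((hWf.image φ).union (hWf.image fun w => (φ w)⁻¹))).subset ?_
    rintro d (rfl | ⟨w, hw, rfl | rfl⟩)
    · exact Or.inl rfl
    · exact Or.inr (Or.inl ⟨w, hw, rfl⟩)
    · exact Or.inr (Or.inr ⟨w, hw, rfl⟩)
  have D1 : 1 ∈ D := Or.inl rfl
  have Dinv : ∀ d ∈ D, d⁻¹ ∈ D := by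
    rintro d (rfl | ⟨w, hw, rfl | rfl⟩)
    · simpa using D1
    · exact Or.inr ⟨w, hw, Or.inr rfl⟩
    · exact Or.inr ⟨w, hw, Or.inl (inv_inv _)⟩
  have hstab1 : ∀ (x : G) (g : G), g • (Sum.inl x : ConeVertex H) = .inl x → g = 1 := by
    intro x g hg
    exact mul_eq_right.1 (show g * x = x from Sum.inl_injective hg)
  let X : FlagComplex G (ConeVertex H) :=
    { R := coneRel H D
      refl := coneRel_refl D1
      symm := coneRel_symm Dinv
      smul := coneRel_smul
      conn := coneRel_conn hφ hs D1 Dinv fun k =>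
        Or.inr ⟨_, hsub (Or.inr ⟨k, rfl⟩), Or.inl rfl⟩
      cocycle := fun c hc => exists_coboundary hφ hs hr
        (Set.subset_union_left.trans hsub) hW (fun _ => Iff.rfl) hc }
  refine ⟨ConeVertex H, inferInstance, X, ⟨.inl 1⟩, ?_, ?_, ?_, ?_⟩
  · let N : Set (ConeVertex H) := Sum.inl '' D ∪ Set.range fun j => .inr ⟨j, ((1 : G) : G ⧸ H j)⟩
    have hN : N.Finite := (hDf.image _).union (Set.finite_range _)
    have hnear : ∀ a : ConeVertex H, coneRel H D (.inl 1) a → a ∈ N := by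
      rintro (d | ⟨j, x⟩) h
      · exact Or.inl ⟨d, by simpa [coneRel] using h, rfl⟩
      · obtain rfl : ((1 : G) : G ⧸ H j) = x := h
        exact Or.inr ⟨j, rfl⟩
    have hone : ∀ a b d : ConeVertex H, coneRel H D a b → coneRel H D a d → coneRel H D b d →
        ∃ g : G, coneRel H D (.inl 1) (g • a) ∧ coneRel H D (.inl 1) (g • b) ∧
          coneRel H D (.inl 1) (g • d) := by
      have hmv : ∀ (x : G) (a : ConeVertex H), coneRel H D (.inl x) a →
          coneRel H D (.inl 1) (x⁻¹ • a) := by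
        intro x a h
        have := coneRel_smul x⁻¹ h
        rwa [Sum.smul_inl, smul_eq_mul, inv_mul_cancel] at this
      rintro a b d hab had hbd
      rcases a with a | a
      · exact ⟨a⁻¹, hmv a _ (coneRel_refl D1 _), hmv a _ hab, hmv a _ had⟩
      rcases b with b | b
      · exact ⟨b⁻¹, hmv b _ (coneRel_symm Dinv hab), hmv b _ (coneRel_refl D1 _), hmv b _ hbd⟩
      rcases d with d | d
      · exact ⟨d⁻¹, hmv d _ (coneRel_symm Dinv had), hmv d _ (coneRel_symm Dinv hbd),
          hmv d _ (coneRel_refl D1 _)⟩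
      obtain rfl : a = b := hab
      obtain rfl : a = d := had
      have : coneRel H D (.inl a.2.out) (.inr a) := QuotientGroup.out_eq' a.2
      exact ⟨a.2.out⁻¹, hmv _ _ this, hmv _ _ this, hmv _ _ this⟩
    refine ⟨Subtype.val ⁻¹' (N ×ˢ N ×ˢ N),
      (hN.prod (hN.prod hN)).preimage Subtype.val_injective.injOn, ?_⟩
    rintro ⟨⟨a, b, d⟩, hab, had, hbd⟩
    obtain ⟨g, h1, h2, h3⟩ := hone a b d hab had hbd
    exact ⟨g, hnear _ h1, hnear _ h2, hnear _ h3⟩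
  · rintro (a | a) (b | b) hab hne g ha hb
    · exact hstab1 a g ha
    · exact hstab1 a g ha
    · exact hstab1 b g hb
    · exact absurd (congrArg Sum.inr (show a = b from hab)) hne
  · rintro (a | ⟨j, x⟩)
    · exact Or.inl (hstab1 a)
    · refine Or.inr ⟨j, x.out, ?_⟩
      ext g
      rw [MulAction.mem_stabilizer_iff, Subgroup.mem_map_equiv]
      constructor
      · intro hg
        have h1 : g • x = x := by simpa using hg
        rw [← QuotientGroup.out_eq' x, MulAction.Quotient.smul_mk] at h1
        have h2 := QuotientGroup.eq.1 h1.symm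
        simpa [mul_assoc] using h2
      · intro hg
        have h2 : x.out⁻¹ * (g * x.out) ∈ H j := by simpa [mul_assoc] using hg
        have h1 := (QuotientGroup.eq.2 h2).symm
        change (Sum.inr (⟨j, g • x⟩ : Σ j, G ⧸ H j) : ConeVertex H) = _
        congr 2
        rw [QuotientGroup.out_eq'] at h1
        conv_lhs => rw [← QuotientGroup.out_eq' x]
        exact h1
  · intro j
    refine ⟨.inr ⟨j, ((1 : G) : G ⧸ H j)⟩, fun h hh => ?_⟩
    change (Sum.inr (⟨j, ((h * 1 : G) : G ⧸ H j)⟩ : Σ j, G ⧸ H j) : ConeVertex H) = _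
    congr 2
    exact (QuotientGroup.eq.2 (by simpa using hh)).symm

end ConedCayley

section Finiteness

variable {G V : Type*} [Group G] [MulAction G V] {X : FlagComplex G V}

theorem FlagComplex.Track.stabilizer_fg
    (hX : ∃ F : Set X.Simplex, F.Finite ∧ ∀ e, ∃ g : G, g • e ∈ F)
    (hfree : ∀ a b, X.R a b → a ≠ b → ∀ g : G, g • a = a → g • b = b → g = 1)
    {W : Set (Set V)} (hW : IsWallSystem G W) {A : Set V} (hA : A ∈ W) (ht : X.Track A) :
    (MulAction.stabilizer G A).FG := by
  obtain ⟨F, hF, hFX⟩ := hX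
  let f₁ : X.Simplex → (V × V) × (V × V) := fun e => ((e.1.1, e.1.2.1), (e.1.1, e.1.2.2))
  let f₂ : X.Simplex → (V × V) × (V × V) := fun e => ((e.1.1, e.1.2.2), (e.1.2.1, e.1.2.2))
  let I : (V × V) × (V × V) → Set V → Prop := fun p B => B ∈ W ∧ X.CutStep B p.1 p.2
  obtain ⟨F', hF', hFF⟩ := exists_finite_stabilizer_orbits ((hF.image f₁).union (hF.image f₂)) I
    (by
      rintro g ⟨⟨a, b⟩, a', b'⟩ B ⟨hB, h1, h2, h3⟩
      refine ⟨hW.smul_mem g B hB, X.smul_mem_cut_smul g h1, X.smul_mem_cut_smul g h2, ?_⟩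
      exact h3.imp (fun h => ⟨congrArg (g • ·) h.1, X.smul g h.2⟩)
        (fun h => ⟨congrArg (g • ·) h.1, X.smul g h.2⟩))
    (by
      rintro ⟨⟨a, b⟩, p'⟩
      exact (hW.finite a b).subset fun B hB => ⟨hB.1, hB.2.1.2.1, hB.2.1.2.2⟩) A
  obtain ⟨⟨p0, hp0⟩, hc⟩ := ht
  refine fg_of_connected_action _ (X.CutStep A) p0 (fun k hk => hc _ hp0 _ ?_) hF' ?_ ?_
  · have := X.smul_mem_cut_smul (a := p0.1) (b := p0.2) k hp0
    rwa [MulAction.mem_stabilizer_iff.1 hk] at this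
  · intro p p' h
    obtain ⟨k, hk, f, hf, e⟩ := hFF (p, p') (by
      obtain ⟨a, b⟩ := p
      obtain ⟨a', b'⟩ := p'
      obtain ⟨h1, h2, ⟨e, h3⟩ | ⟨e, h3⟩⟩ := h
      · obtain rfl : a = a' := e
        obtain ⟨g, hg⟩ := hFX ⟨(a, b, b'), h1.1, h2.1, h3⟩
        exact ⟨g, Or.inl ⟨_, hg, rfl⟩⟩
      · obtain rfl : b = b' := e
        obtain ⟨g, hg⟩ := hFX ⟨(a, a', b), h3, h1.1, h2.1⟩
        exact ⟨g, Or.inr ⟨_, hg, rfl⟩⟩) ⟨hA, h⟩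
    exact ⟨k, hk, f, hf, congrArg Prod.fst e, congrArg Prod.snd e⟩
  · intro p hp
    have hpA : p ∈ X.cut A := by
      rcases Relation.ReflTransGen.cases_tail hp with rfl | ⟨q, -, h⟩
      · exact hp0
      · exact h.2.1
    have : MulAction.stabilizer G p ⊓ MulAction.stabilizer G A = ⊥ := by
      rw [eq_bot_iff]
      rintro g ⟨hg, -⟩
      have hg' : g • p = p := hg
      refine hfree p.1 p.2 hpA.1 (fun h => hpA.2.1 (h ▸ hpA.2.2)) g (congrArg Prod.fst hg')
        (congrArg Prod.snd hg')
    rw [this]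
    exact Subgroup.FG.bot

theorem FlagComplex.exists_finite_walls
    (hX : ∃ F : Set X.Simplex, F.Finite ∧ ∀ e, ∃ g : G, g • e ∈ F)
    {W : Set (Set V)} (hW : IsWallSystem G W) (ht : ∀ A ∈ W, X.Track A) :
    ∃ F : Set (Set V), F.Finite ∧ ∀ A ∈ W, ∃ g : G, g • A ∈ F := by
  obtain ⟨F, hF, hFX⟩ := hX
  refine ⟨⋃ e ∈ F, wallsBetween W e.1.1 e.1.2.1, hF.biUnion fun e _ => hW.finite _ _, ?_⟩
  intro A hA
  obtain ⟨⟨a, b⟩, hab, ha, hb⟩ := (ht A hA).1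
  obtain ⟨g, hg⟩ := hFX ⟨(a, b, b), hab, hab, X.refl b⟩
  refine ⟨g, Set.mem_biUnion hg ⟨hW.smul_mem g A hA, ?_, Set.smul_mem_smul_set hb⟩⟩
  exact fun h => ha (Set.smul_mem_smul_set_iff.1 h)

variable {S : Type*} [MulAction G S] {𝓦 : Set (Set S)}

theorem stabilizer_topWall_le (hW : IsWallSystem G 𝓦) (hsep : SeparatesPoints 𝓦) {s x : S}
    (h : x ≠ s) : MulAction.stabilizer G (topWall 𝓦 s x) ≤ MulAction.stabilizer G s := by
  have hm := topWall_mem hW.nested hW.compl_mem hW.finite hsep h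
  have hmax : ∀ B ∈ wallsBetween 𝓦 s x, B ⊆ topWall 𝓦 s x := fun B hB =>
    Set.subset_sUnion_of_mem hB
  set A := topWall 𝓦 s x
  intro g hg
  have hgA : g • A = A := hg
  have hgs : g • s ∉ A := by
    rw [← hgA, Set.smul_mem_smul_set_iff]
    exact hm.2.1
  have hout : ∀ B ∈ 𝓦, A ⊆ B → s ∉ B → B = A := fun B hB h1 h2 =>
    (hmax B ⟨hB, h2, h1 hm.2.2⟩).antisymm h1
  have key : ∀ B ∈ 𝓦, s ∉ B → g • s ∉ B := by
    intro B hB hs hgB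
    rcases hW.nested A hm.1 B hB with h1 | h1 | h1 | h1
    · exact hgs (hout B hB h1 hs ▸ hgB)
    · have h2 : g⁻¹ • Bᶜ = A := by
        refine hout _ (hW.smul_mem _ _ (hW.compl_mem B hB)) ?_ ?_
        · rw [← inv_smul_eq_iff.2 hgA.symm]
          exact Set.smul_set_mono h1
        · rw [Set.mem_inv_smul_set_iff]
          exact not_not.2 hgB
      have h3 : Bᶜ = A := by rw [← hgA, ← h2, smul_inv_smul]
      exact hm.2.1 (h3 ▸ hs)
    · exact hs (h1 hm.2.1)
    · exact h1 hgs hgB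
  refine hsep _ _ fun B hB => ⟨fun h1 => ?_, fun h1 => ?_⟩
  · by_contra h2
    exact key B hB h2 h1
  · by_contra h2
    exact key Bᶜ (hW.compl_mem B hB) (not_not.2 h1) h2

theorem exists_finite_interval (hW : IsWallSystem G 𝓦) (hsep : SeparatesPoints 𝓦) (x y : S) :
    {s | ∀ A ∈ 𝓦, x ∈ A → y ∈ A → s ∈ A}.Finite := by
  refine Set.Finite.of_finite_image (f := fun s => {A ∈ wallsBetween 𝓦 x y | s ∈ A})
    ((hW.finite x y).finite_subsets.subset ?_) ?_
  · rintro _ ⟨s, -, rfl⟩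
    exact Set.sep_subset _ _
  · intro s hs t ht hst
    refine hsep s t fun A hA => ?_
    have hAc := hW.compl_mem A hA
    have key : ∀ A ∈ 𝓦, x ∉ A → y ∈ A → (s ∈ A ↔ t ∈ A) := by
      intro A hA h1 h2
      have := Set.ext_iff.1 hst A
      exact ⟨fun h => (this.1 ⟨⟨hA, h1, h2⟩, h⟩).2, fun h => (this.2 ⟨⟨hA, h1, h2⟩, h⟩).2⟩
    by_cases h1 : x ∈ A <;> by_cases h2 : y ∈ A
    · exact iff_of_true (hs A hA h1 h2) (ht A hA h1 h2)
    · exact not_iff_not.1 (key Aᶜ hAc (not_not.2 h1) h2)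
    · exact key A hA h1 h2
    · exact iff_of_false (hs Aᶜ hAc h1 h2) (ht Aᶜ hAc h1 h2)

/-- The image of a vertex in the star of a point: itself over the point, and the outermost wall
separating it from the point elsewhere. -/
noncomputable def starRetract (𝓦 : Set (Set S)) (ρ : V → S) (s : S) (v : V) : V ⊕ Set S :=
  open Classical in if ρ v = s then .inl v else .inr (topWall 𝓦 s (ρ v))

theorem stabilizer_point_fg (hX : ∃ F : Set X.Simplex, F.Finite ∧ ∀ e, ∃ g : G, g • e ∈ F)
    [Nonempty V] (hW : IsWallSystem G 𝓦) (hsep : SeparatesPoints 𝓦) {ρ : V → S}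
    (hρ : ∀ (g : G) v, ρ (g • v) = g • ρ v)
    (hA : ∀ A ∈ 𝓦, (MulAction.stabilizer G A).FG) (hV : ∀ v : V, (MulAction.stabilizer G v).FG)
    (s : S) : (MulAction.stabilizer G s).FG := by
  obtain ⟨F, hF, hFX⟩ := hX
  obtain ⟨F', hF', hFF⟩ := exists_finite_stabilizer_orbits
    (hF.image fun e : X.Simplex => (e.1.1, e.1.2.1))
    (fun (p : V × V) s => ∀ A ∈ 𝓦, ρ p.1 ∈ A → ρ p.2 ∈ A → s ∈ A)
    (by
      intro g p s h A hA h1 h2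
      have := h (g⁻¹ • A) (hW.smul_mem _ A hA)
      simp only [Set.mem_inv_smul_set_iff, ← hρ] at this
      exact this h1 h2)
    (fun p => exists_finite_interval hW hsep _ _) s
  let r := starRetract 𝓦 ρ s
  have hr : ∀ k ∈ MulAction.stabilizer G s, ∀ v, r (k • v) = k • r v := by
    intro k hk v
    have hk' : k • s = s := hk
    have e : ρ (k • v) = s ↔ ρ v = s := by
      rw [hρ, ← hk', smul_left_cancel_iff, hk']
    by_cases h : ρ v = s
    · simp only [r, starRetract, if_pos h, if_pos (e.2 h), Sum.smul_inl]
    · simp only [r, starRetract, if_neg h, if_neg (mt e.1 h), Sum.smul_inr]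
      rw [← smul_topWall hW.smul_mem, hk', hρ]
  obtain ⟨v0⟩ := ‹Nonempty V›
  let R : V ⊕ Set S → V ⊕ Set S → Prop := fun p p' => p ≠ p' ∧ ∃ a b, X.R a b ∧ p = r a ∧ p' = r b
  have hconn : ∀ a b, Relation.ReflTransGen R (r a) (r b) := by
    intro a b
    induction X.conn a b with
    | refl => exact .refl
    | @tail c d _ h ih =>
      by_cases e : r c = r d
      · rwa [← e]
      · exact ih.tail ⟨e, c, d, h, rfl, rfl⟩
  refine fg_of_connected_action _ R (r v0) (fun k hk => ?_)
    (hF'.image fun f => (r f.1, r f.2)) ?_ ?_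
  · rw [← hr k hk]
    exact hconn _ _
  · rintro _ _ ⟨hne, a, b, hab, rfl, rfl⟩
    obtain ⟨k, hk, f, hf, e⟩ := hFF (a, b) (by
      obtain ⟨g, hg⟩ := hFX ⟨(a, b, b), hab, hab, X.refl b⟩
      exact ⟨g, _, hg, rfl⟩) (by
      intro A hA h1 h2
      by_contra hs
      have ha : ρ a ≠ s := fun h => hs (h ▸ h1)
      have hb : ρ b ≠ s := fun h => hs (h ▸ h2)
      refine hne ?_
      simp only [r, starRetract, if_neg ha, if_neg hb]
      rw [topWall_congr hW.nested hA hs h1 h2])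
    refine ⟨k, hk, _, ⟨f, hf, rfl⟩, ?_, ?_⟩
    · rw [← hr k hk, ← Prod.smul_fst, ← e]
    · rw [← hr k hk, ← Prod.smul_snd, ← e]
  · intro p hp
    have hpr : ∃ v, p = r v := by
      rcases Relation.ReflTransGen.cases_tail hp with rfl | ⟨q, -, -, a, b, -, -, h⟩
      · exact ⟨v0, rfl⟩
      · exact ⟨b, h⟩
    obtain ⟨v, rfl⟩ := hpr
    by_cases h : ρ v = s
    · have e1 : r v = .inl v := if_pos h
      have e : MulAction.stabilizer G (r v) ⊓ MulAction.stabilizer G s =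
          MulAction.stabilizer G v := by
        rw [e1]
        ext g
        constructor
        · rintro ⟨h1, -⟩
          exact Sum.inl_injective (show Sum.inl (g • v) = Sum.inl v from h1)
        · intro h1
          have h1' : g • v = v := h1
          refine ⟨congrArg Sum.inl h1', ?_⟩
          change g • s = s
          rw [← h, ← hρ, h1']
      rw [e]
      exact hV v
    · have e1 : r v = .inr (topWall 𝓦 s (ρ v)) := if_neg h
      have e : MulAction.stabilizer G (r v) ⊓ MulAction.stabilizer G s =
          MulAction.stabilizer G (topWall 𝓦 s (ρ v)) := by
        rw [e1]
        ext g
        constructor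
        · rintro ⟨h1, -⟩
          exact Sum.inr_injective (show Sum.inr (g • _) = Sum.inr _ from h1)
        · intro h1
          have h1' : g • topWall 𝓦 s (ρ v) = _ := h1
          exact ⟨congrArg Sum.inr h1', stabilizer_topWall_le hW hsep h h1⟩
      rw [e]
      exact hA _ (topWall_mem hW.nested hW.compl_mem hW.finite hsep h).1

end Finiteness

theorem IndexLeTwo.fg {G : Type*} [Group G] {K₀ K : Subgroup G} (h : IndexLeTwo K₀ K)
    (h0 : K₀.FG) : K.FG := by
  by_cases hK : K ≤ K₀
  · rwa [← h.1.antisymm hK]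
  obtain ⟨g, hg, hg0⟩ := SetLike.not_le_iff_exists.1 hK
  have e : K = K₀ ⊔ Subgroup.closure {g} := by
    refine le_antisymm (fun x hx => ?_) (sup_le h.1 ?_)
    · by_cases hx0 : x ∈ K₀
      · exact (le_sup_left : K₀ ≤ _) hx0
      · have h1 : g⁻¹ * x ∈ K₀ := h.2 g hg x hx hg0 hx0
        rw [← mul_inv_cancel_left g x]
        exact mul_mem ((le_sup_right : Subgroup.closure {g} ≤ _)
          (Subgroup.subset_closure rfl)) ((le_sup_left : K₀ ≤ _) h1)
    · rwa [Subgroup.closure_le, Set.singleton_subset_iff]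
  rw [e]
  exact h0.sup ⟨{g}, by simp⟩

theorem FlagComplex.exists_gtree {G V : Type u} [Group G] [MulAction G V] {X : FlagComplex G V}
    [Nonempty V] (hX : ∃ F : Set X.Simplex, F.Finite ∧ ∀ e, ∃ g : G, g • e ∈ F)
    (hfree : ∀ a b, X.R a b → a ≠ b → ∀ g : G, g • a = a → g • b = b → g = 1)
    {W : Set (Set V)} (hW : IsWallSystem G W) (ht : ∀ A ∈ W, X.Track A) :
    ∃ T : GTree G,
      (∀ a b, T.graph.Adj a b → ∃ A ∈ W, T.edgeStab a b = MulAction.stabilizer G A ∧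
        (T.edgeStab a b).FG) ∧
      (∀ w, (∃ e : X.Simplex, ∀ k ∈ T.vertexStab w, ∀ A ∈ W,
          k • e ∈ X.simplexWall A ↔ e ∈ X.simplexWall A) ∨
        ∃ A ∈ W, IndexLeTwo (MulAction.stabilizer G A) (T.vertexStab w)) ∧
      (∀ K : Subgroup G, (∃ v : V, ∀ k ∈ K, k • v = v) → T.EllipticSubgroup K) ∧
      ((∀ v : V, (MulAction.stabilizer G v).FG) → ∀ w, (T.vertexStab w).FG) := by
  obtain ⟨S, _, π, 𝓦, hπs, hπ, h𝓦, hsep, hpre⟩ :=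
    (X.isWallSystem_simplexWall hW).exists_quotient
  have hto : ∀ B ∈ 𝓦, ∃ A ∈ W, π ⁻¹' B = X.simplexWall A := by
    intro B hB
    obtain ⟨A, hA, h⟩ := hpre.symm.subset ⟨B, hB, rfl⟩
    exact ⟨A, hA, h.symm⟩
  have hfrom : ∀ A ∈ W, ∃ B ∈ 𝓦, π ⁻¹' B = X.simplexWall A := fun A hA =>
    hpre.subset ⟨A, hA, rfl⟩
  have hinj := hπs.preimage_injective
  have hpsm : ∀ (g : G) B, π ⁻¹' (g • B) = g • (π ⁻¹' B) := by
    intro g B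
    ext e
    rw [Set.mem_smul_set_iff_inv_smul_mem, Set.mem_preimage, Set.mem_preimage, hπ,
      Set.mem_smul_set_iff_inv_smul_mem]
  have hst : ∀ A B, π ⁻¹' B = X.simplexWall A →
      MulAction.stabilizer G B = MulAction.stabilizer G A := by
    intro A B h
    ext g
    rw [MulAction.mem_stabilizer_iff, MulAction.mem_stabilizer_iff, ← hinj.eq_iff, hpsm, h,
      ← X.simplexWall_smul, X.simplexWall_injective.eq_iff]
  have hA : ∀ A ∈ W, (MulAction.stabilizer G A).FG := fun A hA =>
    (ht A hA).stabilizer_fg hX hfree hW hA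
  have hB : ∀ B ∈ 𝓦, (MulAction.stabilizer G B).FG := by
    intro B hB
    obtain ⟨A, hAW, h⟩ := hto B hB
    rw [hst A B h]
    exact hA A hAW
  let δ : V → X.Simplex := fun v => ⟨(v, v, v), X.refl v, X.refl v, X.refl v⟩
  have hδ : ∀ (g : G) v, δ (g • v) = g • δ v := fun g v => rfl
  obtain ⟨v0⟩ := ‹Nonempty V›
  have : Nonempty V := ⟨v0⟩
  have : Nonempty S := ⟨π (δ v0)⟩
  have hunit : ∀ B ∈ 𝓦, ∃ s, JustInside 𝓦 B s := by
    intro B hBW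
    obtain ⟨A, hAW, h⟩ := hto B hBW
    obtain ⟨e, he, hout⟩ := X.exists_justInside hW ht hAW
    refine ⟨π e, ?_, fun B' hB' hlt => ?_⟩
    · rw [← h] at he
      exact he
    · obtain ⟨A', hAW', h'⟩ := hto B' hB'
      have := hout _ ⟨A', hAW', rfl⟩ (by
        rw [← h, ← h']
        exact ⟨Set.preimage_mono hlt.1, fun h => hlt.2 (hπs.preimage_subset_preimage_iff.1 h)⟩)
      rwa [← h'] at this
  have hS : ∃ F : Set S, F.Finite ∧ ∀ s, ∃ g : G, g • s ∈ F := by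
    obtain ⟨F, hF, hFX⟩ := hX
    refine ⟨π '' F, hF.image π, fun s => ?_⟩
    obtain ⟨e, rfl⟩ := hπs s
    obtain ⟨g, hg⟩ := hFX e
    exact ⟨g, g • e, hg, hπ g e⟩
  have hWF : ∃ F : Set (Set S), F.Finite ∧ ∀ B ∈ 𝓦, ∃ g : G, g • B ∈ F := by
    obtain ⟨F, hF, hFW⟩ := X.exists_finite_walls hX hW ht
    refine ⟨(fun B => π ⁻¹' B) ⁻¹' (X.simplexWall '' F),
      (hF.image _).preimage hinj.injOn, fun B hBW => ?_⟩
    obtain ⟨A, hAW, h⟩ := hto B hBW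
    obtain ⟨g, hg⟩ := hFW A hAW
    exact ⟨g, g • A, hg, by beta_reduce; rw [hpsm, h, X.simplexWall_smul]⟩
  obtain ⟨T, h1, h2, h3⟩ := exists_dual_gtree h𝓦 hsep hunit hS hWF
  refine ⟨T, ?_, ?_, ?_, ?_⟩
  · intro a b hab
    obtain ⟨B, hBW, e⟩ := h1 a b hab
    obtain ⟨A, hAW, h⟩ := hto B hBW
    rw [e, hst A B h]
    exact ⟨A, hAW, rfl, hA A hAW⟩
  · intro w
    rcases h2 w with ⟨s, hs⟩ | ⟨B, hBW, hs⟩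
    · obtain ⟨e, rfl⟩ := hπs s
      refine Or.inl ⟨e, fun k hk A hAW => ?_⟩
      rw [hs] at hk
      obtain ⟨B, hBW, h⟩ := hfrom A hAW
      rw [← h, Set.mem_preimage, Set.mem_preimage, hπ, MulAction.mem_stabilizer_iff.1 hk]
    · obtain ⟨A, hAW, h⟩ := hto B hBW
      exact Or.inr ⟨A, hAW, hst A B h ▸ hs⟩
  · rintro K ⟨v, hv⟩
    exact h3 K ⟨π (δ v), fun k hk => by rw [← hπ, ← hδ, hv k hk]⟩
  · intro hV w
    rcases h2 w with ⟨s, hs⟩ | ⟨B, hBW, hs⟩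
    · rw [hs]
      exact stabilizer_point_fg hX h𝓦 hsep (ρ := fun v => π (δ v))
        (fun g v => by rw [hδ, hπ]) hB hV s
    · exact hs.fg (hB B hBW)

/-- The action on the vertices of a `G`-tree. -/
@[reducible]
def GTree.mulAction {G : Type u} [Group G] (T : GTree G) : MulAction G T.V where
  smul := T.act
  one_smul := T.act_one
  mul_smul := T.act_mul

/-- Existence of the relative JSJ tree for groups finitely presented
relative to a finite family of subgroups. -/
theorem relative_jsj_existence {G : Type u} [Group G] (hfg : Group.FG G)
    (𝒜 : Set (Subgroup G)) (h𝒜 : ClosedFamily 𝒜)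
    {p : ℕ} (H : Fin p → Subgroup G) (hfp : RelFinitelyPresented H) :
    ∃ T : GTree G, RelATree 𝒜 (Set.range H) T ∧ RelUnivEllipticTree 𝒜 (Set.range H) T ∧
      (∀ T' : GTree G, RelATree 𝒜 (Set.range H) T' →
        RelUnivEllipticTree 𝒜 (Set.range H) T' → T.Dominates T') ∧
      (∀ a b : T.V, T.graph.Adj a b → (T.edgeStab a b).FG) ∧
      ((∀ j : Fin p, (H j).FG) → ∀ w : T.V, (T.vertexStab w).FG) := by
  obtain ⟨V, _, X, _, hX, hfree, hstab, hell⟩ := hfp.exists_flagComplex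
  obtain ⟨W, ⟨hW, hWA⟩, hmax⟩ := X.exists_maximal_walls hfg hX
    (fun W => IsWallSystem G W ∧ ∀ A ∈ W, X.Track A ∧ MulAction.stabilizer G A ∈ 𝒜 ∧
      RelUnivEllipticSubgroup 𝒜 (Set.range H) (MulAction.stabilizer G A))
    (fun W h => ⟨h.1, fun A hA => (h.2 A hA).1⟩)
    ⟨⟨by simp, by simp, by simp, fun x y => by simp [wallsBetween]⟩, by simp⟩
  have ht : ∀ A ∈ W, X.Track A := fun A hA => (hWA A hA).1
  obtain ⟨T, hedge, hvert, hTell, hTfg⟩ := X.exists_gtree hX hfree hW ht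
  refine ⟨T, ⟨?_, ?_⟩, ?_, ?_, ?_, ?_⟩
  · intro a b hab
    obtain ⟨A, hA, e, -⟩ := hedge a b hab
    rw [e]
    exact (hWA A hA).2.1
  · rintro _ ⟨j, rfl⟩
    exact hTell _ (hell j)
  · intro a b hab
    obtain ⟨A, hA, e, -⟩ := hedge a b hab
    rw [e]
    exact (hWA A hA).2.2
  · rintro T' hT' hU' K ⟨w, hw⟩
    suffices T'.EllipticSubgroup (T.vertexStab w) by
      obtain ⟨u, hu⟩ := this
      exact ⟨u, fun k hk => hu k (hw k hk)⟩
    let _ := T'.mulAction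
    have hT : T'.graph.IsTree := ⟨T'.connected, T'.acyclic⟩
    have hWU : ∀ A ∈ W, ∃ u : T'.V, ∀ g ∈ MulAction.stabilizer G A, g • u = u :=
      fun A hA => (hWA A hA).2.2 T' hT'
    rcases hvert w with ⟨e, he⟩ | ⟨A, hA, hi⟩
    · refine X.elliptic_of_maximal hW ht hT T'.act_adj hWU (fun v => ?_) (fun W' hW' h' hWW' => ?_)
        he
      · rcases hstab v with h | ⟨j, g, h⟩
        · obtain ⟨u⟩ := T'.nonempty
          exact ⟨u, fun g hg => by rw [h g hg, one_smul]⟩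
        · obtain ⟨u, hu⟩ := hT'.2 _ ⟨j, rfl⟩
          refine ⟨g • u, fun x hx => ?_⟩
          obtain ⟨y, hy, rfl⟩ := h.le (show x ∈ MulAction.stabilizer G v from hx)
          have hy' : y • u = u := hu y hy
          change (g * y * g⁻¹) • g • u = g • u
          rw [mul_smul, inv_smul_smul, mul_smul, hy']
      · refine hmax W' ⟨hW', fun A hA => ⟨(h' A hA).1, ?_⟩⟩ hWW'
        have hmono : ∀ K L : Subgroup G, K ≤ L → L ∈ 𝒜 →
            RelUnivEllipticSubgroup 𝒜 (Set.range H) L →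
            K ∈ 𝒜 ∧ RelUnivEllipticSubgroup 𝒜 (Set.range H) K := by
          intro K L hKL h1 h2
          refine ⟨h𝒜.2 L h1 K hKL, fun T hT => ?_⟩
          obtain ⟨u, hu⟩ := h2 T hT
          exact ⟨u, fun k hk => hu k (hKL hk)⟩
        rcases (h' A hA).2 with ⟨B, hB, hle⟩ | ⟨u, u', hadj, hle⟩
        · exact hmono _ _ hle (hWA B hB).2.1 (hWA B hB).2.2
        · exact hmono _ (T'.edgeStab u u') hle (hT'.1 u u' hadj) (hU' u u' hadj)
    · exact elliptic_of_indexLeTwo hT T'.act_adj T'.noInversion hi (hWU A hA)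
  · intro a b hab
    obtain ⟨A, hA, -, h⟩ := hedge a b hab
    exact h
  · intro hH
    refine hTfg fun v => ?_
    rcases hstab v with h | ⟨j, g, h⟩
    · rw [show MulAction.stabilizer G v = ⊥ from eq_bot_iff.2 fun g hg => h g hg]
      exact Subgroup.FG.bot
    · rw [h]
      exact (hH j).map_hom _
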